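/- arXiv:1008.2604 — 2 statements merged into one kernel-verified Lean document; each statement's English description precedes it below -/
import Mathlib

section
/- Let n ≥ 1, let Ω ⊆ ℝⁿ be an open set, and let f : Ω → ℝ be a smooth function whose Hessian matrix H(x) = (∂²f/∂xᵢ∂xⱼ(x)) is positive definite at every x ∈ Ω. Assume det H is constant on Ω (equivalently, the invariant Φ = (Σᵢⱼ H^{ij} ∂ᵢρ ∂ⱼρ)/ρ² with ρ = (det H)^{−1/(n+2)} vanishes identically), and assume the Calabi metric g = Σ fᵢⱼ dxᵢ dxⱼ on Ω is complete. Then f is a quadratic polynomial: there exist a symmetric positive definite n×n real matrix A, a vector b ∈ ℝⁿ, and c ∈ ℝ such that f(x) = (1/2)⟨Ax, x⟩ + ⟨b, x⟩ + c for all x ∈ Ω. -/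
open Matrix

/-- Partial derivative `∂u/∂xᵢ` of a function `u : ℝⁿ → ℝ`. -/
noncomputable def pder (n : ℕ) (i : Fin n) (u : (Fin n → ℝ) → ℝ) (x : Fin n → ℝ) : ℝ :=
  fderiv ℝ u x (Pi.single i 1)

/-- Hessian matrix `H(x) = (∂²f/∂xᵢ∂xⱼ(x))`. -/
noncomputable def Hess (n : ℕ) (f : (Fin n → ℝ) → ℝ) (x : Fin n → ℝ) :
    Matrix (Fin n) (Fin n) ℝ :=
  Matrix.of fun i j => pder n i (pder n j f) x

/-- `ρ = (det H)^(−1/(n+2))`. -/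
noncomputable def rho (n : ℕ) (f : (Fin n → ℝ) → ℝ) (x : Fin n → ℝ) : ℝ :=
  (Hess n f x).det ^ (-(1 : ℝ) / ((n : ℝ) + 2))

/-- `⟨∇u, ∇v⟩_g = Σᵢⱼ H^{ij} ∂ᵢu ∂ⱼv` with respect to the Calabi metric of `f`. -/
noncomputable def gradInner (n : ℕ) (f u v : (Fin n → ℝ) → ℝ) (x : Fin n → ℝ) : ℝ :=
  ∑ i, ∑ j, (Hess n f x)⁻¹ i j * pder n i u x * pder n j v x

/-- `Φ = ‖∇ρ‖²_g / ρ²`. -/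
noncomputable def Phi (n : ℕ) (f : (Fin n → ℝ) → ℝ) (x : Fin n → ℝ) : ℝ :=
  gradInner n f (rho n f) (rho n f) x / (rho n f x) ^ 2

/-- Laplace–Beltrami operator of the Calabi metric:
`Δ_g u = (det H)^{−1/2} Σᵢ ∂ᵢ( (det H)^{1/2} Σⱼ H^{ij} ∂ⱼu )`. -/
noncomputable def lapBel (n : ℕ) (f u : (Fin n → ℝ) → ℝ) (x : Fin n → ℝ) : ℝ :=
  (Hess n f x).det ^ (-(1 : ℝ) / 2) *
    ∑ i, pder n i (fun y => (Hess n f y).det ^ ((1 : ℝ) / 2) *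
      ∑ j, (Hess n f y)⁻¹ i j * pder n j u y) x

/-- Completeness of the Calabi metric `g = Σ fᵢⱼ dxᵢ dxⱼ` on `Ω`: every C¹ curve
`γ : [0,1) → Ω` eventually leaving every compact subset of `Ω` has infinite length. -/
def CalabiComplete (n : ℕ) (Ω : Set (Fin n → ℝ)) (f : (Fin n → ℝ) → ℝ) : Prop :=
  ∀ γ : ℝ → (Fin n → ℝ), ContDiffOn ℝ 1 γ (Set.Ico (0 : ℝ) 1) →
    (∀ t ∈ Set.Ico (0 : ℝ) 1, γ t ∈ Ω) →
    (∀ K : Set (Fin n → ℝ), K ⊆ Ω → IsCompact K →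
      ∃ t₀, t₀ < 1 ∧ ∀ t, t₀ < t → t < 1 → γ t ∉ K) →
    ∫⁻ t in Set.Ioo (0 : ℝ) 1,
      ENNReal.ofReal (Real.sqrt ((Hess n f (γ t)).mulVec (deriv γ t) ⬝ᵥ deriv γ t)) = ⊤

/-- `f` coincides on `Ω` with a quadratic polynomial with symmetric positive definite
quadratic part. -/
def IsQuadraticOn (n : ℕ) (Ω : Set (Fin n → ℝ)) (f : (Fin n → ℝ) → ℝ) : Prop :=
  ∃ A : Matrix (Fin n) (Fin n) ℝ, A.IsSymm ∧ A.PosDef ∧ ∃ b : Fin n → ℝ, ∃ c : ℝ,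
    ∀ x ∈ Ω, f x = (1 / 2) * (A.mulVec x ⬝ᵥ x) + b ⬝ᵥ x + c



set_option linter.unusedSimpArgs false
set_option linter.unusedVariables false
set_option linter.unusedTactic false
set_option linter.unreachableTactic false

section algebra
variable {n : ℕ}

def oo1 (M : Fin n → Fin n → ℝ) (A : Fin n → Fin n → Fin n → ℝ) : Fin n → Fin n → Fin n → ℝ :=
  fun i j k => ∑ l, M i l * A l j k
def oo2 (M : Fin n → Fin n → ℝ) (A : Fin n → Fin n → Fin n → ℝ) : Fin n → Fin n → Fin n → ℝ :=
  fun i j k => ∑ l, M j l * A i l k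
def oo3 (M : Fin n → Fin n → ℝ) (A : Fin n → Fin n → Fin n → ℝ) : Fin n → Fin n → Fin n → ℝ :=
  fun i j k => ∑ l, M k l * A i j l

def ip3 (A B : Fin n → Fin n → Fin n → ℝ) : ℝ := ∑ i, ∑ j, ∑ k, A i j k * B i j k

lemma ip3_add (A B C : Fin n → Fin n → Fin n → ℝ) : ip3 A (B + C) = ip3 A B + ip3 A C := by
  simp [ip3, mul_add, Finset.sum_add_distrib]

lemma ip3_sub (A B C : Fin n → Fin n → Fin n → ℝ) : ip3 A (B - C) = ip3 A B - ip3 A C := by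
  simp [ip3, mul_sub, Finset.sum_sub_distrib]

lemma ip3_smul (A B : Fin n → Fin n → Fin n → ℝ) (c : ℝ) : ip3 A (c • B) = c * ip3 A B := by
  simp only [ip3, Pi.smul_apply, smul_eq_mul, Finset.mul_sum]
  refine Finset.sum_congr rfl fun i _ => Finset.sum_congr rfl fun j _ =>
    Finset.sum_congr rfl fun k _ => by ring

lemma ip3_comm (A B : Fin n → Fin n → Fin n → ℝ) : ip3 A B = ip3 B A := by
  simp only [ip3, mul_comm]

abbrev T4 (n : ℕ) := Fin n × Fin n × Fin n × Fin n
abbrev T5 (n : ℕ) := Fin n × Fin n × Fin n × Fin n × Fin n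
abbrev T6 (n : ℕ) := Fin n × Fin n × Fin n × Fin n × Fin n × Fin n

def ZZ (A : Fin n → Fin n → Fin n → ℝ) : ℝ :=
  ∑ p : T6 n, match p with
    | (i, j, k, l, s, t) => A i j s * A k l s * (A i j t * A k l t)
def YY (A : Fin n → Fin n → Fin n → ℝ) : ℝ :=
  ∑ p : T6 n, match p with
    | (i, j, k, l, s, t) => A i j s * A k l s * (A i k t * A j l t)
def XX (A : Fin n → Fin n → Fin n → ℝ) (B : Fin n → Fin n → Fin n → Fin n → ℝ) : ℝ :=
  ∑ p : T5 n, match p with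
    | (i, j, k, l, s) => B i j k l * (A i j s * A k l s)

lemma adj1 (A : Fin n → Fin n → Fin n → ℝ) (M : Fin n → Fin n → ℝ) (hM : ∀ a b, M a b = M b a)
    (S : Fin n → Fin n → Fin n → ℝ) : ip3 A (oo1 M S) = ip3 S (oo1 M A) := by
  have := Fintype.sum_equiv (ι := T4 n) (κ := T4 n)
    ⟨fun (i,j,k,l) => (l,j,k,i), fun (i,j,k,l) => (l,j,k,i), fun _ => rfl, fun _ => rfl⟩
    (fun (i,j,k,l) => A i j k * (M i l * S l j k)) (fun (i,j,k,l) => S i j k * (M i l * A l j k))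
    (by rintro ⟨i,j,k,l⟩; simp only [Equiv.coe_fn_mk]; rw [hM]; ring)
  simp only [Fintype.sum_prod_type] at this
  simpa only [ip3, oo1, Finset.mul_sum] using this

lemma adj2 (A : Fin n → Fin n → Fin n → ℝ) (M : Fin n → Fin n → ℝ) (hM : ∀ a b, M a b = M b a)
    (S : Fin n → Fin n → Fin n → ℝ) : ip3 A (oo2 M S) = ip3 S (oo2 M A) := by
  have := Fintype.sum_equiv (ι := T4 n) (κ := T4 n)
    ⟨fun (i,j,k,l) => (i,l,k,j), fun (i,j,k,l) => (i,l,k,j), fun _ => rfl, fun _ => rfl⟩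
    (fun (i,j,k,l) => A i j k * (M j l * S i l k)) (fun (i,j,k,l) => S i j k * (M j l * A i l k))
    (by rintro ⟨i,j,k,l⟩; simp only [Equiv.coe_fn_mk]; rw [hM]; ring)
  simp only [Fintype.sum_prod_type] at this
  simpa only [ip3, oo2, Finset.mul_sum] using this

lemma adj3 (A : Fin n → Fin n → Fin n → ℝ) (M : Fin n → Fin n → ℝ) (hM : ∀ a b, M a b = M b a)
    (S : Fin n → Fin n → Fin n → ℝ) : ip3 A (oo3 M S) = ip3 S (oo3 M A) := by
  have := Fintype.sum_equiv (ι := T4 n) (κ := T4 n)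
    ⟨fun (i,j,k,l) => (i,j,l,k), fun (i,j,k,l) => (i,j,l,k), fun _ => rfl, fun _ => rfl⟩
    (fun (i,j,k,l) => A i j k * (M k l * S i j l)) (fun (i,j,k,l) => S i j k * (M k l * A i j l))
    (by rintro ⟨i,j,k,l⟩; simp only [Equiv.coe_fn_mk]; rw [hM]; ring)
  simp only [Fintype.sum_prod_type] at this
  simpa only [ip3, oo3, Finset.mul_sum] using this


lemma Y23 (A : Fin n → Fin n → Fin n → ℝ)  (hA1 : ∀ a b c, A a b c = A b a c) (hA2 : ∀ a b c, A a b c = A a c b) :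
    ∑ s, ip3 A (oo2 (A s) (oo3 (A s) A)) = YY A := by
  have := Fintype.sum_equiv (ι := T6 n) (κ := T6 n)
    ⟨fun (s,i,j,k,l,m) => (l,m,j,k,i,s), fun (i,j,k,l,s,t) => (t,s,k,l,i,j), fun _ => rfl, fun _ => rfl⟩
    (fun (s,i,j,k,l,m) => A i j k * (A s j l * (A s k m * A i l m))) (fun (i,j,k,l,s,t) => A i j s * A k l s * (A i k t * A j l t))
    (by rintro ⟨s,i,j,k,l,m⟩; simp only [Equiv.coe_fn_mk]; (try simp only [hA1, hA2]); (try ring))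
  simp only [Fintype.sum_prod_type] at this
  simpa only [ip3, oo1, oo2, oo3, YY, Finset.mul_sum, Finset.sum_mul, Fintype.sum_prod_type] using this

lemma Y13 (A : Fin n → Fin n → Fin n → ℝ)  (hA1 : ∀ a b c, A a b c = A b a c) (hA2 : ∀ a b c, A a b c = A a c b) :
    ∑ s, ip3 A (oo1 (A s) (oo3 (A s) A)) = YY A := by
  have := Fintype.sum_equiv (ι := T6 n) (κ := T6 n)
    ⟨fun (s,i,j,k,l,m) => (l,m,i,k,j,s), fun (i,j,k,l,s,t) => (t,k,s,l,i,j), fun _ => rfl, fun _ => rfl⟩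
    (fun (s,i,j,k,l,m) => A i j k * (A s i l * (A s k m * A l j m))) (fun (i,j,k,l,s,t) => A i j s * A k l s * (A i k t * A j l t))
    (by rintro ⟨s,i,j,k,l,m⟩; simp only [Equiv.coe_fn_mk]; (try simp only [hA1, hA2]); (try ring))
  simp only [Fintype.sum_prod_type] at this
  simpa only [ip3, oo1, oo2, oo3, YY, Finset.mul_sum, Finset.sum_mul, Fintype.sum_prod_type] using this

lemma Y12 (A : Fin n → Fin n → Fin n → ℝ)  (hA1 : ∀ a b c, A a b c = A b a c) (hA2 : ∀ a b c, A a b c = A a c b) :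
    ∑ s, ip3 A (oo1 (A s) (oo2 (A s) A)) = YY A := by
  have := Fintype.sum_equiv (ι := T6 n) (κ := T6 n)
    ⟨fun (s,i,j,k,l,m) => (l,m,i,j,k,s), fun (i,j,k,l,s,t) => (t,k,l,s,i,j), fun _ => rfl, fun _ => rfl⟩
    (fun (s,i,j,k,l,m) => A i j k * (A s i l * (A s j m * A l m k))) (fun (i,j,k,l,s,t) => A i j s * A k l s * (A i k t * A j l t))
    (by rintro ⟨s,i,j,k,l,m⟩; simp only [Equiv.coe_fn_mk]; (try simp only [hA1, hA2]); (try ring))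
  simp only [Fintype.sum_prod_type] at this
  simpa only [ip3, oo1, oo2, oo3, YY, Finset.mul_sum, Finset.sum_mul, Fintype.sum_prod_type] using this

lemma X1 (A : Fin n → Fin n → Fin n → ℝ) (B : Fin n → Fin n → Fin n → Fin n → ℝ) (hA1 : ∀ a b c, A a b c = A b a c) (hA2 : ∀ a b c, A a b c = A a c b) :
    ∑ s, ip3 (B s) (oo1 (A s) A) = XX A B := by
  have := Fintype.sum_equiv (ι := T5 n) (κ := T5 n)
    ⟨fun (s,i,j,k,l) => (s,i,j,k,l), fun (i,j,k,l,s) => (i,j,k,l,s), fun _ => rfl, fun _ => rfl⟩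
    (fun (s,i,j,k,l) => B s i j k * (A s i l * A l j k)) (fun (i,j,k,l,s) => B i j k l * (A i j s * A k l s))
    (by rintro ⟨s,i,j,k,l⟩; simp only [Equiv.coe_fn_mk]; (try simp only [hA1, hA2]); (try ring))
  simp only [Fintype.sum_prod_type] at this
  simpa only [ip3, oo1, oo2, oo3, XX, Finset.mul_sum, Finset.sum_mul, Fintype.sum_prod_type] using this

lemma X2 (A : Fin n → Fin n → Fin n → ℝ) (B : Fin n → Fin n → Fin n → Fin n → ℝ) (hA1 : ∀ a b c, A a b c = A b a c) (hA2 : ∀ a b c, A a b c = A a c b) (hB1 : ∀ a b c d, B a b c d = B b a c d) (hB2 : ∀ a b c d, B a b c d = B a c b d) (hB3 : ∀ a b c d, B a b c d = B a b d c) :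
    ∑ s, ip3 (B s) (oo2 (A s) A) = XX A B := by
  have := Fintype.sum_equiv (ι := T5 n) (κ := T5 n)
    ⟨fun (s,i,j,k,l) => (s,j,i,k,l), fun (i,j,k,l,s) => (i,k,j,l,s), fun _ => rfl, fun _ => rfl⟩
    (fun (s,i,j,k,l) => B s i j k * (A s j l * A i l k)) (fun (i,j,k,l,s) => B i j k l * (A i j s * A k l s))
    (by rintro ⟨s,i,j,k,l⟩; simp only [Equiv.coe_fn_mk]; (try simp only [hA1, hA2, hB1, hB2, hB3]); (try ring))
  simp only [Fintype.sum_prod_type] at this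
  simpa only [ip3, oo1, oo2, oo3, XX, Finset.mul_sum, Finset.sum_mul, Fintype.sum_prod_type] using this

lemma X3 (A : Fin n → Fin n → Fin n → ℝ) (B : Fin n → Fin n → Fin n → Fin n → ℝ) (hA1 : ∀ a b c, A a b c = A b a c) (hA2 : ∀ a b c, A a b c = A a c b) (hB1 : ∀ a b c d, B a b c d = B b a c d) (hB2 : ∀ a b c d, B a b c d = B a c b d) (hB3 : ∀ a b c d, B a b c d = B a b d c) :
    ∑ s, ip3 (B s) (oo3 (A s) A) = XX A B := by
  have := Fintype.sum_equiv (ι := T5 n) (κ := T5 n)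
    ⟨fun (s,i,j,k,l) => (s,k,i,j,l), fun (i,j,k,l,s) => (i,k,l,j,s), fun _ => rfl, fun _ => rfl⟩
    (fun (s,i,j,k,l) => B s i j k * (A s k l * A i j l)) (fun (i,j,k,l,s) => B i j k l * (A i j s * A k l s))
    (by rintro ⟨s,i,j,k,l⟩; simp only [Equiv.coe_fn_mk]; (try simp only [hA1, hA2, hB1, hB2, hB3]); (try ring))
  simp only [Fintype.sum_prod_type] at this
  simpa only [ip3, oo1, oo2, oo3, XX, Finset.mul_sum, Finset.sum_mul, Fintype.sum_prod_type] using this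

lemma PP11 (A : Fin n → Fin n → Fin n → ℝ)  (hA1 : ∀ a b c, A a b c = A b a c) (hA2 : ∀ a b c, A a b c = A a c b) :
    ∑ s, ip3 (oo1 (A s) A) (oo1 (A s) A) = ZZ A := by
  have := Fintype.sum_equiv (ι := T6 n) (κ := T6 n)
    ⟨fun (s,i,j,k,m,l) => (s,i,j,k,l,m), fun (i,j,k,l,s,t) => (i,j,k,l,t,s), fun _ => rfl, fun _ => rfl⟩
    (fun (s,i,j,k,m,l) => A s i l * A l j k * (A s i m * A m j k)) (fun (i,j,k,l,s,t) => A i j s * A k l s * (A i j t * A k l t))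
    (by rintro ⟨s,i,j,k,m,l⟩; simp only [Equiv.coe_fn_mk]; (try simp only [hA1, hA2]); (try ring))
  simp only [Fintype.sum_prod_type] at this
  simpa only [ip3, oo1, oo2, oo3, ZZ, Finset.mul_sum, Finset.sum_mul, Fintype.sum_prod_type] using this

lemma PP22 (A : Fin n → Fin n → Fin n → ℝ)  (hA1 : ∀ a b c, A a b c = A b a c) (hA2 : ∀ a b c, A a b c = A a c b) :
    ∑ s, ip3 (oo2 (A s) A) (oo2 (A s) A) = ZZ A := by
  have := Fintype.sum_equiv (ι := T6 n) (κ := T6 n)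
    ⟨fun (s,i,j,k,m,l) => (s,j,i,k,l,m), fun (i,j,k,l,s,t) => (i,k,j,l,t,s), fun _ => rfl, fun _ => rfl⟩
    (fun (s,i,j,k,m,l) => A s j l * A i l k * (A s j m * A i m k)) (fun (i,j,k,l,s,t) => A i j s * A k l s * (A i j t * A k l t))
    (by rintro ⟨s,i,j,k,m,l⟩; simp only [Equiv.coe_fn_mk]; (try simp only [hA1, hA2]); (try ring))
  simp only [Fintype.sum_prod_type] at this
  simpa only [ip3, oo1, oo2, oo3, ZZ, Finset.mul_sum, Finset.sum_mul, Fintype.sum_prod_type] using this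

lemma PP33 (A : Fin n → Fin n → Fin n → ℝ)  (hA1 : ∀ a b c, A a b c = A b a c) (hA2 : ∀ a b c, A a b c = A a c b) :
    ∑ s, ip3 (oo3 (A s) A) (oo3 (A s) A) = ZZ A := by
  have := Fintype.sum_equiv (ι := T6 n) (κ := T6 n)
    ⟨fun (s,i,j,k,m,l) => (s,k,i,j,l,m), fun (i,j,k,l,s,t) => (i,k,l,j,t,s), fun _ => rfl, fun _ => rfl⟩
    (fun (s,i,j,k,m,l) => A s k l * A i j l * (A s k m * A i j m)) (fun (i,j,k,l,s,t) => A i j s * A k l s * (A i j t * A k l t))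
    (by rintro ⟨s,i,j,k,m,l⟩; simp only [Equiv.coe_fn_mk]; (try simp only [hA1, hA2]); (try ring))
  simp only [Fintype.sum_prod_type] at this
  simpa only [ip3, oo1, oo2, oo3, ZZ, Finset.mul_sum, Finset.sum_mul, Fintype.sum_prod_type] using this

lemma PP12 (A : Fin n → Fin n → Fin n → ℝ)  (hA1 : ∀ a b c, A a b c = A b a c) (hA2 : ∀ a b c, A a b c = A a c b) :
    ∑ s, ip3 (oo1 (A s) A) (oo2 (A s) A) = YY A := by
  have := Fintype.sum_equiv (ι := T6 n) (κ := T6 n)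
    ⟨fun (s,i,j,k,m,l) => (s,i,j,k,l,m), fun (i,j,k,l,s,t) => (i,j,k,l,t,s), fun _ => rfl, fun _ => rfl⟩
    (fun (s,i,j,k,m,l) => A s i l * A l j k * (A s j m * A i m k)) (fun (i,j,k,l,s,t) => A i j s * A k l s * (A i k t * A j l t))
    (by rintro ⟨s,i,j,k,m,l⟩; simp only [Equiv.coe_fn_mk]; (try simp only [hA1, hA2]); (try ring))
  simp only [Fintype.sum_prod_type] at this
  simpa only [ip3, oo1, oo2, oo3, YY, Finset.mul_sum, Finset.sum_mul, Fintype.sum_prod_type] using this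

lemma PP13 (A : Fin n → Fin n → Fin n → ℝ)  (hA1 : ∀ a b c, A a b c = A b a c) (hA2 : ∀ a b c, A a b c = A a c b) :
    ∑ s, ip3 (oo1 (A s) A) (oo3 (A s) A) = YY A := by
  have := Fintype.sum_equiv (ι := T6 n) (κ := T6 n)
    ⟨fun (s,i,j,k,m,l) => (s,i,k,j,l,m), fun (i,j,k,l,s,t) => (i,j,l,k,t,s), fun _ => rfl, fun _ => rfl⟩
    (fun (s,i,j,k,m,l) => A s i l * A l j k * (A s k m * A i j m)) (fun (i,j,k,l,s,t) => A i j s * A k l s * (A i k t * A j l t))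
    (by rintro ⟨s,i,j,k,m,l⟩; simp only [Equiv.coe_fn_mk]; (try simp only [hA1, hA2]); (try ring))
  simp only [Fintype.sum_prod_type] at this
  simpa only [ip3, oo1, oo2, oo3, YY, Finset.mul_sum, Finset.sum_mul, Fintype.sum_prod_type] using this

lemma PP23 (A : Fin n → Fin n → Fin n → ℝ)  (hA1 : ∀ a b c, A a b c = A b a c) (hA2 : ∀ a b c, A a b c = A a c b) :
    ∑ s, ip3 (oo2 (A s) A) (oo3 (A s) A) = YY A := by
  have := Fintype.sum_equiv (ι := T6 n) (κ := T6 n)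
    ⟨fun (s,i,j,k,m,l) => (s,j,k,i,l,m), fun (i,j,k,l,s,t) => (i,l,j,k,t,s), fun _ => rfl, fun _ => rfl⟩
    (fun (s,i,j,k,m,l) => A s j l * A i l k * (A s k m * A i j m)) (fun (i,j,k,l,s,t) => A i j s * A k l s * (A i k t * A j l t))
    (by rintro ⟨s,i,j,k,m,l⟩; simp only [Equiv.coe_fn_mk]; (try simp only [hA1, hA2]); (try ring))
  simp only [Fintype.sum_prod_type] at this
  simpa only [ip3, oo1, oo2, oo3, YY, Finset.mul_sum, Finset.sum_mul, Fintype.sum_prod_type] using this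

lemma C1 (A : Fin n → Fin n → Fin n → ℝ) (B : Fin n → Fin n → Fin n → Fin n → ℝ) (hA1 : ∀ a b c, A a b c = A b a c) (hA2 : ∀ a b c, A a b c = A a c b) :
    ip3 A (fun i j k => ∑ a, ∑ b, A a b k * B a b i j) = XX A B := by
  have := Fintype.sum_equiv (ι := T5 n) (κ := T5 n)
    ⟨fun (i,j,k,a,b) => (a,b,i,j,k), fun (i,j,k,l,s) => (k,l,s,i,j), fun _ => rfl, fun _ => rfl⟩
    (fun (i,j,k,a,b) => A i j k * (A a b k * B a b i j)) (fun (i,j,k,l,s) => B i j k l * (A i j s * A k l s))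
    (by rintro ⟨i,j,k,a,b⟩; simp only [Equiv.coe_fn_mk]; (try simp only [hA1, hA2]); (try ring))
  simp only [Fintype.sum_prod_type] at this
  simpa only [ip3, oo1, oo2, oo3, XX, Finset.mul_sum, Finset.sum_mul, Fintype.sum_prod_type] using this

lemma C2 (A : Fin n → Fin n → Fin n → ℝ) (B : Fin n → Fin n → Fin n → Fin n → ℝ) (hA1 : ∀ a b c, A a b c = A b a c) (hA2 : ∀ a b c, A a b c = A a c b) (hB1 : ∀ a b c d, B a b c d = B b a c d) (hB2 : ∀ a b c d, B a b c d = B a c b d) (hB3 : ∀ a b c d, B a b c d = B a b d c) :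
    ip3 A (fun i j k => ∑ a, ∑ b, A a b j * B a b i k) = XX A B := by
  have := Fintype.sum_equiv (ι := T5 n) (κ := T5 n)
    ⟨fun (i,j,k,a,b) => (a,b,i,k,j), fun (i,j,k,l,s) => (k,s,l,i,j), fun _ => rfl, fun _ => rfl⟩
    (fun (i,j,k,a,b) => A i j k * (A a b j * B a b i k)) (fun (i,j,k,l,s) => B i j k l * (A i j s * A k l s))
    (by rintro ⟨i,j,k,a,b⟩; simp only [Equiv.coe_fn_mk]; (try simp only [hA1, hA2, hB1, hB2, hB3]); (try ring))
  simp only [Fintype.sum_prod_type] at this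
  simpa only [ip3, oo1, oo2, oo3, XX, Finset.mul_sum, Finset.sum_mul, Fintype.sum_prod_type] using this

lemma C3 (A : Fin n → Fin n → Fin n → ℝ) (B : Fin n → Fin n → Fin n → Fin n → ℝ) (hA1 : ∀ a b c, A a b c = A b a c) (hA2 : ∀ a b c, A a b c = A a c b) (hB1 : ∀ a b c d, B a b c d = B b a c d) (hB2 : ∀ a b c d, B a b c d = B a c b d) (hB3 : ∀ a b c d, B a b c d = B a b d c) :
    ip3 A (fun i j k => ∑ a, ∑ b, A a b i * B a b j k) = XX A B := by
  have := Fintype.sum_equiv (ι := T5 n) (κ := T5 n)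
    ⟨fun (i,j,k,a,b) => (a,b,j,k,i), fun (i,j,k,l,s) => (s,k,l,i,j), fun _ => rfl, fun _ => rfl⟩
    (fun (i,j,k,a,b) => A i j k * (A a b i * B a b j k)) (fun (i,j,k,l,s) => B i j k l * (A i j s * A k l s))
    (by rintro ⟨i,j,k,a,b⟩; simp only [Equiv.coe_fn_mk]; (try simp only [hA1, hA2, hB1, hB2, hB3]); (try ring))
  simp only [Fintype.sum_prod_type] at this
  simpa only [ip3, oo1, oo2, oo3, XX, Finset.mul_sum, Finset.sum_mul, Fintype.sum_prod_type] using this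

lemma C4 (A : Fin n → Fin n → Fin n → ℝ)  (hA1 : ∀ a b c, A a b c = A b a c) (hA2 : ∀ a b c, A a b c = A a c b) :
    ip3 A (fun i j k => ∑ a, ∑ b, ∑ c, A a b i * A b c j * A c a k) = YY A := by
  have := Fintype.sum_equiv (ι := T6 n) (κ := T6 n)
    ⟨fun (i,j,k,a,b,c) => (b,a,j,k,i,c), fun (i,j,k,l,s,t) => (s,k,l,j,i,t), fun _ => rfl, fun _ => rfl⟩
    (fun (i,j,k,a,b,c) => A i j k * (A a b i * A b c j * A c a k)) (fun (i,j,k,l,s,t) => A i j s * A k l s * (A i k t * A j l t))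
    (by rintro ⟨i,j,k,a,b,c⟩; simp only [Equiv.coe_fn_mk]; (try simp only [hA1, hA2]); (try ring))
  simp only [Fintype.sum_prod_type] at this
  simpa only [ip3, oo1, oo2, oo3, YY, Finset.mul_sum, Finset.sum_mul, Fintype.sum_prod_type] using this

lemma ZR1 (A : Fin n → Fin n → Fin n → ℝ)  (hA1 : ∀ a b c, A a b c = A b a c) (hA2 : ∀ a b c, A a b c = A a c b) :
    ip3 A (oo1 (fun a b => ∑ c, ∑ d, A c d a * A c d b) A) = ZZ A := by
  have := Fintype.sum_equiv (ι := T6 n) (κ := T6 n)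
    ⟨fun (i,j,k,l,a,b) => (j,k,a,b,i,l), fun (i,j,k,l,s,t) => (s,i,j,t,k,l), fun _ => rfl, fun _ => rfl⟩
    (fun (i,j,k,l,a,b) => A i j k * (A a b i * A a b l * A l j k)) (fun (i,j,k,l,s,t) => A i j s * A k l s * (A i j t * A k l t))
    (by rintro ⟨i,j,k,l,a,b⟩; simp only [Equiv.coe_fn_mk]; (try simp only [hA1, hA2]); (try ring))
  simp only [Fintype.sum_prod_type] at this
  simpa only [ip3, oo1, oo2, oo3, ZZ, Finset.mul_sum, Finset.sum_mul, Fintype.sum_prod_type] using this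

lemma ZR2 (A : Fin n → Fin n → Fin n → ℝ)  (hA1 : ∀ a b c, A a b c = A b a c) (hA2 : ∀ a b c, A a b c = A a c b) :
    ip3 A (oo2 (fun a b => ∑ c, ∑ d, A c d a * A c d b) A) = ZZ A := by
  have := Fintype.sum_equiv (ι := T6 n) (κ := T6 n)
    ⟨fun (i,j,k,l,a,b) => (i,k,a,b,j,l), fun (i,j,k,l,s,t) => (i,s,j,t,k,l), fun _ => rfl, fun _ => rfl⟩
    (fun (i,j,k,l,a,b) => A i j k * (A a b j * A a b l * A i l k)) (fun (i,j,k,l,s,t) => A i j s * A k l s * (A i j t * A k l t))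
    (by rintro ⟨i,j,k,l,a,b⟩; simp only [Equiv.coe_fn_mk]; (try simp only [hA1, hA2]); (try ring))
  simp only [Fintype.sum_prod_type] at this
  simpa only [ip3, oo1, oo2, oo3, ZZ, Finset.mul_sum, Finset.sum_mul, Fintype.sum_prod_type] using this

lemma ZR3 (A : Fin n → Fin n → Fin n → ℝ)  (hA1 : ∀ a b c, A a b c = A b a c) (hA2 : ∀ a b c, A a b c = A a c b) :
    ip3 A (oo3 (fun a b => ∑ c, ∑ d, A c d a * A c d b) A) = ZZ A := by
  have := Fintype.sum_equiv (ι := T6 n) (κ := T6 n)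
    ⟨fun (i,j,k,l,a,b) => (i,j,a,b,k,l), fun (i,j,k,l,s,t) => (i,j,s,t,k,l), fun _ => rfl, fun _ => rfl⟩
    (fun (i,j,k,l,a,b) => A i j k * (A a b k * A a b l * A i j l)) (fun (i,j,k,l,s,t) => A i j s * A k l s * (A i j t * A k l t))
    (by rintro ⟨i,j,k,l,a,b⟩; simp only [Equiv.coe_fn_mk]; (try simp only [hA1, hA2]); (try ring))
  simp only [Fintype.sum_prod_type] at this
  simpa only [ip3, oo1, oo2, oo3, ZZ, Finset.mul_sum, Finset.sum_mul, Fintype.sum_prod_type] using this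

lemma UU1 (A : Fin n → Fin n → Fin n → ℝ)  (hA1 : ∀ a b c, A a b c = A b a c) (hA2 : ∀ a b c, A a b c = A a c b) :
    ∑ i, ∑ j, ∑ k, ∑ l, (∑ s, A i j s * A k l s) * (∑ s, A i j s * A k l s) = ZZ A := by
  have := Fintype.sum_equiv (ι := T6 n) (κ := T6 n)
    ⟨fun (i,j,k,l,t,s) => (i,j,k,l,s,t), fun (i,j,k,l,s,t) => (i,j,k,l,t,s), fun _ => rfl, fun _ => rfl⟩
    (fun (i,j,k,l,t,s) => A i j s * A k l s * (A i j t * A k l t)) (fun (i,j,k,l,s,t) => A i j s * A k l s * (A i j t * A k l t))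
    (by rintro ⟨i,j,k,l,t,s⟩; simp only [Equiv.coe_fn_mk]; (try simp only [hA1, hA2]); (try ring))
  simp only [Fintype.sum_prod_type] at this
  simpa only [ip3, oo1, oo2, oo3, ZZ, Finset.mul_sum, Finset.sum_mul, Fintype.sum_prod_type] using this

lemma UU2 (A : Fin n → Fin n → Fin n → ℝ)  (hA1 : ∀ a b c, A a b c = A b a c) (hA2 : ∀ a b c, A a b c = A a c b) :
    ∑ i, ∑ j, ∑ k, ∑ l, (∑ s, A i k s * A j l s) * (∑ s, A i k s * A j l s) = ZZ A := by
  have := Fintype.sum_equiv (ι := T6 n) (κ := T6 n)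
    ⟨fun (i,j,k,l,t,s) => (i,k,j,l,s,t), fun (i,j,k,l,s,t) => (i,k,j,l,t,s), fun _ => rfl, fun _ => rfl⟩
    (fun (i,j,k,l,t,s) => A i k s * A j l s * (A i k t * A j l t)) (fun (i,j,k,l,s,t) => A i j s * A k l s * (A i j t * A k l t))
    (by rintro ⟨i,j,k,l,t,s⟩; simp only [Equiv.coe_fn_mk]; (try simp only [hA1, hA2]); (try ring))
  simp only [Fintype.sum_prod_type] at this
  simpa only [ip3, oo1, oo2, oo3, ZZ, Finset.mul_sum, Finset.sum_mul, Fintype.sum_prod_type] using this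

lemma UU3 (A : Fin n → Fin n → Fin n → ℝ)  (hA1 : ∀ a b c, A a b c = A b a c) (hA2 : ∀ a b c, A a b c = A a c b) :
    ∑ i, ∑ j, ∑ k, ∑ l, (∑ s, A i j s * A k l s) * (∑ s, A i k s * A j l s) = YY A := by
  have := Fintype.sum_equiv (ι := T6 n) (κ := T6 n)
    ⟨fun (i,j,k,l,t,s) => (i,j,k,l,s,t), fun (i,j,k,l,s,t) => (i,j,k,l,t,s), fun _ => rfl, fun _ => rfl⟩
    (fun (i,j,k,l,t,s) => A i j s * A k l s * (A i k t * A j l t)) (fun (i,j,k,l,s,t) => A i j s * A k l s * (A i k t * A j l t))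
    (by rintro ⟨i,j,k,l,t,s⟩; simp only [Equiv.coe_fn_mk]; (try simp only [hA1, hA2]); (try ring))
  simp only [Fintype.sum_prod_type] at this
  simpa only [ip3, oo1, oo2, oo3, YY, Finset.mul_sum, Finset.sum_mul, Fintype.sum_prod_type] using this

lemma RR (A : Fin n → Fin n → Fin n → ℝ)  (hA1 : ∀ a b c, A a b c = A b a c) (hA2 : ∀ a b c, A a b c = A a c b) :
    ∑ s, ∑ t, (∑ i, ∑ j, A i j s * A i j t) * (∑ i, ∑ j, A i j s * A i j t) = ZZ A := by
  have := Fintype.sum_equiv (ι := T6 n) (κ := T6 n)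
    ⟨fun (s,t,k,l,i,j) => (i,j,k,l,s,t), fun (i,j,k,l,s,t) => (s,t,k,l,i,j), fun _ => rfl, fun _ => rfl⟩
    (fun (s,t,k,l,i,j) => A i j s * A i j t * (A k l s * A k l t)) (fun (i,j,k,l,s,t) => A i j s * A k l s * (A i j t * A k l t))
    (by rintro ⟨s,t,k,l,i,j⟩; simp only [Equiv.coe_fn_mk]; (try simp only [hA1, hA2]); (try ring))
  simp only [Fintype.sum_prod_type] at this
  simpa only [ip3, oo1, oo2, oo3, ZZ, Finset.mul_sum, Finset.sum_mul, Fintype.sum_prod_type] using this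

end algebra

section algebra2
variable {n : ℕ}

lemma YY_le_ZZ (A : Fin n → Fin n → Fin n → ℝ)
    (hA1 : ∀ a b c, A a b c = A b a c) (hA2 : ∀ a b c, A a b c = A a c b) : YY A ≤ ZZ A := by
  have h1 := UU1 A hA1 hA2
  have h2 := UU2 A hA1 hA2
  have h3 := UU3 A hA1 hA2
  have h : 0 ≤ ∑ i, ∑ j, ∑ k, ∑ l, ((∑ s, A i j s * A k l s) - (∑ s, A i k s * A j l s)) ^ 2 := by
    exact Finset.sum_nonneg fun _ _ => Finset.sum_nonneg fun _ _ => Finset.sum_nonneg fun _ _ =>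
      Finset.sum_nonneg fun _ _ => sq_nonneg _
  have e : ∀ i j k l, ((∑ s, A i j s * A k l s) - (∑ s, A i k s * A j l s)) ^ 2 =
     (∑ s, A i j s * A k l s) * (∑ s, A i j s * A k l s) +
     (∑ s, A i k s * A j l s) * (∑ s, A i k s * A j l s) -
     2 * ((∑ s, A i j s * A k l s) * (∑ s, A i k s * A j l s)) := by intros; ring
  simp only [e, Finset.sum_sub_distrib, Finset.sum_add_distrib, ← Finset.mul_sum] at h
  rw [h1, h2, h3] at h
  linarith

lemma J_sq_le (A : Fin n → Fin n → Fin n → ℝ)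
    (hA1 : ∀ a b c, A a b c = A b a c) (hA2 : ∀ a b c, A a b c = A a c b) :
    (ip3 A A) ^ 2 ≤ n * ZZ A := by
  have h1 := RR A hA1 hA2
  have e : ip3 A A = ∑ s, ∑ i, ∑ j, A i j s * A i j s := by
    have := Fintype.sum_equiv (ι := Fin n × Fin n × Fin n) (κ := Fin n × Fin n × Fin n)
      ⟨fun (i,j,k) => (k,i,j), fun (k,i,j) => (i,j,k), fun _ => rfl, fun _ => rfl⟩
      (fun (i,j,k) => A i j k * A i j k) (fun (s,i,j) => A i j s * A i j s) (by rintro ⟨i,j,k⟩; rfl)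
    simpa only [ip3, Fintype.sum_prod_type] using this
  rw [e, ← h1]
  refine (sq_sum_le_card_mul_sum_sq).trans ?_
  simp only [Finset.card_univ, Fintype.card_fin]
  gcongr with s
  rw [sq]
  exact Finset.single_le_sum (f := fun t => (∑ i, ∑ j, A i j s * A i j t) * (∑ i, ∑ j, A i j s * A i j t))
    (fun t _ => mul_self_nonneg _) (Finset.mem_univ s)

lemma sum_oo1 (A : Fin n → Fin n → Fin n → ℝ) (M : Fin n → Fin n → Fin n → ℝ) :
    ∑ s, ip3 A (oo1 (M s) A) = ip3 A (oo1 (fun a b => ∑ s, M s a b) A) := by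
  simp only [ip3, oo1, Finset.mul_sum, Finset.sum_mul]
  rw [Finset.sum_comm]; refine Finset.sum_congr rfl fun i _ => ?_
  rw [Finset.sum_comm]; refine Finset.sum_congr rfl fun j _ => ?_
  rw [Finset.sum_comm]; refine Finset.sum_congr rfl fun k _ => ?_
  rw [Finset.sum_comm]
lemma sum_oo2 (A : Fin n → Fin n → Fin n → ℝ) (M : Fin n → Fin n → Fin n → ℝ) :
    ∑ s, ip3 A (oo2 (M s) A) = ip3 A (oo2 (fun a b => ∑ s, M s a b) A) := by
  simp only [ip3, oo2, Finset.mul_sum, Finset.sum_mul]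
  rw [Finset.sum_comm]; refine Finset.sum_congr rfl fun i _ => ?_
  rw [Finset.sum_comm]; refine Finset.sum_congr rfl fun j _ => ?_
  rw [Finset.sum_comm]; refine Finset.sum_congr rfl fun k _ => ?_
  rw [Finset.sum_comm]
lemma sum_oo3 (A : Fin n → Fin n → Fin n → ℝ) (M : Fin n → Fin n → Fin n → ℝ) :
    ∑ s, ip3 A (oo3 (M s) A) = ip3 A (oo3 (fun a b => ∑ s, M s a b) A) := by
  simp only [ip3, oo3, Finset.mul_sum, Finset.sum_mul]
  rw [Finset.sum_comm]; refine Finset.sum_congr rfl fun i _ => ?_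
  rw [Finset.sum_comm]; refine Finset.sum_congr rfl fun j _ => ?_
  rw [Finset.sum_comm]; refine Finset.sum_congr rfl fun k _ => ?_
  rw [Finset.sum_comm]

/-- third-slot style derivation -/
def Pt (A : Fin n → Fin n → Fin n → ℝ) (s : Fin n) : Fin n → Fin n → Fin n → ℝ :=
  oo1 (A s) A + oo2 (A s) A + oo3 (A s) A

/-- second derivative of the quadratic form part -/
def t3dd (A S : Fin n → Fin n → Fin n → ℝ) (g1 g2 : Fin n → Fin n → ℝ) :
    Fin n → Fin n → Fin n → ℝ :=
  (2 : ℝ) • (oo1 g1 S + oo2 g1 S + oo3 g1 S) + (oo1 g2 A + oo2 g2 A + oo3 g2 A) +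
    (2 : ℝ) • (oo2 g1 (oo3 g1 A) + oo1 g1 (oo3 g1 A) + oo1 g1 (oo2 g1 A))

lemma calabi_algebra (A : Fin n → Fin n → Fin n → ℝ) (B : Fin n → Fin n → Fin n → Fin n → ℝ)
    (C : Fin n → Fin n → Fin n → Fin n → ℝ)
    (hA1 : ∀ a b c, A a b c = A b a c) (hA2 : ∀ a b c, A a b c = A a c b)
    (hB1 : ∀ a b c d, B a b c d = B b a c d) (hB2 : ∀ a b c d, B a b c d = B a c b d)
    (hB3 : ∀ a b c d, B a b c d = B a b d c)
    (hR : ∀ i j, ∑ s, B s s i j = ∑ a, ∑ b, A a b i * A a b j)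
    (hC : ∀ i j k, ∑ s, C s i j k = (∑ a, ∑ b, A a b k * B a b i j) + (∑ a, ∑ b, A a b j * B a b i k)
      + (∑ a, ∑ b, A a b i * B a b j k) - 2 * ∑ a, ∑ b, ∑ c, A a b i * A b c j * A c a k) :
    (ip3 A A) ^ 2 ≤ 2 * n * ∑ s, (2 * ip3 A (C s) + 4 * ip3 (B s) (B s - Pt A s) -
      (ip3 A (t3dd A (B s - Pt A s) (A s) (B s s)) +
       2 * ip3 (B s - Pt A s) ((B s - Pt A s) + Pt A s))) := by
  have hZY := YY_le_ZZ A hA1 hA2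
  have hJ := J_sq_le A hA1 hA2
  have hn : (0 : ℝ) ≤ n := Nat.cast_nonneg n
  set σ := fun s => B s - Pt A s with hσ
  -- adjoint
  have hadj : ∀ s, ip3 A (oo1 (A s) (σ s) + oo2 (A s) (σ s) + oo3 (A s) (σ s))
      = ip3 (σ s) (Pt A s) := by
    intro s
    have hs : ∀ a b, A s a b = A s b a := fun a b => hA2 s a b
    simp only [Pt, ip3_add]
    rw [adj1 A _ hs, adj2 A _ hs, adj3 A _ hs]
  have hg2 : ∑ s, ip3 A (oo1 (B s s) A + oo2 (B s s) A + oo3 (B s s) A) = 3 * ZZ A := by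
    simp only [ip3_add, Finset.sum_add_distrib]
    rw [sum_oo1 A (fun s => B s s), sum_oo2 A (fun s => B s s), sum_oo3 A (fun s => B s s)]
    simp only [hR]
    rw [ZR1 A hA1 hA2, ZR2 A hA1 hA2, ZR3 A hA1 hA2]; ring
  have hYs : ∑ s, ip3 A (oo2 (A s) (oo3 (A s) A) + oo1 (A s) (oo3 (A s) A) + oo1 (A s) (oo2 (A s) A))
      = 3 * YY A := by
    simp only [ip3_add, Finset.sum_add_distrib]
    rw [Y23 A hA1 hA2, Y13 A hA1 hA2, Y12 A hA1 hA2]; ring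
  have hCs : ∑ s, ip3 A (C s) = 3 * XX A B - 2 * YY A := by
    have e : ∑ s, ip3 A (C s) = ip3 A (fun i j k => ∑ s, C s i j k) := by
      simp only [ip3, Finset.mul_sum]
      rw [Finset.sum_comm]; refine Finset.sum_congr rfl fun i _ => ?_
      rw [Finset.sum_comm]; refine Finset.sum_congr rfl fun j _ => ?_
      rw [Finset.sum_comm]
    have e2 : (fun i j k => ∑ s, C s i j k) = (fun i j k => ∑ a, ∑ b, A a b k * B a b i j) +
      (fun i j k => ∑ a, ∑ b, A a b j * B a b i k) + (fun i j k => ∑ a, ∑ b, A a b i * B a b j k) -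
      (2 : ℝ) • (fun i j k => ∑ a, ∑ b, ∑ c, A a b i * A b c j * A c a k) := by
      funext i j k; simp [hC]
    rw [e, e2, ip3_sub, ip3_add, ip3_add, ip3_smul, C1 A B hA1 hA2, C2 A B hA1 hA2 hB1 hB2 hB3,
      C3 A B hA1 hA2 hB1 hB2 hB3, C4 A hA1 hA2]; ring
  have hBP : ∑ s, ip3 (B s) (Pt A s) = 3 * XX A B := by
    simp only [Pt, ip3_add, Finset.sum_add_distrib]
    rw [X1 A B hA1 hA2, X2 A B hA1 hA2 hB1 hB2 hB3, X3 A B hA1 hA2 hB1 hB2 hB3]; ring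
  have hPP : ∑ s, ip3 (Pt A s) (Pt A s) = 3 * ZZ A + 6 * YY A := by
    have : ∀ s, ip3 (Pt A s) (Pt A s) = ip3 (oo1 (A s) A) (oo1 (A s) A) + ip3 (oo2 (A s) A) (oo2 (A s) A)
      + ip3 (oo3 (A s) A) (oo3 (A s) A) + 2 * ip3 (oo1 (A s) A) (oo2 (A s) A) +
      2 * ip3 (oo1 (A s) A) (oo3 (A s) A) + 2 * ip3 (oo2 (A s) A) (oo3 (A s) A) := by
      intro s
      simp only [Pt, ip3_add]
      rw [ip3_comm _ (oo1 (A s) A), ip3_comm _ (oo2 (A s) A), ip3_comm _ (oo3 (A s) A)]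
      simp only [ip3_add]
      rw [ip3_comm (oo2 (A s) A) (oo1 (A s) A), ip3_comm (oo3 (A s) A) (oo1 (A s) A),
        ip3_comm (oo3 (A s) A) (oo2 (A s) A)]
      ring
    simp only [this, Finset.sum_add_distrib, ← Finset.mul_sum]
    rw [PP11 A hA1 hA2, PP22 A hA1 hA2, PP33 A hA1 hA2, PP12 A hA1 hA2, PP13 A hA1 hA2, PP23 A hA1 hA2]
    ring
  have hsq : 0 ≤ ∑ s, ip3 (B s - (1/2 : ℝ) • Pt A s) (B s - (1/2 : ℝ) • Pt A s) := by
    refine Finset.sum_nonneg fun s _ => ?_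
    unfold ip3
    exact Finset.sum_nonneg fun i _ => Finset.sum_nonneg fun j _ => Finset.sum_nonneg fun k _ =>
      mul_self_nonneg _
  have hsq2 : ∑ s, ip3 (B s - (1/2 : ℝ) • Pt A s) (B s - (1/2 : ℝ) • Pt A s) =
      ∑ s, ip3 (B s) (B s) - ∑ s, ip3 (B s) (Pt A s) + (1/4) * ∑ s, ip3 (Pt A s) (Pt A s) := by
    rw [Finset.mul_sum, ← Finset.sum_sub_distrib, ← Finset.sum_add_distrib]
    refine Finset.sum_congr rfl fun s _ => ?_
    simp only [ip3_sub, ip3_smul]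
    rw [ip3_comm _ (B s), ip3_comm _ (Pt A s)]
    simp only [ip3_sub, ip3_smul]
    rw [ip3_comm (Pt A s) (B s)]; ring
  have htot : ∑ s, (2 * ip3 A (C s) + 4 * ip3 (B s) (σ s) -
      (ip3 A (t3dd A (σ s) (A s) (B s s)) + 2 * ip3 (σ s) (σ s + Pt A s))) =
      2 * ∑ s, ip3 A (C s) + 2 * ∑ s, ip3 (B s) (B s) - 4 * ∑ s, ip3 (B s) (Pt A s)
       + 2 * ∑ s, ip3 (Pt A s) (Pt A s) 
       - ∑ s, ip3 A (oo1 (B s s) A + oo2 (B s s) A + oo3 (B s s) A)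
       - 2 * ∑ s, ip3 A (oo2 (A s) (oo3 (A s) A) + oo1 (A s) (oo3 (A s) A) + oo1 (A s) (oo2 (A s) A)) := by
    simp only [Finset.mul_sum]
    rw [← Finset.sum_add_distrib, ← Finset.sum_sub_distrib, ← Finset.sum_add_distrib,
      ← Finset.sum_sub_distrib, ← Finset.sum_sub_distrib]
    refine Finset.sum_congr rfl fun s _ => ?_
    unfold t3dd
    rw [ip3_add A, ip3_add A, ip3_smul, ip3_smul, hadj, ip3_add (σ s)]
    have h1 : ip3 (B s) (σ s) = ip3 (B s) (B s) - ip3 (B s) (Pt A s) := by rw [hσ]; simp only [ip3_sub]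
    have h2 : ip3 (σ s) (Pt A s) = ip3 (B s) (Pt A s) - ip3 (Pt A s) (Pt A s) := by
      rw [ip3_comm, hσ]; simp only [ip3_sub]; rw [ip3_comm (Pt A s) (B s)]
    have h3 : ip3 (σ s) (σ s) = ip3 (B s) (σ s) - ip3 (σ s) (Pt A s) := by
      conv_lhs => rw [show ip3 (σ s) (σ s) = ip3 (σ s) (B s - Pt A s) from rfl]
      rw [ip3_sub, ip3_comm (σ s) (B s)]
    rw [h3, h2, h1]; ring
  have hfin : ∑ s, (2 * ip3 A (C s) + 4 * ip3 (B s) (σ s) -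
      (ip3 A (t3dd A (σ s) (A s) (B s s)) + 2 * ip3 (σ s) (σ s + Pt A s))) ≥ (1/2) * ZZ A := by
    rw [htot]
    rw [hsq2] at hsq
    rw [hCs, hBP, hPP, hg2, hYs]
    rw [hBP, hPP] at hsq
    linarith
  calc _ ≤ n * ZZ A := hJ
    _ = 2 * n * ((1/2) * ZZ A) := by ring
    _ ≤ _ := by gcongr
end algebra2

section bar
variable {n : ℕ}
open scoped Kronecker MatrixOrder

def vec3 (a : Fin n → Fin n → Fin n → ℝ) : Fin n × Fin n × Fin n → ℝ := fun p => a p.1 p.2.1 p.2.2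

noncomputable def J3 (g : Matrix (Fin n) (Fin n) ℝ) (a : Fin n → Fin n → Fin n → ℝ) : ℝ :=
  vec3 a ⬝ᵥ ((g ⊗ₖ (g ⊗ₖ g))⁻¹ *ᵥ vec3 a)

def fr (E : Matrix (Fin n) (Fin n) ℝ) (a : Fin n → Fin n → Fin n → ℝ) : Fin n → Fin n → Fin n → ℝ :=
  fun p q r => ∑ i, ∑ j, ∑ k, E i p * (E j q * E k r) * a i j k

lemma vec3_fr (E : Matrix (Fin n) (Fin n) ℝ) (a : Fin n → Fin n → Fin n → ℝ) :
    vec3 (fr E a) = (E ⊗ₖ (E ⊗ₖ E))ᵀ *ᵥ vec3 a := by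
  funext p
  simp only [vec3, fr, Matrix.mulVec, dotProduct, Fintype.sum_prod_type, transpose_apply, kroneckerMap_apply]

lemma vec3_dot (a b : Fin n → Fin n → Fin n → ℝ) : vec3 a ⬝ᵥ vec3 b = ip3 a b := by
  simp only [vec3, ip3, dotProduct, Fintype.sum_prod_type]

lemma vec3_kron (g : Matrix (Fin n) (Fin n) ℝ) (a : Fin n → Fin n → Fin n → ℝ) :
    (g ⊗ₖ (g ⊗ₖ g)) *ᵥ vec3 a = vec3 (oo1 g (oo2 g (oo3 g a))) := by
  funext p
  simp only [vec3, oo1, oo2, oo3, Matrix.mulVec, dotProduct, Fintype.sum_prod_type, kroneckerMap_apply,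
    Finset.mul_sum, mul_assoc]

lemma posdef_barrier {ι : Type*} [Fintype ι] [DecidableEq ι] {M : Matrix ι ι ℝ} (hM : M.PosDef) (a τ : ι → ℝ) :
    2 * (a ⬝ᵥ τ) - τ ⬝ᵥ (M *ᵥ τ) ≤ a ⬝ᵥ (M⁻¹ *ᵥ a) := by
  have h := hM.posSemidef.dotProduct_mulVec_nonneg (τ - M⁻¹ *ᵥ a)
  have hu : IsUnit M.det := (Matrix.isUnit_iff_isUnit_det M).1 hM.isUnit
  have hs : Mᵀ = M := by simpa using hM.isHermitian.eq
  rw [star_trivial, mulVec_sub, mulVec_mulVec, mul_nonsing_inv _ hu, one_mulVec, sub_dotProduct,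
    dotProduct_sub, dotProduct_sub] at h
  have e : (M⁻¹ *ᵥ a) ⬝ᵥ (M *ᵥ τ) = a ⬝ᵥ τ := by
    rw [dotProduct_mulVec, ← mulVec_transpose, hs, mulVec_mulVec, mul_nonsing_inv _ hu, one_mulVec]
  rw [e, dotProduct_comm τ a, dotProduct_comm _ a] at h
  linarith

lemma kron_pd {g : Matrix (Fin n) (Fin n) ℝ} (hg : g.PosDef) : (g ⊗ₖ (g ⊗ₖ g)).PosDef :=
  hg.kronecker (hg.kronecker hg)

lemma kron_conj (E g : Matrix (Fin n) (Fin n) ℝ) :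
    (E ⊗ₖ (E ⊗ₖ E))ᵀ * (g ⊗ₖ (g ⊗ₖ g)) * (E ⊗ₖ (E ⊗ₖ E)) =
      (Eᵀ * g * E) ⊗ₖ ((Eᵀ * g * E) ⊗ₖ (Eᵀ * g * E)) := by
  rw [← kroneckerMap_transpose, ← kroneckerMap_transpose, ← mul_kronecker_mul, ← mul_kronecker_mul, ← mul_kronecker_mul, ← mul_kronecker_mul]

lemma J3_ge {g : Matrix (Fin n) (Fin n) ℝ} (hg : g.PosDef) (E : Matrix (Fin n) (Fin n) ℝ)
    (a τ : Fin n → Fin n → Fin n → ℝ) :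
    2 * ip3 (fr E a) τ - ip3 τ (oo1 (Eᵀ * g * E) (oo2 (Eᵀ * g * E) (oo3 (Eᵀ * g * E) τ))) ≤ J3 g a := by
  have h := posdef_barrier (kron_pd hg) (vec3 a) ((E ⊗ₖ (E ⊗ₖ E)) *ᵥ vec3 τ)
  refine le_trans (le_of_eq ?_) h
  congr 1
  · rw [← vec3_dot, vec3_fr, dotProduct_mulVec, ← mulVec_transpose]
  · rw [← vec3_dot, ← vec3_kron, ← kron_conj, ← mulVec_mulVec, ← mulVec_mulVec, dotProduct_mulVec,
      ← mulVec_transpose, transpose_transpose]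

lemma J3_eq {g : Matrix (Fin n) (Fin n) ℝ} (E : Matrix (Fin n) (Fin n) ℝ)
    (hE : Eᵀ * g * E = 1) (a : Fin n → Fin n → Fin n → ℝ) :
    J3 g a = ip3 (fr E a) (fr E a) := by
  have h := kron_conj E g
  rw [hE, one_kronecker_one, one_kronecker_one] at h
  have h2 : (E ⊗ₖ (E ⊗ₖ E)) * ((E ⊗ₖ (E ⊗ₖ E))ᵀ * (g ⊗ₖ (g ⊗ₖ g))) = 1 := mul_eq_one_comm.1 h
  rw [← Matrix.mul_assoc] at h2
  unfold J3
  rw [inv_eq_left_inv h2, ← vec3_dot, vec3_fr, ← mulVec_mulVec, dotProduct_mulVec, ← mulVec_transpose]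

lemma exists_frame {g : Matrix (Fin n) (Fin n) ℝ} (hg : g.PosDef) :
    ∃ E : Matrix (Fin n) (Fin n) ℝ, Eᵀ * g * E = 1 := by
  obtain ⟨B, h⟩ := CStarAlgebra.nonneg_iff_eq_star_mul_self.mp hg.posSemidef.nonneg
  rw [star_eq_conjTranspose] at h
  have hu : IsUnit B.det := by
    have := hg.det_pos.ne'
    rw [h, det_mul] at this
    exact isUnit_iff_ne_zero.2 (right_ne_zero_of_mul this)
  refine ⟨B⁻¹, ?_⟩
  rw [h, conjTranspose_eq_transpose_of_trivial, ← Matrix.mul_assoc, ← transpose_mul, Matrix.mul_assoc,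
    mul_nonsing_inv _ hu]
  simp

lemma J3_nonneg {g : Matrix (Fin n) (Fin n) ℝ} (hg : g.PosDef) (a : Fin n → Fin n → Fin n → ℝ) :
    0 ≤ J3 g a := by
  simpa [J3] using (kron_pd hg).inv.posSemidef.dotProduct_mulVec_nonneg (vec3 a)

lemma J3_eq_zero {g : Matrix (Fin n) (Fin n) ℝ} (hg : g.PosDef) (a : Fin n → Fin n → Fin n → ℝ)
    (h : J3 g a = 0) (i j k) : a i j k = 0 := by
  by_contra hne
  have : vec3 a ≠ 0 := fun h0 => hne (congrFun h0 (i, j, k))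
  have := (kron_pd hg).inv.dotProduct_mulVec_pos this
  simp only [star_trivial] at this
  exact absurd h this.ne'

lemma sum3_mul (p q r : Fin n → ℝ) : (∑ i, p i) * ((∑ j, q j) * ∑ k, r k) =
    ∑ i, ∑ j, ∑ k, p i * (q j * r k) := by
  rw [Finset.sum_mul_sum, Finset.sum_mul]
  refine Finset.sum_congr rfl fun _ _ => ?_
  simp only [Finset.mul_sum]

lemma J3_bound {g : Matrix (Fin n) (Fin n) ℝ} (hg : g.PosDef) (a : Fin n → Fin n → Fin n → ℝ)
    (u v w : Fin n → ℝ) :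
    (∑ i, ∑ j, ∑ k, u i * (v j * w k) * a i j k) ^ 2 ≤
      J3 g a * ((u ⬝ᵥ (g *ᵥ u)) * ((v ⬝ᵥ (g *ᵥ v)) * (w ⬝ᵥ (g *ᵥ w)))) := by
  set s := ∑ i, ∑ j, ∑ k, u i * (v j * w k) * a i j k
  set Q := ((u ⬝ᵥ (g *ᵥ u)) * ((v ⬝ᵥ (g *ᵥ v)) * (w ⬝ᵥ (g *ᵥ w))))
  set τ : Fin n → Fin n → Fin n → ℝ := fun i j k => u i * (v j * w k)
  have key : ∀ t : ℝ, 0 ≤ Q * (t * t) + (-2 * s) * t + J3 g a := by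
    intro t
    have h := posdef_barrier (kron_pd hg) (vec3 a) (t • vec3 τ)
    rw [mulVec_smul, dotProduct_smul, dotProduct_smul, smul_dotProduct, vec3_kron, vec3_dot, vec3_dot] at h
    have e1 : ip3 a τ = s := by
      simp only [ip3, s, τ, mul_comm]
    have e2 : ip3 τ (oo1 g (oo2 g (oo3 g τ))) = Q := by
      have : ∀ i j k, oo1 g (oo2 g (oo3 g τ)) i j k = (g *ᵥ u) i * ((g *ᵥ v) j * (g *ᵥ w) k) := by
        intro i j k
        simp only [oo1, oo2, oo3, τ, mulVec, dotProduct, sum3_mul]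
        simp only [Finset.mul_sum]
        refine Finset.sum_congr rfl fun _ _ => Finset.sum_congr rfl fun _ _ => Finset.sum_congr rfl fun _ _ => by ring
      simp only [ip3, this, Q, τ, dotProduct, sum3_mul]
      refine Finset.sum_congr rfl fun _ _ => Finset.sum_congr rfl fun _ _ => Finset.sum_congr rfl fun _ _ => by ring
    rw [e1, e2] at h
    simp only [smul_eq_mul] at h
    unfold J3
    nlinarith
  have := discrim_le_zero key
  unfold discrim at this
  nlinarith
end bar

section calc1
variable {n : ℕ}

/-- directional derivative -/
noncomputable def dd (v : Fin n → ℝ) (u : (Fin n → ℝ) → ℝ) : (Fin n → ℝ) → ℝ := fun x => fderiv ℝ u x v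

lemma dd_smooth {Ω : Set (Fin n → ℝ)} (hΩ : IsOpen Ω) {u : (Fin n → ℝ) → ℝ}
    (hu : ContDiffOn ℝ (⊤ : ℕ∞) u Ω) (v : Fin n → ℝ) : ContDiffOn ℝ (⊤ : ℕ∞) (dd v u) Ω :=
  (hu.fderiv_of_isOpen hΩ (by simp)).clm_apply contDiffOn_const

lemma sm_diff {Ω : Set (Fin n → ℝ)} (hΩ : IsOpen Ω) {u : (Fin n → ℝ) → ℝ}
    (hu : ContDiffOn ℝ (⊤ : ℕ∞) u Ω) {x : Fin n → ℝ} (hx : x ∈ Ω) : DifferentiableAt ℝ u x :=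
  (hu.contDiffAt (hΩ.mem_nhds hx)).differentiableAt (by simp)

lemma dd_comm {Ω : Set (Fin n → ℝ)} (hΩ : IsOpen Ω) {u : (Fin n → ℝ) → ℝ}
    (hu : ContDiffOn ℝ (⊤ : ℕ∞) u Ω) {x : Fin n → ℝ} (hx : x ∈ Ω) (v w : Fin n → ℝ) :
    dd v (dd w u) x = dd w (dd v u) x := by
  have hc := (hu.contDiffAt (hΩ.mem_nhds hx))
  have hs := hc.isSymmSndFDerivAt (by simp only [minSmoothness_of_isRCLikeNormedField]; exact WithTop.coe_le_coe.2 le_top)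
  have hd : DifferentiableAt ℝ (fderiv ℝ u) x := 
    ((hu.fderiv_of_isOpen (m := (⊤ : ℕ∞)) hΩ (by simp)).contDiffAt (hΩ.mem_nhds hx)).differentiableAt (by simp)
  have e : ∀ v w, dd v (dd w u) x = fderiv ℝ (fderiv ℝ u) x v w := by
    intro v w
    have := (hd.hasFDerivAt.clm_apply (hasFDerivAt_const w x)).fderiv
    unfold dd
    rw [this]; simp
  rw [e, e]; exact hs v w

lemma dd_congr {Ω : Set (Fin n → ℝ)} (hΩ : IsOpen Ω) {u u' : (Fin n → ℝ) → ℝ}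
    (h : ∀ x ∈ Ω, u x = u' x) {x : Fin n → ℝ} (hx : x ∈ Ω) (v : Fin n → ℝ) : dd v u x = dd v u' x := by
  have : u =ᶠ[nhds x] u' := Filter.eventuallyEq_of_mem (hΩ.mem_nhds hx) h
  unfold dd; rw [this.fderiv_eq]

lemma dd_line {u : (Fin n → ℝ) → ℝ} (x v : Fin n → ℝ) (t : ℝ) (h : DifferentiableAt ℝ u (x + t • v)) :
    HasDerivAt (fun s : ℝ => u (x + s • v)) (dd v u (x + t • v)) t := by
  have h1 : HasDerivAt (fun s : ℝ => x + s • v) v t := by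
    simpa using ((hasDerivAt_id t).smul_const v).const_add x
  exact h.hasFDerivAt.comp_hasDerivAt t h1

lemma line_mem {Ω : Set (Fin n → ℝ)} (hΩ : IsOpen Ω) {x : Fin n → ℝ} (v : Fin n → ℝ) (t : ℝ)
    (hx : x + t • v ∈ Ω) : ∀ᶠ s in nhds t, x + s • v ∈ Ω := by
  have hc : Continuous fun s : ℝ => x + s • v := by fun_prop
  exact hc.continuousAt.eventually_mem (hΩ.mem_nhds hx)

lemma dd_lin (u : (Fin n → ℝ) → ℝ) (x v : Fin n → ℝ) :
    dd v u x = ∑ i, v i * dd (Pi.single i 1) u x := by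
  unfold dd
  conv_lhs => rw [pi_eq_sum_univ' v]
  rw [map_sum]
  refine Finset.sum_congr rfl fun i _ => ?_
  rw [map_smul, smul_eq_mul]

lemma dd_lincomb {ι : Type*} [Fintype ι] (c : ι → ℝ) (w : ι → (Fin n → ℝ) → ℝ) (x v : Fin n → ℝ)
    (h : ∀ i, DifferentiableAt ℝ (w i) x) :
    dd v (fun y => ∑ i, c i * w i y) x = ∑ i, c i * dd v (w i) x := by
  unfold dd
  rw [fderiv_fun_sum (fun i _ => (h i).const_mul (c i))]
  rw [_root_.sum_apply]
  refine Finset.sum_congr rfl fun i _ => ?_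
  rw [fderiv_const_mul (h i)]; simp

def stdb (n : ℕ) : Fin n → Fin n → ℝ := fun i => Pi.single i 1

noncomputable def f2 (e : Fin n → Fin n → ℝ) (f : (Fin n → ℝ) → ℝ) (x : Fin n → ℝ) : Matrix (Fin n) (Fin n) ℝ :=
  Matrix.of fun a b => dd (e a) (dd (e b) f) x
noncomputable def f3 (e : Fin n → Fin n → ℝ) (f : (Fin n → ℝ) → ℝ) (x : Fin n → ℝ) :
    Fin n → Fin n → Fin n → ℝ := fun a b c => dd (e a) (dd (e b) (dd (e c) f)) x
noncomputable def f4 (e : Fin n → Fin n → ℝ) (f : (Fin n → ℝ) → ℝ) (x : Fin n → ℝ) :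
    Fin n → Fin n → Fin n → Fin n → ℝ := fun a b c d => dd (e a) (dd (e b) (dd (e c) (dd (e d) f))) x
noncomputable def f5 (e : Fin n → Fin n → ℝ) (f : (Fin n → ℝ) → ℝ) (x : Fin n → ℝ) :
    Fin n → Fin n → Fin n → Fin n → Fin n → ℝ :=
  fun a b c d k => dd (e a) (dd (e b) (dd (e c) (dd (e d) (dd (e k) f)))) x

lemma Hess_eq (f : (Fin n → ℝ) → ℝ) (x : Fin n → ℝ) : Hess n f x = f2 (stdb n) f x := rfl

lemma dd2_lin {Ω : Set (Fin n → ℝ)} (hΩ : IsOpen Ω) {u : (Fin n → ℝ) → ℝ}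
    (hu : ContDiffOn ℝ (⊤ : ℕ∞) u Ω) {x : Fin n → ℝ} (hx : x ∈ Ω) (v w : Fin n → ℝ) :
    dd v (dd w u) x = ∑ i, ∑ j, v i * (w j * f2 (stdb n) u x i j) := by
  rw [dd_congr hΩ (u' := fun y => ∑ i, w i * dd (Pi.single i 1) u y) (fun y _ => dd_lin u y w) hx,
    dd_lincomb _ _ _ _ (fun i => sm_diff hΩ (dd_smooth hΩ hu _) hx), Finset.sum_comm]
  refine Finset.sum_congr rfl fun j _ => ?_
  rw [dd_lin, Finset.mul_sum]
  refine Finset.sum_congr rfl fun i _ => ?_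
  simp only [f2, stdb, of_apply]; ring

lemma dd2_quad {Ω : Set (Fin n → ℝ)} (hΩ : IsOpen Ω) {u : (Fin n → ℝ) → ℝ}
    (hu : ContDiffOn ℝ (⊤ : ℕ∞) u Ω) {x : Fin n → ℝ} (hx : x ∈ Ω) (v w : Fin n → ℝ) :
    dd v (dd w u) x = v ⬝ᵥ (Hess n u x *ᵥ w) := by
  rw [dd2_lin hΩ hu hx, Hess_eq]
  simp only [dotProduct, mulVec, Finset.mul_sum]
  refine Finset.sum_congr rfl fun j _ => Finset.sum_congr rfl fun i _ => by ring

lemma dd3_lin {Ω : Set (Fin n → ℝ)} (hΩ : IsOpen Ω) {u : (Fin n → ℝ) → ℝ}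
    (hu : ContDiffOn ℝ (⊤ : ℕ∞) u Ω) {x : Fin n → ℝ} (hx : x ∈ Ω) (v w z : Fin n → ℝ) :
    dd v (dd w (dd z u)) x = ∑ i, ∑ j, ∑ k, v i * (w j * z k) * f3 (stdb n) u x i j k := by
  rw [dd2_lin hΩ (dd_smooth hΩ hu z) hx]
  refine Finset.sum_congr rfl fun i _ => Finset.sum_congr rfl fun j _ => ?_
  have : f2 (stdb n) (dd z u) x i j = ∑ k, z k * f3 (stdb n) u x i j k := by
    have h1 : ∀ y ∈ Ω, dd (stdb n j) (dd z u) y = ∑ k, z k * dd (stdb n j) (dd (stdb n k) u) y := by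
      intro y hy
      rw [dd_congr hΩ (u' := fun y => ∑ i, z i * dd (Pi.single i 1) u y) (fun y _ => dd_lin u y z) hy,
        dd_lincomb _ _ _ _ (fun i => sm_diff hΩ (dd_smooth hΩ hu _) hy)]
      rfl
    simp only [f2, of_apply, f3]
    rw [dd_congr hΩ h1 hx, dd_lincomb _ _ _ _ (fun i => sm_diff hΩ (dd_smooth hΩ (dd_smooth hΩ hu _) _) hx)]
  rw [this]; simp only [Finset.mul_sum]
  refine Finset.sum_congr rfl fun k _ => by ring

/-- columns of a matrix as vectors -/
def colv (E : Matrix (Fin n) (Fin n) ℝ) : Fin n → Fin n → ℝ := fun a i => E i a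

lemma f2_frame {Ω : Set (Fin n → ℝ)} (hΩ : IsOpen Ω) {u : (Fin n → ℝ) → ℝ}
    (hu : ContDiffOn ℝ (⊤ : ℕ∞) u Ω) {x : Fin n → ℝ} (hx : x ∈ Ω) (E : Matrix (Fin n) (Fin n) ℝ) :
    f2 (colv E) u x = Eᵀ * Hess n u x * E := by
  ext a b
  rw [f2, of_apply, dd2_quad hΩ hu hx, Matrix.mul_assoc]
  rfl

lemma f3_frame {Ω : Set (Fin n → ℝ)} (hΩ : IsOpen Ω) {u : (Fin n → ℝ) → ℝ}
    (hu : ContDiffOn ℝ (⊤ : ℕ∞) u Ω) {x : Fin n → ℝ} (hx : x ∈ Ω) (E : Matrix (Fin n) (Fin n) ℝ) :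
    f3 (colv E) u x = fr E (f3 (stdb n) u x) := by
  funext a b c
  rw [f3, dd3_lin hΩ hu hx]
  rfl

/-- the invariant J -/
noncomputable def JJ (f : (Fin n → ℝ) → ℝ) (x : Fin n → ℝ) : ℝ := J3 (Hess n f x) (f3 (stdb n) f x)

lemma matmul_hasDerivAt {M N : ℝ → Matrix (Fin n) (Fin n) ℝ} {M' N' : Matrix (Fin n) (Fin n) ℝ} {t : ℝ}
    (hM : ∀ a b, HasDerivAt (fun s => M s a b) (M' a b) t)
    (hN : ∀ a b, HasDerivAt (fun s => N s a b) (N' a b) t) (a b) :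
    HasDerivAt (fun s => (M s * N s) a b) ((M' * N t + M t * N') a b) t := by
  have := HasDerivAt.fun_sum (u := Finset.univ) (fun c _ => (hM a c).mul (hN c b))
  simp only [Matrix.mul_apply, Matrix.add_apply, ← Finset.sum_add_distrib]
  exact this

noncomputable def detCM (n : ℕ) : ContinuousMultilinearMap ℝ (fun _ : Fin n => (Fin n → ℝ)) ℝ :=
  { (Matrix.detRowAlternating (R := ℝ) (n := Fin n)).toMultilinearMap with
    cont := by
      change Continuous fun M : Fin n → Fin n → ℝ => Matrix.det (Matrix.of M)
      exact Continuous.matrix_det continuous_id }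

lemma det_hasDerivAt {M : ℝ → Matrix (Fin n) (Fin n) ℝ} {M' : Matrix (Fin n) (Fin n) ℝ} {t : ℝ}
    (hM : ∀ a b, HasDerivAt (fun s => M s a b) (M' a b) t) :
    HasDerivAt (fun s => (M s).det) (∑ a, ∑ b, (M t).adjugate b a * M' a b) t := by
  have h1 : HasDerivAt (fun s => (fun a => M s a : Fin n → Fin n → ℝ)) (fun a => M' a) t :=
    hasDerivAt_pi.2 fun a => hasDerivAt_pi.2 fun b => hM a b
  have h2 := ((detCM n).hasFDerivAt (fun a => M t a)).comp_hasDerivAt t h1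
  refine HasDerivAt.congr_deriv (f := fun s => (M s).det) h2 ?_
  symm
  rw [ContinuousMultilinearMap.linearDeriv_apply]
  refine Finset.sum_congr rfl fun a _ => ?_
  have : (detCM n) (Function.update (fun a => M t a) a (M' a)) = ((M t).updateRow a (M' a)).det := rfl
  rw [this, ← cramer_transpose_apply, cramer_eq_adjugate_mulVec, ← adjugate_transpose]
  rfl

lemma inv_hasDerivAt {M : ℝ → Matrix (Fin n) (Fin n) ℝ} {M' : Matrix (Fin n) (Fin n) ℝ} {t : ℝ}
    (hM : ∀ a b, HasDerivAt (fun s => M s a b) (M' a b) t) (hu : IsUnit (M t).det) (a b) :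
    HasDerivAt (fun s => (M s)⁻¹ a b) ((-((M t)⁻¹ * M' * (M t)⁻¹)) a b) t := by
  have hd := det_hasDerivAt hM
  have hdiff : ∀ a b, DifferentiableAt ℝ (fun s => (M s)⁻¹ a b) t := by
    intro a b
    have h1 : ∀ c d, HasDerivAt (fun s => (M s).updateRow b (Pi.single a 1) c d)
        (M'.updateRow b 0 c d) t := by
      intro c d
      by_cases h : c = b
      · subst h; simpa using hasDerivAt_const _ _
      · simpa [h] using hM c d
    have h2 := det_hasDerivAt h1
    have h3 := (hd.differentiableAt.inv hu.ne_zero).mul h2.differentiableAt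
    refine h3.congr_of_eventuallyEq (Filter.Eventually.of_forall fun s => ?_)
    change _ = ((M s).det)⁻¹ * ((M s).updateRow b (Pi.single a 1)).det
    beta_reduce
    rw [inv_def, Matrix.smul_apply, adjugate_apply, Ring.inverse_eq_inv', smul_eq_mul]
  set D : Matrix (Fin n) (Fin n) ℝ := Matrix.of fun a b => deriv (fun s => (M s)⁻¹ a b) t
  have hD : ∀ a b, HasDerivAt (fun s => (M s)⁻¹ a b) (D a b) t := fun a b => (hdiff a b).hasDerivAt
  have hev : ∀ᶠ s in nhds t, (M s).det ≠ 0 := hd.continuousAt.eventually_ne hu.ne_zero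
  have key : D * M t + (M t)⁻¹ * M' = 0 := by
    ext a b
    have h1 := matmul_hasDerivAt hD hM a b
    have h2 : HasDerivAt (fun s => ((M s)⁻¹ * M s) a b) 0 t := by
      refine (hasDerivAt_const t ((1 : Matrix (Fin n) (Fin n) ℝ) a b)).congr_of_eventuallyEq ?_
      filter_upwards [hev] with s hs
      rw [nonsing_inv_mul _ (isUnit_iff_ne_zero.2 hs)]
    exact h1.unique h2
  have : D = -((M t)⁻¹ * M' * (M t)⁻¹) := by
    have h1 : D * M t = -((M t)⁻¹ * M') := eq_neg_of_add_eq_zero_left key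
    have h2 : D * M t * (M t)⁻¹ = D := by rw [Matrix.mul_assoc, mul_nonsing_inv _ hu, Matrix.mul_one]
    rw [← h2, h1, Matrix.neg_mul]
  rw [← this]; exact hD a b

end calc1

section trace
variable {n : ℕ}

lemma dd_line0 {Ω : Set (Fin n → ℝ)} (hΩ : IsOpen Ω) {u : (Fin n → ℝ) → ℝ}
    (hu : ContDiffOn ℝ (⊤ : ℕ∞) u Ω) {x : Fin n → ℝ} (hx : x ∈ Ω) (v : Fin n → ℝ) :
    HasDerivAt (fun t : ℝ => u (x + t • v)) (dd v u x) 0 := by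
  have := dd_line x v 0 (u := u) (by simpa using sm_diff hΩ hu hx)
  simpa using this

lemma deriv_zero_line {Ω : Set (Fin n → ℝ)} (hΩ : IsOpen Ω) {u : (Fin n → ℝ) → ℝ} {c d : ℝ}
    (hu : ∀ y ∈ Ω, u y = c) {x : Fin n → ℝ} (hx : x ∈ Ω) (v : Fin n → ℝ)
    (h : HasDerivAt (fun t : ℝ => u (x + t • v)) d 0) : d = 0 := by
  refine h.unique ((hasDerivAt_const 0 c).congr_of_eventuallyEq ?_)
  filter_upwards [line_mem hΩ v 0 (x := x) (by simpa using hx)] with s hs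
  exact hu _ hs

lemma inv_line {Ω : Set (Fin n → ℝ)} (hΩ : IsOpen Ω) {f : (Fin n → ℝ) → ℝ}
    (hf : ContDiffOn ℝ (⊤ : ℕ∞) f Ω) (e : Fin n → Fin n → ℝ) {x : Fin n → ℝ} (hx : x ∈ Ω)
    (hc : (f2 e f x).det ≠ 0) (k a b : Fin n) :
    HasDerivAt (fun t : ℝ => (f2 e f (x + t • e k))⁻¹ a b)
      ((-((f2 e f x)⁻¹ * Matrix.of (f3 e f x k) * (f2 e f x)⁻¹)) a b) 0 := by
  have h1 : ∀ a b, HasDerivAt (fun t : ℝ => f2 e f (x + t • e k) a b) (Matrix.of (f3 e f x k) a b) 0 :=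
    fun a b => dd_line0 hΩ (dd_smooth hΩ (dd_smooth hΩ hf _) _) hx _
  have := inv_hasDerivAt h1 (by simpa using hc) a b
  simpa using this

lemma trace1 {Ω : Set (Fin n → ℝ)} (hΩ : IsOpen Ω) {f : (Fin n → ℝ) → ℝ}
    (hf : ContDiffOn ℝ (⊤ : ℕ∞) f Ω) (e : Fin n → Fin n → ℝ) {c : ℝ} (hc : c ≠ 0)
    (hdet : ∀ x ∈ Ω, (f2 e f x).det = c) {x : Fin n → ℝ} (hx : x ∈ Ω) (i : Fin n) :
    ∑ a, ∑ b, (f2 e f x)⁻¹ b a * f3 e f x i a b = 0 := by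
  have h1 : ∀ a b, HasDerivAt (fun t : ℝ => f2 e f (x + t • e i) a b) (Matrix.of (f3 e f x i) a b) 0 :=
    fun a b => dd_line0 hΩ (dd_smooth hΩ (dd_smooth hΩ hf _) _) hx _
  have h2 := deriv_zero_line hΩ (u := fun y => (f2 e f y).det) hdet hx (e i) (det_hasDerivAt h1)
  simp only [zero_smul, add_zero, of_apply] at h2
  simp only [inv_def, hdet x hx, Ring.inverse_eq_inv', Matrix.smul_apply, smul_eq_mul, mul_assoc, ← Finset.mul_sum, h2, mul_zero]

lemma trace2 {Ω : Set (Fin n → ℝ)} (hΩ : IsOpen Ω) {f : (Fin n → ℝ) → ℝ}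
    (hf : ContDiffOn ℝ (⊤ : ℕ∞) f Ω) (e : Fin n → Fin n → ℝ) {c : ℝ} (hc : c ≠ 0)
    (hdet : ∀ x ∈ Ω, (f2 e f x).det = c) {x : Fin n → ℝ} (hx : x ∈ Ω) (i j : Fin n) :
    ∑ a, ∑ b, ((-((f2 e f x)⁻¹ * Matrix.of (f3 e f x j) * (f2 e f x)⁻¹)) b a * f3 e f x i a b
      + (f2 e f x)⁻¹ b a * f4 e f x j i a b) = 0 := by
  have h1 : ∀ a b, HasDerivAt (fun t : ℝ => (f2 e f (x + t • e j))⁻¹ b a * f3 e f (x + t • e j) i a b)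
     ((-((f2 e f x)⁻¹ * Matrix.of (f3 e f x j) * (f2 e f x)⁻¹)) b a * f3 e f x i a b
      + (f2 e f x)⁻¹ b a * f4 e f x j i a b) 0 := by
    intro a b
    have := (inv_line hΩ hf e hx (by rwa [hdet x hx]) j b a).mul
      (dd_line0 hΩ (dd_smooth hΩ (dd_smooth hΩ (dd_smooth hΩ hf (e b)) (e a)) (e i)) hx (e j))
    simp only [zero_smul, add_zero] at this
    exact this
  exact deriv_zero_line hΩ (u := fun y => ∑ a, ∑ b, (f2 e f y)⁻¹ b a * f3 e f y i a b)
    (fun y hy => trace1 hΩ hf e hc hdet hy i) hx (e j)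
    (HasDerivAt.fun_sum fun a _ => HasDerivAt.fun_sum fun b _ => h1 a b)

lemma trace3 {Ω : Set (Fin n → ℝ)} (hΩ : IsOpen Ω) {f : (Fin n → ℝ) → ℝ}
    (hf : ContDiffOn ℝ (⊤ : ℕ∞) f Ω) (e : Fin n → Fin n → ℝ) {c : ℝ} (hc : c ≠ 0)
    (hdet : ∀ x ∈ Ω, (f2 e f x).det = c) {x : Fin n → ℝ} (hx : x ∈ Ω) (h1 : f2 e f x = 1) (i j k : Fin n) :
    ∑ a, ∑ b, (((Matrix.of (f3 e f x k) * Matrix.of (f3 e f x j) - Matrix.of (f4 e f x k j)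
        + Matrix.of (f3 e f x j) * Matrix.of (f3 e f x k)) b a * f3 e f x i a b
        - f3 e f x j b a * f4 e f x k i a b)
      + (- f3 e f x k b a * f4 e f x j i a b + (1 : Matrix (Fin n) (Fin n) ℝ) b a * f5 e f x k j i a b)) = 0 := by
  have hI := fun a b => inv_line hΩ hf e hx (by rwa [hdet x hx]) k a b
  have hF : ∀ a b, HasDerivAt (fun t : ℝ => (Matrix.of (f3 e f (x + t • e k) j)) a b) 
     (Matrix.of (f4 e f x k j) a b) 0 := fun a b =>
      (dd_line0 hΩ (dd_smooth hΩ (dd_smooth hΩ (dd_smooth hΩ hf (e b)) (e a)) (e j)) hx (e k))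
  have hP := fun a b => (matmul_hasDerivAt (matmul_hasDerivAt hI hF) hI a b).fun_neg
  have h2 : ∀ a b, HasDerivAt (fun t : ℝ => 
       (-((f2 e f (x + t • e k))⁻¹ * Matrix.of (f3 e f (x + t • e k) j) * (f2 e f (x + t • e k))⁻¹)) b a * f3 e f (x + t • e k) i a b
      + (f2 e f (x + t • e k))⁻¹ b a * f4 e f (x + t • e k) j i a b) 
     (((Matrix.of (f3 e f x k) * Matrix.of (f3 e f x j) - Matrix.of (f4 e f x k j)
        + Matrix.of (f3 e f x j) * Matrix.of (f3 e f x k)) b a * f3 e f x i a b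
        - f3 e f x j b a * f4 e f x k i a b)
      + (- f3 e f x k b a * f4 e f x j i a b + (1 : Matrix (Fin n) (Fin n) ℝ) b a * f5 e f x k j i a b)) 0 := by
    intro a b
    have q1 := (hP b a).mul 
      (dd_line0 hΩ (dd_smooth hΩ (dd_smooth hΩ (dd_smooth hΩ hf (e b)) (e a)) (e i)) hx (e k))
    have q2 := (hI b a).mul 
      (dd_line0 hΩ (dd_smooth hΩ (dd_smooth hΩ (dd_smooth hΩ (dd_smooth hΩ hf (e b)) (e a)) (e i)) (e j)) hx (e k))
    refine (q1.add q2).congr_deriv ?_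
    simp only [zero_smul, add_zero, h1, inv_one, Matrix.mul_one, Matrix.one_mul, Matrix.neg_apply,
      Matrix.add_apply, Matrix.sub_apply, Matrix.neg_mul, Matrix.mul_neg, of_apply, f4, f5, f3]
    ring
  exact deriv_zero_line hΩ (u := fun y => ∑ a, ∑ b, ((-((f2 e f y)⁻¹ * Matrix.of (f3 e f y j) * (f2 e f y)⁻¹)) b a * f3 e f y i a b
      + (f2 e f y)⁻¹ b a * f4 e f y j i a b))
    (fun y hy => trace2 hΩ hf e hc hdet hy i j) hx (e k)
    (HasDerivAt.fun_sum fun a _ => HasDerivAt.fun_sum fun b _ => h2 a b)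

lemma f3_s1 {Ω : Set (Fin n → ℝ)} (hΩ : IsOpen Ω) {f : (Fin n → ℝ) → ℝ}
    (hf : ContDiffOn ℝ (⊤ : ℕ∞) f Ω) (e : Fin n → Fin n → ℝ) {x : Fin n → ℝ} (hx : x ∈ Ω) (a b c) :
    f3 e f x a b c = f3 e f x b a c := dd_comm hΩ (dd_smooth hΩ hf _) hx _ _
lemma f3_s2 {Ω : Set (Fin n → ℝ)} (hΩ : IsOpen Ω) {f : (Fin n → ℝ) → ℝ}
    (hf : ContDiffOn ℝ (⊤ : ℕ∞) f Ω) (e : Fin n → Fin n → ℝ) {x : Fin n → ℝ} (hx : x ∈ Ω) (a b c) :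
    f3 e f x a b c = f3 e f x a c b := dd_congr hΩ (fun y hy => dd_comm hΩ hf hy _ _) hx _
lemma f4_s1 {Ω : Set (Fin n → ℝ)} (hΩ : IsOpen Ω) {f : (Fin n → ℝ) → ℝ}
    (hf : ContDiffOn ℝ (⊤ : ℕ∞) f Ω) (e : Fin n → Fin n → ℝ) {x : Fin n → ℝ} (hx : x ∈ Ω) (a b c d) :
    f4 e f x a b c d = f4 e f x b a c d := f3_s1 hΩ (dd_smooth hΩ hf (e d)) e hx a b c
lemma f4_s2 {Ω : Set (Fin n → ℝ)} (hΩ : IsOpen Ω) {f : (Fin n → ℝ) → ℝ}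
    (hf : ContDiffOn ℝ (⊤ : ℕ∞) f Ω) (e : Fin n → Fin n → ℝ) {x : Fin n → ℝ} (hx : x ∈ Ω) (a b c d) :
    f4 e f x a b c d = f4 e f x a c b d := f3_s2 hΩ (dd_smooth hΩ hf (e d)) e hx a b c
lemma f4_s3 {Ω : Set (Fin n → ℝ)} (hΩ : IsOpen Ω) {f : (Fin n → ℝ) → ℝ}
    (hf : ContDiffOn ℝ (⊤ : ℕ∞) f Ω) (e : Fin n → Fin n → ℝ) {x : Fin n → ℝ} (hx : x ∈ Ω) (a b c d) :
    f4 e f x a b c d = f4 e f x a b d c := dd_congr hΩ (fun y hy => f3_s2 hΩ hf e hy b c d) hx _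
lemma f5_s1 {Ω : Set (Fin n → ℝ)} (hΩ : IsOpen Ω) {f : (Fin n → ℝ) → ℝ}
    (hf : ContDiffOn ℝ (⊤ : ℕ∞) f Ω) (e : Fin n → Fin n → ℝ) {x : Fin n → ℝ} (hx : x ∈ Ω) (a b c d k) :
    f5 e f x a b c d k = f5 e f x b a c d k := f4_s1 hΩ (dd_smooth hΩ hf (e k)) e hx a b c d
lemma f5_s2 {Ω : Set (Fin n → ℝ)} (hΩ : IsOpen Ω) {f : (Fin n → ℝ) → ℝ}
    (hf : ContDiffOn ℝ (⊤ : ℕ∞) f Ω) (e : Fin n → Fin n → ℝ) {x : Fin n → ℝ} (hx : x ∈ Ω) (a b c d k) :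
    f5 e f x a b c d k = f5 e f x a c b d k := f4_s2 hΩ (dd_smooth hΩ hf (e k)) e hx a b c d
lemma f5_s3 {Ω : Set (Fin n → ℝ)} (hΩ : IsOpen Ω) {f : (Fin n → ℝ) → ℝ}
    (hf : ContDiffOn ℝ (⊤ : ℕ∞) f Ω) (e : Fin n → Fin n → ℝ) {x : Fin n → ℝ} (hx : x ∈ Ω) (a b c d k) :
    f5 e f x a b c d k = f5 e f x a b d c k := f4_s3 hΩ (dd_smooth hΩ hf (e k)) e hx a b c d
lemma f5_s4 {Ω : Set (Fin n → ℝ)} (hΩ : IsOpen Ω) {f : (Fin n → ℝ) → ℝ}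
    (hf : ContDiffOn ℝ (⊤ : ℕ∞) f Ω) (e : Fin n → Fin n → ℝ) {x : Fin n → ℝ} (hx : x ∈ Ω) (a b c d k) :
    f5 e f x a b c d k = f5 e f x a b c k d := dd_congr hΩ (fun y hy => f4_s3 hΩ hf e hy b c d k) hx _

lemma f5_cyc {Ω : Set (Fin n → ℝ)} (hΩ : IsOpen Ω) {f : (Fin n → ℝ) → ℝ}
    (hf : ContDiffOn ℝ (⊤ : ℕ∞) f Ω) (e : Fin n → Fin n → ℝ) {x : Fin n → ℝ} (hx : x ∈ Ω) (i j k s) :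
    f5 e f x s s i j k = f5 e f x k j i s s := by
  have s1 := f5_s1 hΩ hf e hx
  have s2 := f5_s2 hΩ hf e hx
  have s3 := f5_s3 hΩ hf e hx
  have s4 := f5_s4 hΩ hf e hx
  rw [s4 s s i j k, s3 s s i k j, s2 s s k i j, s1 s k s i j, s4 k s s i j, s3 k s s j i, s2 k s j s i,
   s4 k j s s i, s3 k j s i s]

lemma calabi_point {Ω : Set (Fin n → ℝ)} (hΩ : IsOpen Ω) {f : (Fin n → ℝ) → ℝ}
    (hf : ContDiffOn ℝ (⊤ : ℕ∞) f Ω) (e : Fin n → Fin n → ℝ) {c : ℝ} (hc : c ≠ 0)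
    (hdet : ∀ x ∈ Ω, (f2 e f x).det = c) {x : Fin n → ℝ} (hx : x ∈ Ω) (h1 : f2 e f x = 1)
    (A : Fin n → Fin n → Fin n → ℝ) (B C : Fin n → Fin n → Fin n → Fin n → ℝ)
    (hA : A = f3 e f x) (hB : B = f4 e f x) (hC : C = fun s => f5 e f x s s) :
    (ip3 A A) ^ 2 ≤ 2 * n * ∑ s, (2 * ip3 A (C s) + 4 * ip3 (B s) (B s - Pt A s) -
      (ip3 A (t3dd A (B s - Pt A s) (A s) (B s s)) +
       2 * ip3 (B s - Pt A s) ((B s - Pt A s) + Pt A s))) := by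
  have a1 : ∀ a b c, A a b c = A b a c := by subst hA; exact f3_s1 hΩ hf e hx
  have a2 : ∀ a b c, A a b c = A a c b := by subst hA; exact f3_s2 hΩ hf e hx
  have b1 : ∀ a b c d, B a b c d = B b a c d := by subst hB; exact f4_s1 hΩ hf e hx
  have b2 : ∀ a b c d, B a b c d = B a c b d := by subst hB; exact f4_s2 hΩ hf e hx
  have b3 : ∀ a b c d, B a b c d = B a b d c := by subst hB; exact f4_s3 hΩ hf e hx
  refine calabi_algebra A B C a1 a2 b1 b2 b3 ?_ ?_
  · intro i j
    have h := trace2 hΩ hf e hc hdet hx i j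
    rw [h1, ← hA, ← hB] at h
    simp only [inv_one, Matrix.one_mul, Matrix.mul_one, Matrix.neg_apply, of_apply, Finset.sum_add_distrib, 
      Matrix.one_apply, ite_mul, one_mul, zero_mul, Finset.sum_ite_eq', Finset.mem_univ, if_true, neg_mul,
      Finset.sum_neg_distrib] at h
    have e1 : ∀ s, B s s i j = B j i s s := by
      intro s
      rw [b3 s s i j, b2 s s j i, b1 s j s i, b3 j s s i, b2 j s i s]
    have e2 : ∀ a b, A a b i * A a b j = A j b a * A i a b := by
      intro a b
      rw [a2 a b i, a1 a i b, a2 a b j, a1 a j b, a2 j a b]; ring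
    simp only [e1, e2]
    linarith
  · intro i j k
    have h := trace3 hΩ hf e hc hdet hx h1 i j k
    rw [← hA, ← hB] at h
    simp only [Matrix.sub_apply, Matrix.add_apply, sub_mul, add_mul, of_apply, Finset.sum_add_distrib, Finset.sum_sub_distrib,
      Matrix.one_apply, ite_mul, one_mul, zero_mul, Finset.sum_ite_eq', Finset.mem_univ, if_true, neg_mul,
      Finset.sum_neg_distrib, Matrix.mul_apply, Finset.sum_mul] at h
    have e0 : ∀ s, C s i j k = f5 e f x k j i s s := by
      intro s; rw [hC]; exact f5_cyc hΩ hf e hx i j k s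
    have e1 : ∀ a b, A a b k * B a b i j = A k b a * B j i a b := by
      intro a b
      rw [a2 a b k, a1 a k b, a2 k a b]
      rw [b3 a b i j, b2 a b j i, b1 a j b i, b3 j a b i, b2 j a i b]
    have e2 : ∀ a b, A a b j * B a b i k = A j b a * B k i a b := by
      intro a b
      rw [a2 a b j, a1 a j b, a2 j a b]
      rw [b3 a b i k, b2 a b k i, b1 a k b i, b3 k a b i, b2 k a i b]
    have e3 : ∀ a b, A a b i * B a b j k = B k j b a * A i a b := by
      intro a b
      rw [a2 a b i, a1 a i b]
      rw [b3 a b j k, b2 a b k j, b1 a k b j, b3 k a b j, b2 k a j b, b3 k j a b]; ring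
    have e4 : ∑ a, ∑ b, ∑ c, A a b i * A b c j * A c a k = ∑ a, ∑ b, ∑ c, A k b c * A j c a * A i a b := by
      -- c -> 
      have : ∀ a b c, A a b i * A b c j * A c a k = A k a c * A j c b * A i b a := by
        intro a b c
        rw [a2 a b i, a1 a i b, a2 i a b, a2 b c j, a1 b j c, a2 j b c, a2 c a k, a1 c k a, a2 k c a]; ring
      simp only [this]
      rw [Finset.sum_comm]
    have e5 : ∑ a, ∑ b, ∑ c, A a b i * A b c j * A c a k = ∑ a, ∑ b, ∑ c, A j b c * A k c a * A i a b := by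
      have : ∀ a b c, A a b i * A b c j * A c a k = A j b c * A k c a * A i a b := by
        intro a b c
        rw [a2 a b i, a1 a i b, a2 b c j, a1 b j c, a2 c a k, a1 c k a]; ring
      simp only [this]
    simp only [e0, e1, e2, e3]
    linarith
end trace

section jets
variable {n : ℕ}

/-- second order jet at 0 -/
def Jet2 (u : ℝ → ℝ) (a b c : ℝ) : Prop :=
  ∃ u' : ℝ → ℝ, (∀ᶠ t in nhds 0, HasDerivAt u (u' t) t) ∧ u 0 = a ∧ u' 0 = b ∧ HasDerivAt u' c 0

lemma Jet2.add {u v : ℝ → ℝ} {a b c a' b' c' : ℝ} (h : Jet2 u a b c) (k : Jet2 v a' b' c') :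
    Jet2 (fun t => u t + v t) (a + a') (b + b') (c + c') := by
  obtain ⟨u', h1, h2, h3, h4⟩ := h
  obtain ⟨v', k1, k2, k3, k4⟩ := k
  refine ⟨fun t => u' t + v' t, ?_, by simp [h2, k2], by simp [h3, k3], h4.add k4⟩
  filter_upwards [h1, k1] with t x y using x.add y

lemma Jet2.mul {u v : ℝ → ℝ} {a b c a' b' c' : ℝ} (h : Jet2 u a b c) (k : Jet2 v a' b' c') :
    Jet2 (fun t => u t * v t) (a * a') (b * a' + a * b') (c * a' + 2 * (b * b') + a * c') := by
  obtain ⟨u', h1, h2, h3, h4⟩ := h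
  obtain ⟨v', k1, k2, k3, k4⟩ := k
  refine ⟨fun t => u' t * v t + u t * v' t, ?_, by simp [h2, k2], by simp [h2, h3, k2, k3], ?_⟩
  · filter_upwards [h1, k1] with t x y using x.mul y
  · have := (h4.mul k1.self_of_nhds).add (h1.self_of_nhds.mul k4)
    refine this.congr_deriv ?_
    rw [h2, h3, k2, k3]; ring

lemma jet2_poly (a b c : ℝ) : Jet2 (fun t => a + t * b + t ^ 2 * c) a b (2 * c) := by
  refine ⟨fun t => b + 2 * t * c, ?_, by simp, by simp, ?_⟩
  · refine Filter.Eventually.of_forall fun t => ?_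
    have := ((hasDerivAt_const t a).add ((hasDerivAt_id t).mul_const b)).add ((hasDerivAt_pow 2 t).mul_const c)
    refine this.congr_deriv (by simp)
  · have := (hasDerivAt_const (0 : ℝ) b).add (((hasDerivAt_id (0:ℝ)).const_mul 2).mul_const c)
    refine this.congr_deriv (by simp)

lemma jet2_const (a : ℝ) : Jet2 (fun _ => a) a 0 0 := by
  simpa using jet2_poly a 0 0

lemma Jet2.congr {u v : ℝ → ℝ} {a b c a' b' c' : ℝ} (h : Jet2 u a b c) (huv : ∀ t, v t = u t)
    (ha : a' = a) (hb : b' = b) (hc : c' = c) : Jet2 v a' b' c' := by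
  obtain rfl : v = u := funext huv
  subst ha hb hc; exact h

lemma Jet2.sum {ι : Type*} (s : Finset ι) {u : ι → ℝ → ℝ} {a b c : ι → ℝ} (h : ∀ i, Jet2 (u i) (a i) (b i) (c i)) :
    Jet2 (fun t => ∑ i ∈ s, u i t) (∑ i ∈ s, a i) (∑ i ∈ s, b i) (∑ i ∈ s, c i) := by
  classical
  induction s using Finset.induction_on with
  | empty => simpa using jet2_const 0
  | insert i s hi ih =>
    simp only [Finset.sum_insert hi]
    exact (h i).add ih

lemma Jet2.max {u : ℝ → ℝ} {a b c : ℝ} (h : Jet2 u a b c) (hm : ∀ᶠ t in nhds 0, u t ≤ u 0) : c ≤ 0 := by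
  obtain ⟨u', h1, h2, h3, h4⟩ := h
  by_contra hc
  push Not at hc
  have hd : deriv u =ᶠ[nhds 0] u' := by filter_upwards [h1] with t ht using ht.deriv
  have hdd : deriv (deriv u) 0 = c := by rw [hd.deriv_eq]; exact h4.deriv
  have hmax : IsLocalMax u 0 := hm
  have hmin := isLocalMin_of_deriv_deriv_pos (f := u) (by rw [hdd]; exact hc) hmax.deriv_eq_zero
    h1.self_of_nhds.continuousAt
  have heq : u =ᶠ[nhds 0] fun _ => u 0 := by
    filter_upwards [hm, hmin] with t x y using le_antisymm x y
  have h5 : deriv u =ᶠ[nhds 0] deriv (fun _ => u 0) := heq.deriv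
  have : deriv (deriv u) 0 = 0 := by rw [h5.deriv_eq]; simp
  rw [hdd] at this; linarith

/-- tensor jets -/
def JT (T : ℝ → Fin n → Fin n → Fin n → ℝ) (a b c : Fin n → Fin n → Fin n → ℝ) : Prop :=
  ∀ i j k, Jet2 (fun t => T t i j k) (a i j k) (b i j k) (c i j k)

lemma JT.ip3 {T U : ℝ → Fin n → Fin n → Fin n → ℝ} {a b c a' b' c' : Fin n → Fin n → Fin n → ℝ}
    (h : JT T a b c) (k : JT U a' b' c') :
    Jet2 (fun t => ip3 (T t) (U t)) (ip3 a a') (ip3 b a' + ip3 a b') (ip3 c a' + 2 * ip3 b b' + ip3 a c') := by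
  refine (Jet2.sum Finset.univ fun i => Jet2.sum Finset.univ fun j => Jet2.sum Finset.univ fun l => (h i j l).mul (k i j l)).congr
    (fun t => rfl) rfl ?_ ?_
  · simp only [_root_.ip3, Finset.sum_add_distrib]
  · simp only [_root_.ip3, Finset.sum_add_distrib, Finset.mul_sum]

lemma JT.oo1 {T : ℝ → Fin n → Fin n → Fin n → ℝ} {a b c : Fin n → Fin n → Fin n → ℝ}
    {g : ℝ → Fin n → Fin n → ℝ} {g1 g2 : Fin n → Fin n → ℝ}
    (hg : ∀ i j, Jet2 (fun t => g t i j) ((1 : Matrix (Fin n) (Fin n) ℝ) i j) (g1 i j) (g2 i j))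
    (h : JT T a b c) :
    JT (fun t => oo1 (g t) (T t)) a (b + oo1 g1 a) (c + (2 : ℝ) • oo1 g1 b + oo1 g2 a) := by
  intro i j k
  refine (Jet2.sum Finset.univ fun l => (hg i l).mul (h l j k)).congr (fun t => rfl) ?_ ?_ ?_
  · simp [Matrix.one_apply]
  · simp [Matrix.one_apply, _root_.oo1, Finset.sum_add_distrib, add_comm]
  · simp [Matrix.one_apply, _root_.oo1, Finset.sum_add_distrib, Finset.mul_sum]; ring
lemma JT.oo2 {T : ℝ → Fin n → Fin n → Fin n → ℝ} {a b c : Fin n → Fin n → Fin n → ℝ}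
    {g : ℝ → Fin n → Fin n → ℝ} {g1 g2 : Fin n → Fin n → ℝ}
    (hg : ∀ i j, Jet2 (fun t => g t i j) ((1 : Matrix (Fin n) (Fin n) ℝ) i j) (g1 i j) (g2 i j))
    (h : JT T a b c) :
    JT (fun t => oo2 (g t) (T t)) a (b + oo2 g1 a) (c + (2 : ℝ) • oo2 g1 b + oo2 g2 a) := by
  intro i j k
  refine (Jet2.sum Finset.univ fun l => (hg j l).mul (h i l k)).congr (fun t => rfl) ?_ ?_ ?_
  · simp [Matrix.one_apply]
  · simp [Matrix.one_apply, _root_.oo2, Finset.sum_add_distrib, add_comm]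
  · simp [Matrix.one_apply, _root_.oo2, Finset.sum_add_distrib, Finset.mul_sum]; ring
lemma JT.oo3 {T : ℝ → Fin n → Fin n → Fin n → ℝ} {a b c : Fin n → Fin n → Fin n → ℝ}
    {g : ℝ → Fin n → Fin n → ℝ} {g1 g2 : Fin n → Fin n → ℝ}
    (hg : ∀ i j, Jet2 (fun t => g t i j) ((1 : Matrix (Fin n) (Fin n) ℝ) i j) (g1 i j) (g2 i j))
    (h : JT T a b c) :
    JT (fun t => oo3 (g t) (T t)) a (b + oo3 g1 a) (c + (2 : ℝ) • oo3 g1 b + oo3 g2 a) := by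
  intro i j k
  refine (Jet2.sum Finset.univ fun l => (hg k l).mul (h i j l)).congr (fun t => rfl) ?_ ?_ ?_
  · simp [Matrix.one_apply]
  · simp [Matrix.one_apply, _root_.oo3, Finset.sum_add_distrib, add_comm]
  · simp [Matrix.one_apply, _root_.oo3, Finset.sum_add_distrib, Finset.mul_sum]; ring

lemma oo1_add (M : Fin n → Fin n → ℝ) (a b : Fin n → Fin n → Fin n → ℝ) : oo1 M (a + b) = oo1 M a + oo1 M b := by
  funext i j k; simp [oo1, mul_add, Finset.sum_add_distrib]
lemma oo2_add (M : Fin n → Fin n → ℝ) (a b : Fin n → Fin n → Fin n → ℝ) : oo2 M (a + b) = oo2 M a + oo2 M b := by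
  funext i j k; simp [oo2, mul_add, Finset.sum_add_distrib]

lemma barrier_jet {a : ℝ → Fin n → Fin n → Fin n → ℝ} {g : ℝ → Fin n → Fin n → ℝ}
    {A B C : Fin n → Fin n → Fin n → ℝ} {g1 g2 : Fin n → Fin n → ℝ} (σ : Fin n → Fin n → Fin n → ℝ)
    (hg : ∀ i j, Jet2 (fun t => g t i j) ((1 : Matrix (Fin n) (Fin n) ℝ) i j) (g1 i j) (g2 i j))
    (ha : JT a A B C) : ∃ b, 
    Jet2 (fun t => 2 * ip3 (a t) (A + t • σ) - 
      ip3 (A + t • σ) (oo1 (g t) (oo2 (g t) (oo3 (g t) (A + t • σ))))) (ip3 A A) b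
      (2 * ip3 A C + 4 * ip3 B σ - (ip3 A (t3dd A σ g1 g2) + 2 * ip3 σ (σ + (oo1 g1 A + oo2 g1 A + oo3 g1 A)))) := by
  have hτ : JT (fun t => A + t • σ) A σ 0 := by
    intro i j k
    refine (jet2_poly (A i j k) (σ i j k) 0).congr (fun t => by simp) rfl rfl (by simp)
  have h1 := (jet2_const 2).mul (ha.ip3 hτ)
  have h2 := (jet2_const (-1)).mul (hτ.ip3 (((hτ.oo3 hg).oo2 hg).oo1 hg))
  refine ⟨_, (h1.add h2).congr (fun t => by ring) (by ring) rfl ?_⟩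
  have e1 : (0 + (2:ℝ) • oo3 g1 σ + oo3 g2 A + (2:ℝ) • oo2 g1 (σ + oo3 g1 A) + oo2 g2 A +
     (2:ℝ) • oo1 g1 (σ + oo3 g1 A + oo2 g1 A) + oo1 g2 A) = t3dd A σ g1 g2 := by
    simp only [oo1_add, oo2_add, t3dd, smul_add]; abel
  have e2 : (σ + oo3 g1 A + oo2 g1 A + oo1 g1 A) = σ + (oo1 g1 A + oo2 g1 A + oo3 g1 A) := by abel
  rw [e1, e2, ip3_comm C A]
  have e3 : ∀ X : Fin n → Fin n → Fin n → ℝ, ip3 0 X = 0 := by intro X; simp [ip3]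
  have e4 : ∀ X : Fin n → Fin n → Fin n → ℝ, ip3 X 0 = 0 := by intro X; simp [ip3]
  rw [e3, e4]; ring

lemma jet2_line {Ω : Set (Fin n → ℝ)} (hΩ : IsOpen Ω) {u : (Fin n → ℝ) → ℝ}
    (hu : ContDiffOn ℝ (⊤ : ℕ∞) u Ω) {x : Fin n → ℝ} (hx : x ∈ Ω) (v : Fin n → ℝ) :
    Jet2 (fun t : ℝ => u (x + t • v)) (u x) (dd v u x) (dd v (dd v u) x) := by
  refine ⟨fun t => dd v u (x + t • v), ?_, by simp, by simp, dd_line0 hΩ (dd_smooth hΩ hu v) hx v⟩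
  filter_upwards [line_mem hΩ v 0 (x := x) (by simpa using hx)] with t ht
  exact dd_line x v t (sm_diff hΩ hu ht)

lemma calabi_max {Ω : Set (Fin n → ℝ)} (hΩ : IsOpen Ω) {f : (Fin n → ℝ) → ℝ}
    (hf : ContDiffOn ℝ (⊤ : ℕ∞) f Ω) (hpos : ∀ x ∈ Ω, (Hess n f x).PosDef) {c : ℝ}
    (hdet : ∀ x ∈ Ω, (Hess n f x).det = c) {x : Fin n → ℝ} (hx : x ∈ Ω)
    (M : Matrix (Fin n) (Fin n) ℝ) (q : Fin n → ℝ) (lam κ : ℝ) (hlam : 0 ≤ lam)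
    (hM : ∀ v, v ⬝ᵥ (M *ᵥ v) ≤ κ * (v ⬝ᵥ (Hess n f x *ᵥ v)))
    (hmax : ∀ᶠ y in nhds x, JJ f y - lam * ((y - q) ⬝ᵥ (M *ᵥ (y - q))) ≤
      JJ f x - lam * ((x - q) ⬝ᵥ (M *ᵥ (x - q)))) :
    JJ f x ^ 2 ≤ 4 * n ^ 2 * (lam * κ) := by
  obtain ⟨E, hE⟩ := exists_frame (hpos x hx)
  set e := colv E with he
  have hc : c ≠ 0 := by rw [← hdet x hx]; exact (hpos x hx).det_pos.ne'
  have hEd : E.det ≠ 0 := by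
    intro h0
    have := congrArg det hE
    rw [det_mul, h0, mul_zero, det_one] at this
    exact zero_ne_one this
  have hdet' : ∀ y ∈ Ω, (f2 e f y).det = E.det * c * E.det := by
    intro y hy
    rw [f2_frame hΩ hf hy, det_mul, det_mul, det_transpose, hdet y hy]
  have h1 : f2 e f x = 1 := by rw [f2_frame hΩ hf hx, hE]
  have hJx : JJ f x = ip3 (f3 e f x) (f3 e f x) := by
    rw [f3_frame hΩ hf hx]; exact J3_eq E hE _
  have key := calabi_point hΩ hf e (mul_ne_zero (mul_ne_zero hEd hc) hEd) hdet' hx h1 _ _ _ rfl rfl rfl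
  rw [← hJx] at key
  refine key.trans ?_
  have hs : ∀ s, (2 * ip3 (f3 e f x) (f5 e f x s s) + 4 * ip3 (f4 e f x s) (f4 e f x s - Pt (f3 e f x) s) -
          (ip3 (f3 e f x) (t3dd (f3 e f x) (f4 e f x s - Pt (f3 e f x) s) (f3 e f x s) (f4 e f x s s)) +
            2 * ip3 (f4 e f x s - Pt (f3 e f x) s) (f4 e f x s - Pt (f3 e f x) s + Pt (f3 e f x) s))) ≤ 2 * (lam * κ) := by
    intro s
    set A := f3 e f x with hA
    set B := f4 e f x with hB
    set σ := B s - Pt A s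
    obtain ⟨b, hj⟩ := barrier_jet (n := n) (a := fun t => f3 e f (x + t • e s)) (A := A) (B := B s) 
      (C := f5 e f x s s) (g := fun t => f2 e f (x + t • e s)) (g1 := A s) (g2 := B s s) σ
      (by
        intro i j
        have := jet2_line hΩ (dd_smooth hΩ (dd_smooth hΩ hf (e j)) (e i)) hx (e s)
        rw [← h1]; exact this)
      (by
        intro i j k
        exact jet2_line hΩ (dd_smooth hΩ (dd_smooth hΩ (dd_smooth hΩ hf (e k)) (e j)) (e i)) hx (e s))
    have hphi := jet2_poly (-lam * ((x - q) ⬝ᵥ (M *ᵥ (x - q))))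
      (-lam * ((x - q) ⬝ᵥ (M *ᵥ e s) + e s ⬝ᵥ (M *ᵥ (x - q)))) (-lam * (e s ⬝ᵥ (M *ᵥ e s)))
    have hphieq : ∀ t : ℝ, (-lam * ((x - q) ⬝ᵥ (M *ᵥ (x - q))) + t *
      (-lam * ((x - q) ⬝ᵥ (M *ᵥ e s) + e s ⬝ᵥ (M *ᵥ (x - q)))) + t ^ 2 * (-lam * (e s ⬝ᵥ (M *ᵥ e s)))) 
       = -lam * ((x + t • e s - q) ⬝ᵥ (M *ᵥ (x + t • e s - q))) := by
      intro t
      have : x + t • e s - q = (x - q) + t • e s := by abel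
      rw [this]
      simp only [mulVec_add, mulVec_smul, dotProduct_add, add_dotProduct, smul_dotProduct, dotProduct_smul, smul_eq_mul]
      ring
    have htot := hj.add hphi
    have hle := htot.max (by
      have hl : Filter.Tendsto (fun t : ℝ => x + t • e s) (nhds 0) (nhds x) := by
        have : Continuous fun t : ℝ => x + t • e s := by fun_prop
        simpa using this.tendsto 0
      filter_upwards [hl.eventually hmax, hl.eventually (hΩ.mem_nhds hx)] with t ht hmem
      have hv := hj.choose_spec.2.1
      have hb := J3_ge (hpos _ hmem) E (f3 (stdb n) f (x + t • e s)) (A + t • σ)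
      rw [← f3_frame hΩ hf hmem, ← f2_frame hΩ hf hmem] at hb
      change _ ≤ JJ f (x + t • e s) at hb
      rw [hphieq t, hphieq 0]
      beta_reduce at hv
      rw [hv, ← hJx]
      simp only [zero_smul, add_zero]
      linarith)
    have hMe := hM (e s)
    have he1 : e s ⬝ᵥ (Hess n f x *ᵥ e s) = 1 := by
      have := congrFun (congrFun h1 s) s
      rw [f2, of_apply, dd2_quad hΩ hf hx] at this
      rw [this]; simp
    rw [he1, mul_one] at hMe
    have := mul_le_mul_of_nonneg_left hMe hlam
    change _ ≤ 0 at hle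
    rw [show oo1 (A s) A + oo2 (A s) A + oo3 (A s) A = Pt A s from rfl] at hle
    linarith
  calc _ ≤ 2 * (n:ℝ) * ∑ s : Fin n, 2 * (lam * κ) := by
        gcongr with s
        exact hs s
    _ = _ := by simp; ring

end jets

section seg
variable {n : ℕ}

/-- metric quadratic form -/
noncomputable def nq (f : (Fin n → ℝ) → ℝ) (x v : Fin n → ℝ) : ℝ := v ⬝ᵥ (Hess n f x *ᵥ v)

lemma nq_smul (f : (Fin n → ℝ) → ℝ) (x v : Fin n → ℝ) (t : ℝ) : nq f x (t • v) = t ^ 2 * nq f x v := by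
  simp only [nq, mulVec_smul, dotProduct_smul, smul_dotProduct, smul_eq_mul]; ring

lemma nq_nonneg {f : (Fin n → ℝ) → ℝ} {x : Fin n → ℝ} (h : (Hess n f x).PosDef) (v : Fin n → ℝ) :
    0 ≤ nq f x v := by simpa [nq] using h.posSemidef.dotProduct_mulVec_nonneg v

lemma nq_pos {f : (Fin n → ℝ) → ℝ} {x : Fin n → ℝ} (h : (Hess n f x).PosDef) {v : Fin n → ℝ} (hv : v ≠ 0) :
    0 < nq f x v := by simpa [nq] using h.dotProduct_mulVec_pos hv

lemma hess_cont {Ω : Set (Fin n → ℝ)} (hΩ : IsOpen Ω) {f : (Fin n → ℝ) → ℝ}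
    (hf : ContDiffOn ℝ (⊤ : ℕ∞) f Ω) : ContinuousOn (fun x => Hess n f x) Ω := by
  refine continuousOn_pi.2 fun i => continuousOn_pi.2 fun j => ?_
  exact (dd_smooth hΩ (dd_smooth hΩ hf _) _).continuousOn

lemma nq_cont {Ω : Set (Fin n → ℝ)} (hΩ : IsOpen Ω) {f : (Fin n → ℝ) → ℝ}
    (hf : ContDiffOn ℝ (⊤ : ℕ∞) f Ω) : 
    ContinuousOn (fun p : (Fin n → ℝ) × (Fin n → ℝ) => nq f p.1 p.2) (Ω ×ˢ Set.univ) := by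
  have h1 : ContinuousOn (fun p : (Fin n → ℝ) × (Fin n → ℝ) => Hess n f p.1) (Ω ×ˢ Set.univ) :=
    (hess_cont hΩ hf).comp continuous_fst.continuousOn (fun p hp => hp.1)
  unfold nq
  simp only [dotProduct, mulVec]
  refine continuousOn_finsetSum _ fun i _ => ?_
  refine ContinuousOn.mul (by fun_prop) (continuousOn_finsetSum _ fun j _ => ?_)
  refine ContinuousOn.mul ?_ (by fun_prop)
  exact (continuous_apply_apply i j).comp_continuousOn h1

lemma JJ_cont {Ω : Set (Fin n → ℝ)} (hΩ : IsOpen Ω) {f : (Fin n → ℝ) → ℝ}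
    (hf : ContDiffOn ℝ (⊤ : ℕ∞) f Ω) (hpos : ∀ x ∈ Ω, (Hess n f x).PosDef) : ContinuousOn (JJ f) Ω := by
  have h1 := hess_cont hΩ hf
  have hv : ContinuousOn (fun x => vec3 (f3 (stdb n) f x)) Ω :=
    continuousOn_pi.2 fun p => (dd_smooth hΩ (dd_smooth hΩ (dd_smooth hΩ hf _) _) _).continuousOn
  set M : (Fin n → ℝ) → Matrix (Fin n × Fin n × Fin n) (Fin n × Fin n × Fin n) ℝ := 
    fun x => kroneckerMap (· * ·) (Hess n f x) (kroneckerMap (· * ·) (Hess n f x) (Hess n f x)) with hM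
  have h2 : ContinuousOn M Ω := by
    refine continuousOn_pi.2 fun p => continuousOn_pi.2 fun r => ?_
    simp only [hM, kroneckerMap_apply]
    exact ((continuous_apply_apply _ _).comp_continuousOn h1).mul
      (((continuous_apply_apply _ _).comp_continuousOn h1).mul ((continuous_apply_apply _ _).comp_continuousOn h1))
  have h3 : ContinuousOn (fun x => (M x)⁻¹) Ω := by
    simp only [inv_def, Ring.inverse_eq_inv']
    have k1 : ContinuousOn (fun x => (M x).det) Ω :=
      (show Continuous fun A : Matrix (Fin n × Fin n × Fin n) (Fin n × Fin n × Fin n) ℝ => A.det from continuous_id.matrix_det).comp_continuousOn h2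
    have k2 : ContinuousOn (fun x => (M x).adjugate) Ω :=
      (show Continuous fun A : Matrix (Fin n × Fin n × Fin n) (Fin n × Fin n × Fin n) ℝ => A.adjugate from continuous_id.matrix_adjugate).comp_continuousOn h2
    exact (k1.inv₀ (fun x hx => (kron_pd (hpos x hx)).det_pos.ne')).smul k2
  have : JJ f = fun x => vec3 (f3 (stdb n) f x) ⬝ᵥ ((M x)⁻¹ *ᵥ vec3 (f3 (stdb n) f x)) := rfl
  rw [this]
  simp only [dotProduct, mulVec]
  refine continuousOn_finsetSum _ fun i _ => ?_
  refine ContinuousOn.mul ((continuous_apply i).comp_continuousOn hv) (continuousOn_finsetSum _ fun j _ => ?_)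
  exact ((continuous_apply_apply i j).comp_continuousOn h3).mul ((continuous_apply j).comp_continuousOn hv)

lemma nq_lower {Ω : Set (Fin n → ℝ)} (hΩ : IsOpen Ω) {f : (Fin n → ℝ) → ℝ}
    (hf : ContDiffOn ℝ (⊤ : ℕ∞) f Ω) (hpos : ∀ x ∈ Ω, (Hess n f x).PosDef) {K : Set (Fin n → ℝ)}
    (hK : IsCompact K) (hKΩ : K ⊆ Ω) : ∃ c > 0, ∀ x ∈ K, ∀ v, c * ‖v‖ ^ 2 ≤ nq f x v := by
  have hS : IsCompact (K ×ˢ Metric.sphere (0 : Fin n → ℝ) 1) := hK.prod (isCompact_sphere 0 1)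
  have main : ∃ c > 0, ∀ x ∈ K, ∀ v : Fin n → ℝ, ‖v‖ = 1 → c ≤ nq f x v := by
    rcases (K ×ˢ Metric.sphere (0 : Fin n → ℝ) 1).eq_empty_or_nonempty with h | h
    · refine ⟨1, one_pos, fun x hx v hv => ?_⟩
      have : (x, v) ∈ K ×ˢ Metric.sphere (0 : Fin n → ℝ) 1 := ⟨hx, by simpa using hv⟩
      rw [h] at this; exact this.elim
    · obtain ⟨p, hp, hmin⟩ := hS.exists_isMinOn h ((nq_cont hΩ hf).mono (fun p hp => ⟨hKΩ hp.1, trivial⟩))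
      refine ⟨nq f p.1 p.2, nq_pos (hpos _ (hKΩ hp.1)) ?_, fun x hx v hv => 
        hmin (show (x, v) ∈ K ×ˢ Metric.sphere (0 : Fin n → ℝ) 1 from ⟨hx, by simpa using hv⟩)⟩
      have := hp.2
      intro h0; rw [h0] at this; simp at this
  obtain ⟨c, hc, h⟩ := main
  refine ⟨c, hc, fun x hx v => ?_⟩
  by_cases hv : v = 0
  · subst hv; simp [nq]
  · have hn : 0 < ‖v‖ := norm_pos_iff.2 hv
    have h1 := h x hx (‖v‖⁻¹ • v) (by rw [norm_smul, norm_inv, norm_norm, inv_mul_cancel₀ hn.ne'])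
    rw [nq_smul, inv_pow] at h1
    have : 0 < ‖v‖ ^ 2 := by positivity
    calc c * ‖v‖ ^ 2 ≤ ((‖v‖ ^ 2)⁻¹ * nq f x v) * ‖v‖ ^ 2 := by gcongr
      _ = nq f x v := by field_simp

lemma nq_line {Ω : Set (Fin n → ℝ)} (hΩ : IsOpen Ω) {f : (Fin n → ℝ) → ℝ}
    (hf : ContDiffOn ℝ (⊤ : ℕ∞) f Ω) (hpos : ∀ x ∈ Ω, (Hess n f x).PosDef) (q u w : Fin n → ℝ) (s : ℝ)
    (hx : q + s • u ∈ Ω) :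
    ∃ d, HasDerivAt (fun t : ℝ => nq f (q + t • u) w) d s ∧ 
      |d| ≤ Real.sqrt (JJ f (q + s • u)) * Real.sqrt (nq f (q + s • u) u) * nq f (q + s • u) w := by
  refine ⟨dd u (dd w (dd w f)) (q + s • u), ?_, ?_⟩
  · have h1 := dd_line q u s (sm_diff hΩ (dd_smooth hΩ (dd_smooth hΩ hf w) w) hx)
    refine h1.congr_of_eventuallyEq ?_
    filter_upwards [line_mem hΩ u s hx] with t ht
    exact (dd2_quad hΩ hf ht w w).symm
  · rw [dd3_lin hΩ hf hx]
    have h := J3_bound (hpos _ hx) (f3 (stdb n) f (q + s • u)) u w w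
    have hJ := J3_nonneg (hpos _ hx) (f3 (stdb n) f (q + s • u))
    have hu := nq_nonneg (hpos _ hx) u
    have hw := nq_nonneg (hpos _ hx) w
    refine abs_le_of_sq_le_sq' ?_ (by positivity) |> fun h => abs_le.2 h
    refine h.trans (le_of_eq ?_)
    change JJ f (q + s • u) * (nq f (q + s • u) u * (nq f (q + s • u) w * nq f (q + s • u) w)) = _
    rw [mul_pow, mul_pow, Real.sq_sqrt (show 0 ≤ JJ f _ from hJ), Real.sq_sqrt hu]; ring

/-- good segment -/
def GS (Ω : Set (Fin n → ℝ)) (f : (Fin n → ℝ) → ℝ) (q u : Fin n → ℝ) (m r : ℝ) : Prop :=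
  ∀ s ∈ Set.Icc (0:ℝ) r, q + s • u ∈ Ω ∧ JJ f (q + s • u) ≤ 4 * m

lemma seg_alpha {Ω : Set (Fin n → ℝ)} (hΩ : IsOpen Ω) {f : (Fin n → ℝ) → ℝ}
    (hf : ContDiffOn ℝ (⊤ : ℕ∞) f Ω) (hpos : ∀ x ∈ Ω, (Hess n f x).PosDef) {q u : Fin n → ℝ} {m r : ℝ}
    (hm : 0 < m) (hr1 : r ≤ 1) (hG : GS Ω f q u m r) (hu : nq f q u ≤ 1 / (4 * m)) {s : ℝ}
    (hs : s ∈ Set.Icc (0:ℝ) r) : nq f (q + s • u) u ≤ 4 * nq f q u := by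
  by_cases hu0 : u = 0
  · subst hu0; simp [nq]
  have hα : ∀ s ∈ Set.Icc (0:ℝ) r, 0 < nq f (q + s • u) u := fun s hs => nq_pos (hpos _ (hG s hs).1) hu0
  have hsm := Real.sqrt_pos.2 hm
  have hder : ∀ s ∈ Set.Icc (0:ℝ) r, ∃ d, HasDerivAt (fun t : ℝ => (Real.sqrt (nq f (q + t • u) u))⁻¹) d s ∧
      ‖d‖ ≤ Real.sqrt m := by
    intro s hs
    obtain ⟨d, hd, hb⟩ := nq_line hΩ hf hpos q u u s (hG s hs).1
    have ha := hα s hs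
    have h1 := (hd.sqrt ha.ne').fun_inv (Real.sqrt_pos.2 ha).ne'
    refine ⟨_, h1, ?_⟩
    rw [Real.norm_eq_abs, Real.sq_sqrt ha.le, abs_div, abs_neg, abs_div, abs_of_pos ha,
      abs_of_pos (by positivity : 0 < 2 * Real.sqrt (nq f (q + s • u) u)), div_div, div_le_iff₀ (by positivity)]
    have hJ : Real.sqrt (JJ f (q + s • u)) ≤ 2 * Real.sqrt m := by
      rw [Real.sqrt_le_left (by positivity), mul_pow, Real.sq_sqrt hm.le]
      linarith [(hG s hs).2]
    calc |d| ≤ _ := hb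
      _ ≤ 2 * Real.sqrt m * Real.sqrt (nq f (q + s • u) u) * nq f (q + s • u) u := by gcongr
      _ = _ := by ring
  choose! d hd hb using hder
  have hmv := norm_image_sub_le_of_norm_deriv_le_segment' 
    (fun t ht => (hd t ht).hasDerivWithinAt) (fun t ht => hb t ⟨ht.1, ht.2.le⟩) s hs
  simp only [zero_smul, add_zero, sub_zero, Real.norm_eq_abs] at hmv
  have h0 : 0 < nq f q u := by simpa using hα 0 ⟨le_rfl, hs.1.trans hs.2⟩
  have hs0 := Real.sqrt_pos.2 h0
  have hss := Real.sqrt_pos.2 (hα s hs)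
  set y0 := (Real.sqrt (nq f q u))⁻¹ with hy0
  set y := (Real.sqrt (nq f (q + s • u) u))⁻¹ with hy
  have h2 : 2 * Real.sqrt m ≤ y0 := by
    rw [hy0, le_inv_comm₀ (by positivity) hs0, Real.sqrt_le_left (by positivity), inv_pow, mul_pow, Real.sq_sqrt hm.le]
    refine hu.trans (le_of_eq ?_); rw [one_div]; norm_num
  have h3 := (abs_le.1 hmv).1
  have h4 : Real.sqrt m * s ≤ Real.sqrt m := by nlinarith [hs.1, hs.2]
  have h5 : y0 / 2 ≤ y := by linarith
  have h6 : Real.sqrt (nq f (q + s • u) u) ≤ 2 * Real.sqrt (nq f q u) := by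
    have hy0p : 0 < y0 := inv_pos.2 hs0
    have := inv_anti₀ (by positivity) h5
    rw [hy, inv_inv, inv_div, hy0, div_inv_eq_mul] at this
    exact this
  rw [Real.sqrt_le_left (by positivity), mul_pow, Real.sq_sqrt h0.le] at h6
  linarith

lemma seg_beta {Ω : Set (Fin n → ℝ)} (hΩ : IsOpen Ω) {f : (Fin n → ℝ) → ℝ}
    (hf : ContDiffOn ℝ (⊤ : ℕ∞) f Ω) (hpos : ∀ x ∈ Ω, (Hess n f x).PosDef) {q u : Fin n → ℝ} {m r : ℝ}
    (hm : 0 < m) (hr1 : r ≤ 1) (hG : GS Ω f q u m r) (hu : nq f q u ≤ 1 / (4 * m)) {s : ℝ}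
    (hs : s ∈ Set.Icc (0:ℝ) r) (w : Fin n → ℝ) :
    nq f (q + s • u) w ≤ Real.exp 2 * nq f q w ∧ nq f q w ≤ Real.exp 2 * nq f (q + s • u) w := by
  by_cases hw0 : w = 0
  · subst hw0; simp [nq]
  have hβ : ∀ s ∈ Set.Icc (0:ℝ) r, 0 < nq f (q + s • u) w := fun s hs => nq_pos (hpos _ (hG s hs).1) hw0
  have hsm := Real.sqrt_pos.2 hm
  have hder : ∀ s ∈ Set.Icc (0:ℝ) r, ∃ d, HasDerivAt (fun t : ℝ => Real.log (nq f (q + t • u) w)) d s ∧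
      ‖d‖ ≤ 2 := by
    intro s hs
    obtain ⟨d, hd, hb⟩ := nq_line hΩ hf hpos q u w s (hG s hs).1
    have ha := hβ s hs
    refine ⟨_, hd.log ha.ne', ?_⟩
    rw [Real.norm_eq_abs, abs_div, abs_of_pos ha, div_le_iff₀ ha]
    have hJ : Real.sqrt (JJ f (q + s • u)) ≤ 2 * Real.sqrt m := by
      rw [Real.sqrt_le_left (by positivity), mul_pow, Real.sq_sqrt hm.le]
      linarith [(hG s hs).2]
    have hA : Real.sqrt (nq f (q + s • u) u) ≤ (Real.sqrt m)⁻¹ := by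
      rw [Real.sqrt_le_left (by positivity), inv_pow, Real.sq_sqrt hm.le]
      refine (seg_alpha hΩ hf hpos hm hr1 hG hu hs).trans ?_
      calc 4 * nq f q u ≤ 4 * (1 / (4 * m)) := by gcongr
        _ = m⁻¹ := by field_simp
    calc |d| ≤ _ := hb
      _ ≤ 2 * Real.sqrt m * (Real.sqrt m)⁻¹ * nq f (q + s • u) w := by gcongr
      _ = _ := by field_simp
  choose! d hd hb using hder
  have hmv := norm_image_sub_le_of_norm_deriv_le_segment' 
    (fun t ht => (hd t ht).hasDerivWithinAt) (fun t ht => hb t ⟨ht.1, ht.2.le⟩) s hs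
  simp only [zero_smul, add_zero, sub_zero, Real.norm_eq_abs] at hmv
  have h0 : 0 < nq f q w := by simpa using hβ 0 ⟨le_rfl, hs.1.trans hs.2⟩
  have hs' := hβ s hs
  have hs1 : s ≤ 1 := hs.2.trans hr1
  obtain ⟨h1, h2⟩ := abs_le.1 hmv
  constructor
  · rw [← Real.exp_log hs', ← Real.exp_log h0, ← Real.exp_add, Real.exp_le_exp]
    linarith
  · rw [← Real.exp_log hs', ← Real.exp_log h0, ← Real.exp_add, Real.exp_le_exp]
    linarith

end seg

section step
variable {n : ℕ}

lemma leave {Ω : Set (Fin n → ℝ)} {f : (Fin n → ℝ) → ℝ}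
    (hcomp : CalabiComplete n Ω f) (q v : Fin n → ℝ) (C : ℝ) (hin : ∀ s ∈ Set.Ico (0:ℝ) 1, q + s • v ∈ Ω)
    (hC : ∀ s ∈ Set.Ico (0:ℝ) 1, nq f (q + s • v) v ≤ C) : q + v ∈ Ω := by
  by_contra hout
  have hcont : Continuous fun s : ℝ => q + s • v := by fun_prop
  have hd : ∀ t : ℝ, HasDerivAt (fun s : ℝ => q + s • v) v t := fun t => by
    simpa using ((hasDerivAt_id t).smul_const v).const_add q
  have h := hcomp (fun s => q + s • v) (by fun_prop) hin (by
    intro K hK hKc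
    have h1 : Kᶜ ∈ nhds (q + (1:ℝ) • v) := hKc.isClosed.isOpen_compl.mem_nhds (by
      rw [one_smul]; exact fun h => hout (hK h))
    have h2 := hcont.continuousAt.eventually_mem h1
    obtain ⟨δ, hδ, hb⟩ := Metric.eventually_nhds_iff.1 h2
    refine ⟨1 - δ, by linarith, fun t ht1 ht2 => ?_⟩
    exact hb (by rw [Real.dist_eq, abs_lt]; constructor <;> linarith))
  refine absurd h (ne_of_lt ?_)
  calc _ ≤ ∫⁻ t in Set.Ioo (0:ℝ) 1, ENNReal.ofReal (Real.sqrt C) := by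
        refine MeasureTheory.setLIntegral_mono' measurableSet_Ioo fun t ht => ?_
        rw [(hd t).deriv, dotProduct_comm]
        exact ENNReal.ofReal_le_ofReal (Real.sqrt_le_sqrt (hC t ⟨ht.1.le, ht.2⟩))
    _ < ⊤ := by simp

lemma continuation {Ω : Set (Fin n → ℝ)} (hΩ : IsOpen Ω) {f : (Fin n → ℝ) → ℝ}
    (hf : ContDiffOn ℝ (⊤ : ℕ∞) f Ω) (hpos : ∀ x ∈ Ω, (Hess n f x).PosDef) 
    (hcomp : CalabiComplete n Ω f) {q u : Fin n → ℝ} (hq : q ∈ Ω) {m ε : ℝ}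
    (hm : 0 < m) (hqm : JJ f q = m) (hε : ε ≤ 3) (hu : nq f q u ≤ 1 / (4 * m))
    (NG : ∀ r ∈ Set.Icc (0:ℝ) 1, GS Ω f q u m r → JJ f (q + r • u) < (1 + ε) * m) :
    GS Ω f q u m 1 := by
  set S := {r : ℝ | r ∈ Set.Icc (0:ℝ) 1 ∧ GS Ω f q u m r} with hS
  have h0 : (0:ℝ) ∈ S := by
    refine ⟨⟨le_rfl, zero_le_one⟩, fun s hs => ?_⟩
    obtain rfl : s = 0 := le_antisymm hs.2 hs.1
    simp only [zero_smul, add_zero]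
    exact ⟨hq, by rw [hqm]; linarith⟩
  have hbdd : BddAbove S := ⟨1, fun r hr => hr.1.2⟩
  set R := sSup S with hR
  have hR0 : 0 ≤ R := le_csSup hbdd h0
  have hR1 : R ≤ 1 := csSup_le ⟨0, h0⟩ fun r hr => hr.1.2
  have hbelow : ∀ s, 0 ≤ s → s < R → q + s • u ∈ Ω ∧ JJ f (q + s • u) ≤ 4 * m ∧ nq f (q + s • u) u ≤ 4 * nq f q u := by
    intro s hs0 hsR
    obtain ⟨r, hr, hsr⟩ := exists_lt_of_lt_csSup ⟨0, h0⟩ hsR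
    have := hr.2 s ⟨hs0, hsr.le⟩
    exact ⟨this.1, this.2, seg_alpha hΩ hf hpos hm hr.1.2 hr.2 hu ⟨hs0, hsr.le⟩⟩
  have hcont : Continuous fun s : ℝ => q + s • u := by fun_prop
  have hRS : R ∈ S := by
    rcases hR0.eq_or_lt with h | h
    · rw [← h]; exact h0
    have hmem : q + R • u ∈ Ω := by
      refine leave hcomp q (R • u) (R ^ 2 * (4 * nq f q u)) ?_ ?_
      · intro s hs
        rw [smul_smul]; exact (hbelow (s * R) (mul_nonneg hs.1 hR0) (by nlinarith [hs.2])).1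
      · intro s hs
        rw [smul_smul, nq_smul]
        gcongr
        exact (hbelow (s * R) (mul_nonneg hs.1 hR0) (by nlinarith [hs.2])).2.2
    have hJR : JJ f (q + R • u) ≤ 4 * m := by
      have hc : ContinuousAt (fun s : ℝ => JJ f (q + s • u)) R :=
        ContinuousAt.comp (f := fun s : ℝ => q + s • u) ((JJ_cont hΩ hf hpos).continuousAt (hΩ.mem_nhds hmem)) hcont.continuousAt
      refine le_of_tendsto (hc.tendsto.mono_left (nhdsWithin_le_nhds (s := Set.Iio R))) ?_
      filter_upwards [self_mem_nhdsWithin, mem_nhdsWithin_of_mem_nhds (lt_mem_nhds h)] with s h1 h2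
      exact (hbelow s h2.le h1).2.1
    refine ⟨⟨hR0, hR1⟩, fun s hs => ?_⟩
    rcases hs.2.eq_or_lt with h' | h'
    · rw [h']; exact ⟨hmem, hJR⟩
    · exact ⟨(hbelow s hs.1 h').1, (hbelow s hs.1 h').2.1⟩
  rcases hR1.eq_or_lt with h | h
  · rw [← h]; exact hRS.2
  exfalso
  have hmem := (hRS.2 R ⟨hR0, le_rfl⟩).1
  have hlt := NG R hRS.1 hRS.2
  have hlt' : JJ f (q + R • u) < 4 * m := hlt.trans_le (by nlinarith)
  have hc : ContinuousAt (fun s : ℝ => JJ f (q + s • u)) R :=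
    ContinuousAt.comp (f := fun s : ℝ => q + s • u) ((JJ_cont hΩ hf hpos).continuousAt (hΩ.mem_nhds hmem)) hcont.continuousAt
  have hev := (hc.eventually (gt_mem_nhds hlt')).and (line_mem hΩ u R hmem)
  obtain ⟨δ, hδ, hb⟩ := Metric.eventually_nhds_iff.1 hev
  set r := min 1 (R + δ / 2) with hr
  have hrR : R < r := lt_min h (by linarith)
  have hrS : r ∈ S := by
    refine ⟨⟨hR0.trans hrR.le, min_le_left _ _⟩, fun s hs => ?_⟩
    rcases le_or_gt s R with h' | h'
    · exact hRS.2 s ⟨hs.1, h'⟩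
    · have : s ≤ R + δ / 2 := hs.2.trans (min_le_right _ _)
      have := hb (y := s) (by rw [Real.dist_eq, abs_lt]; constructor <;> linarith)
      exact ⟨this.2, this.1.le⟩
  exact absurd (le_csSup hbdd hrS) (not_le.2 hrR)

noncomputable def eps (n : ℕ) : ℝ := 1 / (32 * ((n:ℝ) ^ 2 + 1) * Real.exp 2)

lemma eps_pos (n : ℕ) : 0 < eps n := by unfold eps; positivity
lemma eps_le (n : ℕ) : eps n ≤ 3 := by
  unfold eps
  rw [div_le_iff₀ (by positivity)]
  have h1 : (1:ℝ) ≤ Real.exp 2 := Real.one_le_exp (by norm_num)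
  have h2 : (1:ℝ) ≤ (n:ℝ) ^ 2 + 1 := by nlinarith [sq_nonneg (n:ℝ)]
  nlinarith [mul_le_mul h2 h1 zero_le_one (by positivity)]

lemma step {Ω : Set (Fin n → ℝ)} (hΩ : IsOpen Ω) {f : (Fin n → ℝ) → ℝ}
    (hf : ContDiffOn ℝ (⊤ : ℕ∞) f Ω) (hpos : ∀ x ∈ Ω, (Hess n f x).PosDef) {c : ℝ}
    (hdet : ∀ x ∈ Ω, (Hess n f x).det = c)
    (hcomp : CalabiComplete n Ω f) {q : Fin n → ℝ} (hq : q ∈ Ω) (hm : 0 < JJ f q) :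
    ∃ u, nq f q u ≤ 1 / (4 * JJ f q) ∧ GS Ω f q u (JJ f q) 1 ∧ (1 + eps n) * JJ f q ≤ JJ f (q + u) := by
  by_contra hno
  push Not at hno
  set m := JJ f q with hmdef
  have hε := eps_pos n
  -- the whole ellipsoid
  have hNG : ∀ u, nq f q u ≤ 1 / (4 * m) → GS Ω f q u m 1 := by
    intro u hu
    refine continuation hΩ hf hpos hcomp hq hm rfl (eps_le n) hu fun r hr hG => ?_
    refine hno (r • u) ?_ ?_
    · rw [nq_smul]
      have := nq_nonneg (hpos q hq) u
      have : r ^ 2 ≤ 1 := by nlinarith [hr.1, hr.2]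
      nlinarith
    · intro s hs
      rw [smul_smul]
      exact hG _ ⟨mul_nonneg hs.1 hr.1, by nlinarith [hs.2, hr.1]⟩
  set K := {x : Fin n → ℝ | nq f q (x - q) ≤ 1 / (4 * m)} with hK
  have hgs : ∀ x ∈ K, GS Ω f q (x - q) m 1 := fun x hx => hNG _ hx
  have hKΩ : K ⊆ Ω := by
    intro x hx
    have := (hgs x hx 1 ⟨zero_le_one, le_rfl⟩).1
    simpa using this
  have hKJ : ∀ x ∈ K, JJ f x < (1 + eps n) * m := by
    intro x hx
    have := hno (x - q) hx (hgs x hx)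
    simpa using this
  have hnqc : Continuous fun x => nq f q (x - q) := by
    unfold nq
    simp only [dotProduct, mulVec]
    fun_prop
  have hKc : IsCompact K := by
    obtain ⟨c0, hc0, hlow⟩ := nq_lower hΩ hf hpos (isCompact_singleton (x := q)) (by simpa using hq)
    refine Metric.isCompact_of_isClosed_isBounded (isClosed_le hnqc continuous_const) ?_
    refine (Metric.isBounded_iff_subset_closedBall q).2 ⟨Real.sqrt (1 / (4 * m) / c0), fun x hx => ?_⟩
    rw [Metric.mem_closedBall, dist_eq_norm]
    refine Real.le_sqrt_of_sq_le ?_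
    rw [le_div_iff₀ hc0, mul_comm]
    exact (hlow q rfl (x - q)).trans hx
  have hqK : q ∈ K := by
    change nq f q (q - q) ≤ _
    simp only [nq, sub_self, mulVec_zero, dotProduct_zero]; positivity
  set lam := 8 * eps n * m ^ 2 with hlam
  have hlam0 : 0 ≤ lam := by positivity
  obtain ⟨x, hxK, hmax⟩ := hKc.exists_isMaxOn ⟨q, hqK⟩ (f := fun y => JJ f y - lam * nq f q (y - q))
    (((JJ_cont hΩ hf hpos).mono hKΩ).sub (hnqc.continuousOn.const_mul lam |> fun h => by simpa using h))
  have hmx : m ≤ JJ f x - lam * nq f q (x - q) := by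
    have := hmax hqK
    simp only [Set.mem_setOf_eq, sub_self] at this
    have h0 : nq f q 0 = 0 := by simp [nq]
    rw [h0, mul_zero, sub_zero] at this
    exact this
  have hnn := nq_nonneg (hpos q hq) (x - q)
  have hint : nq f q (x - q) < 1 / (4 * m) := by
    refine lt_of_le_of_ne hxK fun heq => ?_
    have h1 := hKJ x hxK
    rw [heq] at hmx
    have : lam * (1 / (4 * m)) = 2 * eps n * m := by rw [hlam]; field_simp; ring
    rw [this] at hmx
    nlinarith
  have hxΩ := hKΩ hxK
  have hcal := calabi_max hΩ hf hpos hdet hxΩ (Hess n f q) q lam (Real.exp 2) hlam0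
    (fun v => by
      have := (seg_beta hΩ hf hpos hm le_rfl (hgs x hxK) hxK (s := 1) ⟨zero_le_one, le_rfl⟩ v).2
      simpa [nq] using this)
    (by
      have : {y | nq f q (y - q) < 1 / (4 * m)} ∈ nhds x := (isOpen_lt hnqc continuous_const).mem_nhds hint
      filter_upwards [this] with y hy
      exact hmax (show y ∈ K from le_of_lt hy))
  have hJx : m ≤ JJ f x := by nlinarith [mul_nonneg hlam0 hnn]
  have h1 : m ^ 2 ≤ JJ f x ^ 2 := by gcongr
  have h2 : 4 * (n:ℝ) ^ 2 * (lam * Real.exp 2) = (n:ℝ) ^ 2 / ((n:ℝ) ^ 2 + 1) * m ^ 2 := by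
    rw [hlam]; unfold eps
    have := Real.exp_pos 2
    field_simp; ring
  have h3 : (n:ℝ) ^ 2 / ((n:ℝ) ^ 2 + 1) < 1 := by rw [div_lt_one (by positivity)]; linarith
  have h4 : 0 < m ^ 2 := by positivity
  nlinarith

end step

section curve
variable {n : ℕ}

noncomputable def tj (j : ℕ) : ℝ := 1 - (1 / 2) ^ j

lemma tj_zero : tj 0 = 0 := by simp [tj]
lemma tj_succ (j : ℕ) : tj (j + 1) = tj j + (1 / 2) ^ (j + 1) := by
  unfold tj; rw [pow_succ]; ring
lemma tj_lt_one (j : ℕ) : tj j < 1 := by unfold tj; have : (0:ℝ) < (1 / 2) ^ j := by positivity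
                                         linarith
lemma tj_mono : StrictMono tj := strictMono_nat_of_lt_succ fun j => by
  rw [tj_succ]; have : (0:ℝ) < (1 / 2) ^ (j + 1) := by positivity
  linarith

lemma tj_find {t : ℝ} (h0 : 0 ≤ t) (h1 : t < 1) : ∃ j, t ∈ Set.Ico (tj j) (tj (j + 1)) := by
  have hex : ∃ N, t < tj N := by
    obtain ⟨N, hN⟩ := exists_pow_lt_of_lt_one (show 0 < 1 - t by linarith) (show (1/2:ℝ) < 1 by norm_num)
    exact ⟨N, by unfold tj; linarith⟩
  classical
  have hs := Nat.find_spec hex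
  have hne : Nat.find hex ≠ 0 := by
    intro h; rw [h, tj_zero] at hs; linarith
  obtain ⟨j, hj⟩ := Nat.exists_eq_succ_of_ne_zero hne
  refine ⟨j, ?_, ?_⟩
  · have := Nat.find_min hex (m := j) (by omega)
    exact not_lt.1 this
  · rw [hj] at hs; exact hs

noncomputable def gN (x u : ℕ → Fin n → ℝ) (N : ℕ) (t : ℝ) : Fin n → ℝ :=
  x 0 + ∑ j ∈ Finset.range N, Real.smoothTransition ((t - tj j) * 2 ^ (j + 1)) • u j

noncomputable def gC (x u : ℕ → Fin n → ℝ) (t : ℝ) : Fin n → ℝ :=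
  x 0 + ∑' j, Real.smoothTransition ((t - tj j) * 2 ^ (j + 1)) • u j

lemma gC_eq (x u : ℕ → Fin n → ℝ) (N : ℕ) {t : ℝ} (ht : t ≤ tj N) : gC x u t = gN x u N t := by
  unfold gC gN
  rw [tsum_eq_sum]
  intro j hj
  have hj' : N ≤ j := by simpa using hj
  have h1 := tj_mono.monotone hj'
  rw [Real.smoothTransition.zero_of_nonpos, zero_smul]
  exact mul_nonpos_of_nonpos_of_nonneg (by linarith) (by positivity)

lemma gC_ev (x u : ℕ → Fin n → ℝ) (N : ℕ) {t : ℝ} (ht : t < tj N) :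
    gC x u =ᶠ[nhds t] gN x u N := by
  filter_upwards [Iio_mem_nhds ht] with s hs using gC_eq x u N (le_of_lt hs)

lemma gN_smooth (x u : ℕ → Fin n → ℝ) (N : ℕ) : ContDiff ℝ 1 (gN x u N) := by
  unfold gN
  refine contDiff_const.add (ContDiff.sum fun j _ => ContDiff.fun_smul ?_ contDiff_const)
  have h : ContDiff ℝ 1 Real.smoothTransition := Real.smoothTransition.contDiff (n := 1)
  exact h.comp (by fun_prop)

lemma gC_smooth (x u : ℕ → Fin n → ℝ) : ContDiffOn ℝ 1 (gC x u) (Set.Ico 0 1) := by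
  intro t ht
  obtain ⟨j, hj⟩ := tj_find ht.1 ht.2
  exact ((gN_smooth x u (j+1)).contDiffAt.congr_of_eventuallyEq (gC_ev x u (j+1) hj.2)).contDiffWithinAt

lemma st_deriv {y : ℝ} (hy : 1 ≤ y) : deriv Real.smoothTransition y = 0 := by
  apply IsLocalMax.deriv_eq_zero
  refine Filter.Eventually.of_forall fun z => ?_
  rw [Real.smoothTransition.one_of_one_le hy]
  exact Real.smoothTransition.le_one z

lemma st_bound : ∃ C : ℝ, 0 < C ∧ ∀ y ∈ Set.Icc (0:ℝ) 1, |deriv Real.smoothTransition y| ≤ C := by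
  have h : ContDiff ℝ 1 Real.smoothTransition := Real.smoothTransition.contDiff (n := 1)
  obtain ⟨C, hC⟩ := (isCompact_Icc (a := (0:ℝ)) (b := 1)).exists_bound_of_continuousOn
    (h.continuous_deriv le_rfl).continuousOn
  refine ⟨max C 1, by positivity, fun y hy => (hC y hy).trans (le_max_left _ _)⟩

lemma gN_deriv (x u : ℕ → Fin n → ℝ) (N : ℕ) (t : ℝ) : HasDerivAt (gN x u N)
    (∑ j ∈ Finset.range N, (deriv Real.smoothTransition ((t - tj j) * 2 ^ (j + 1)) * 2 ^ (j+1)) • u j) t := by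
  unfold gN
  refine HasDerivAt.const_add _ (HasDerivAt.fun_sum fun j _ => HasDerivAt.smul_const ?_ _)
  have h : ContDiff ℝ 1 Real.smoothTransition := Real.smoothTransition.contDiff (n := 1)
  have h1 := ((h.differentiable one_ne_zero) ((t - tj j) * 2 ^ (j + 1))).hasDerivAt
  have h2 : HasDerivAt (fun s : ℝ => (s - tj j) * 2 ^ (j + 1)) (2 ^ (j + 1)) t := by
    simpa using ((hasDerivAt_id t).sub_const (tj j)).mul_const ((2:ℝ) ^ (j + 1))
  exact h1.comp t h2

lemma gC_seg (x u : ℕ → Fin n → ℝ) (hx : ∀ j, x (j + 1) = x j + u j) {C : ℝ}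
    (hC : ∀ y ∈ Set.Icc (0:ℝ) 1, |deriv Real.smoothTransition y| ≤ C) (j : ℕ) {t : ℝ}
    (ht : t ∈ Set.Ico (tj j) (tj (j + 1))) :
    ∃ s ∈ Set.Icc (0:ℝ) 1, gC x u t = x j + s • u j ∧ ∃ d : ℝ, |d| ≤ C ∧
      HasDerivAt (gC x u) ((d * 2 ^ (j + 1)) • u j) t := by
  have hxs : ∀ j, x 0 + ∑ i ∈ Finset.range j, u i = x j := by
    intro j
    induction j with
    | zero => simp
    | succ k ih => rw [Finset.sum_range_succ, ← add_assoc, ih, hx]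
  have harg : (t - tj j) * 2 ^ (j + 1) ∈ Set.Icc (0:ℝ) 1 := by
    have h1 := ht.1
    have h2 := ht.2
    rw [tj_succ] at h2
    have h3 : ((1:ℝ)/2) ^ (j+1) * 2 ^ (j+1) = 1 := by rw [← mul_pow]; norm_num
    refine ⟨mul_nonneg (by linarith) (by positivity), ?_⟩
    rw [← h3]
    gcongr
    linarith
  have hbig : ∀ i ∈ Finset.range j, 1 ≤ (t - tj i) * 2 ^ (i + 1) := by
    intro i hi
    have h1 := tj_mono.monotone (show i + 1 ≤ j by simpa using hi)
    rw [tj_succ] at h1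
    have h3 : ((1:ℝ)/2) ^ (i+1) * 2 ^ (i+1) = 1 := by rw [← mul_pow]; norm_num
    rw [← h3]
    gcongr
    linarith [ht.1]
  refine ⟨_, ⟨Real.smoothTransition.nonneg ((t - tj j) * 2 ^ (j + 1)), Real.smoothTransition.le_one _⟩, ?_,
    deriv Real.smoothTransition ((t - tj j) * 2 ^ (j + 1)), hC _ harg, ?_⟩
  · rw [gC_eq x u (j+1) ht.2.le, gN, Finset.sum_range_succ, ← add_assoc]
    congr 1
    rw [← hxs j]
    congr 1
    refine Finset.sum_congr rfl fun i hi => ?_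
    rw [Real.smoothTransition.one_of_one_le (hbig i hi), one_smul]
  · have := (gN_deriv x u (j+1) t).congr_of_eventuallyEq (gC_ev x u (j+1) ht.2)
    rw [Finset.sum_range_succ, Finset.sum_eq_zero, zero_add] at this
    · exact this
    · intro i hi
      rw [st_deriv (hbig i hi), zero_mul, zero_smul]
end curve

section iter
variable {n : ℕ}

lemma JJ_zero {Ω : Set (Fin n → ℝ)} (hΩ : IsOpen Ω) {f : (Fin n → ℝ) → ℝ}
    (hf : ContDiffOn ℝ (⊤ : ℕ∞) f Ω) (hpos : ∀ x ∈ Ω, (Hess n f x).PosDef)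
    {c : ℝ} (hdet : ∀ x ∈ Ω, (Hess n f x).det = c)
    (hcomp : CalabiComplete n Ω f) {q : Fin n → ℝ} (hq : q ∈ Ω) : JJ f q = 0 := by
  by_contra hne
  have hq0 : 0 < JJ f q := lt_of_le_of_ne (J3_nonneg (hpos q hq) _) (Ne.symm hne)
  choose U hU1 hU2 hU3 using fun (p : {p : Fin n → ℝ // p ∈ Ω ∧ 0 < JJ f p}) =>
    step hΩ hf hpos hdet hcomp p.2.1 p.2.2
  have heps := eps_pos n
  have hnext : ∀ p : {p : Fin n → ℝ // p ∈ Ω ∧ 0 < JJ f p}, p.1 + U p ∈ Ω ∧ 0 < JJ f (p.1 + U p) := by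
    intro p
    refine ⟨?_, lt_of_lt_of_le (mul_pos (by linarith) p.2.2) (hU3 p)⟩
    simpa using (hU2 p 1 ⟨zero_le_one, le_rfl⟩).1
  let X : ℕ → {p : Fin n → ℝ // p ∈ Ω ∧ 0 < JJ f p} := fun j =>
    Nat.rec ⟨q, hq, hq0⟩ (fun _ p => ⟨p.1 + U p, hnext p⟩) j
  let x : ℕ → Fin n → ℝ := fun j => (X j).1
  let u : ℕ → Fin n → ℝ := fun j => U (X j)
  have hx : ∀ j, x (j + 1) = x j + u j := fun j => rfl
  have hxΩ : ∀ j, x j ∈ Ω := fun j => (X j).2.1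
  have hJp : ∀ j, 0 < JJ f (x j) := fun j => (X j).2.2
  have hu : ∀ j, nq f (x j) (u j) ≤ 1 / (4 * JJ f (x j)) := fun j => hU1 (X j)
  have hG : ∀ j, GS Ω f (x j) (u j) (JJ f (x j)) 1 := fun j => hU2 (X j)
  have hJ : ∀ j, (1 + eps n) * JJ f (x j) ≤ JJ f (x (j + 1)) := fun j => hU3 (X j)
  clear_value x u
  clear hnext hU1 hU2 hU3 X
  have hgrow : ∀ j, (1 + eps n) ^ j * JJ f (x 0) ≤ JJ f (x j) := by
    intro j
    induction j with
    | zero => simp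
    | succ k ih =>
      rw [pow_succ', mul_assoc]
      exact (mul_le_mul_of_nonneg_left ih (by linarith)).trans (hJ k)
  have hinf : Filter.Tendsto (fun j => JJ f (x j)) Filter.atTop Filter.atTop :=
    Filter.tendsto_atTop_mono hgrow
      ((tendsto_pow_atTop_atTop_of_one_lt (by linarith)).atTop_mul_const (hJp 0))
  obtain ⟨C, hC0, hC⟩ := st_bound
  have hα : ∀ j, ∀ s ∈ Set.Icc (0:ℝ) 1, nq f (x j + s • u j) (u j) ≤ 1 / JJ f (x j) := by
    intro j s hs
    refine (seg_alpha hΩ hf hpos (hJp j) le_rfl (hG j) (hu j) hs).trans ?_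
    have := hu j
    calc 4 * nq f (x j) (u j) ≤ 4 * (1 / (4 * JJ f (x j))) := by linarith
      _ = 1 / JJ f (x j) := by have := (hJp j).ne'; field_simp
  have hγΩ : ∀ t ∈ Set.Ico (0:ℝ) 1, gC x u t ∈ Ω := by
    intro t ht
    obtain ⟨j, hj⟩ := tj_find ht.1 ht.2
    obtain ⟨s, hs, he, -⟩ := gC_seg x u hx hC j hj
    rw [he]; exact (hG j s hs).1
  have hmain := hcomp (gC x u) (gC_smooth x u) hγΩ (by
    intro K hK hKc
    obtain ⟨a, ha, haK⟩ := nq_lower hΩ hf hpos hKc hK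
    obtain ⟨δ, hδ, hδΩ⟩ := hKc.exists_cthickening_subset_open hΩ hK
    have hc2 : IsCompact (Metric.cthickening δ K) := hKc.cthickening
    obtain ⟨M, hM⟩ := hc2.exists_bound_of_continuousOn ((JJ_cont hΩ hf hpos).mono hδΩ)
    obtain ⟨j0, hj0⟩ := Filter.eventually_atTop.1
      ((hinf.eventually_gt_atTop M).and (hinf.eventually_gt_atTop (1 / (a * δ ^ 2))))
    refine ⟨tj j0, tj_lt_one j0, fun t ht1 ht2 hmem => ?_⟩
    have ht0 : 0 ≤ t := by
      have := tj_mono.monotone (Nat.zero_le j0)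
      rw [tj_zero] at this; linarith
    obtain ⟨j, hj⟩ := tj_find ht0 ht2
    have hjj : j0 ≤ j := by
      have := tj_mono.lt_iff_lt.1 (ht1.trans hj.2)
      omega
    obtain ⟨s, hs, he, -⟩ := gC_seg x u hx hC j hj
    rw [he] at hmem
    have h1 := haK _ hmem (u j)
    have h2 := h1.trans (hα j s hs)
    have h3 : ‖u j‖ ≤ δ := by
      have h4 := (hj0 j hjj).2
      rw [div_lt_iff₀ (by positivity)] at h4
      rw [le_div_iff₀ (hJp j)] at h2
      by_contra hlt
      push Not at hlt
      have h5 : δ ^ 2 < ‖u j‖ ^ 2 := by gcongr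
      have h6 : a * δ ^ 2 * JJ f (x j) < a * ‖u j‖ ^ 2 * JJ f (x j) := by
        have := hJp j
        gcongr
      linarith
    have h7 : x (j + 1) ∈ Metric.cthickening δ K := by
      refine Metric.mem_cthickening_of_dist_le _ _ _ _ hmem ?_
      rw [hx, dist_eq_norm]
      have : x j + u j - (x j + s • u j) = (1 - s) • u j := by
        rw [sub_smul, one_smul]; abel
      rw [this, norm_smul, Real.norm_eq_abs, abs_of_nonneg (by linarith [hs.2])]
      nlinarith [norm_nonneg (u j), hs.1, hs.2]
    have h8 := hM _ h7
    have h9 := (hj0 (j + 1) (by omega)).1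
    rw [Real.norm_eq_abs] at h8
    linarith [le_abs_self (JJ f (x (j + 1)))])
  refine absurd hmain (ne_of_lt ?_)
  set F : ℝ → ENNReal := fun t => ENNReal.ofReal (Real.sqrt ((Hess n f (gC x u t)).mulVec (deriv (gC x u) t) ⬝ᵥ deriv (gC x u) t)) with hF
  have hsub : Set.Ioo (0:ℝ) 1 ⊆ ⋃ j, Set.Ico (tj j) (tj (j + 1)) := by
    intro t ht
    obtain ⟨j, hj⟩ := tj_find ht.1.le ht.2
    exact Set.mem_iUnion.2 ⟨j, hj⟩
  set r : ℝ := Real.sqrt (1 / (1 + eps n)) with hr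
  have hr0 : 0 ≤ r := Real.sqrt_nonneg _
  have hr1 : r < 1 := by
    rw [hr, Real.sqrt_lt' one_pos, div_lt_iff₀ (by linarith)]; linarith
  set B : ℝ := C * Real.sqrt (1 / JJ f (x 0)) with hB
  have hsq : ∀ j, Real.sqrt (1 / JJ f (x j)) ≤ r ^ j * Real.sqrt (1 / JJ f (x 0)) := by
    intro j
    have hpw : Real.sqrt (1 / (1 + eps n)) ^ j = Real.sqrt ((1 / (1 + eps n)) ^ j) := by
      symm
      rw [Real.sqrt_eq_iff_mul_self_eq (by positivity) (by positivity), ← mul_pow, Real.mul_self_sqrt (by positivity)]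
    rw [hr, hpw, ← Real.sqrt_mul (by positivity)]
    apply Real.sqrt_le_sqrt
    rw [div_pow, one_pow, div_mul_div_comm, one_mul]
    have := hJp 0
    exact one_div_le_one_div_of_le (by positivity) (hgrow j)
  have hpt : ∀ j, ∫⁻ t in Set.Ico (tj j) (tj (j+1)), F t ≤ ENNReal.ofReal (B * r ^ j) := by
    intro j
    calc _ ≤ ∫⁻ t in Set.Ico (tj j) (tj (j+1)), ENNReal.ofReal (B * r ^ j * 2 ^ (j+1)) := by
          refine MeasureTheory.setLIntegral_mono' measurableSet_Ico fun t ht => ?_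
          obtain ⟨s, hs, he, d, hd, hder⟩ := gC_seg x u hx hC j ht
          simp only [hF]
          rw [hder.deriv, he, dotProduct_comm]
          apply ENNReal.ofReal_le_ofReal
          change Real.sqrt (nq f (x j + s • u j) _) ≤ _
          rw [nq_smul, Real.sqrt_mul (sq_nonneg _), Real.sqrt_sq_eq_abs, abs_mul, abs_of_pos (by positivity : (0:ℝ) < 2 ^ (j+1))]
          calc |d| * 2 ^ (j + 1) * Real.sqrt (nq f (x j + s • u j) (u j)) 
              ≤ C * 2 ^ (j+1) * (r ^ j * Real.sqrt (1 / JJ f (x 0))) := by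
                gcongr
                exact (Real.sqrt_le_sqrt (hα j s hs)).trans (hsq j)
            _ = _ := by rw [hB]; ring
      _ = _ := by
          rw [MeasureTheory.setLIntegral_const, Real.volume_Ico, ← ENNReal.ofReal_mul (by positivity), tj_succ]
          congr 1
          have h3 : (2:ℝ) ^ (j+1) * (1/2) ^ (j+1) = 1 := by rw [← mul_pow]; norm_num
          rw [add_sub_cancel_left, mul_assoc, h3, mul_one]
  calc ∫⁻ t in Set.Ioo (0:ℝ) 1, F t ≤ ∫⁻ t in ⋃ j, Set.Ico (tj j) (tj (j + 1)), F t :=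
        MeasureTheory.lintegral_mono_set hsub
    _ ≤ ∑' j, ∫⁻ t in Set.Ico (tj j) (tj (j+1)), F t := MeasureTheory.lintegral_iUnion_le _ _
    _ ≤ ∑' j, ENNReal.ofReal (B * r ^ j) := ENNReal.tsum_le_tsum hpt
    _ = ENNReal.ofReal (∑' j, B * r ^ j) := by
        rw [ENNReal.ofReal_tsum_of_nonneg (fun j => by positivity)]
        exact (summable_geometric_of_lt_one hr0 hr1).mul_left B
    _ < ⊤ := ENNReal.ofReal_lt_top
end iter

section fin
variable {n : ℕ}

lemma dd3_zero {Ω : Set (Fin n → ℝ)} (hΩ : IsOpen Ω) {f : (Fin n → ℝ) → ℝ}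
    (hf : ContDiffOn ℝ (⊤ : ℕ∞) f Ω) (hpos : ∀ x ∈ Ω, (Hess n f x).PosDef)
    (hJ : ∀ x ∈ Ω, JJ f x = 0) {x : Fin n → ℝ} (hx : x ∈ Ω) (v w z : Fin n → ℝ) :
    dd v (dd w (dd z f)) x = 0 := by
  rw [dd3_lin hΩ hf hx]
  have := J3_eq_zero (hpos x hx) _ (hJ x hx)
  simp [this]

lemma univ_of_JJ {Ω : Set (Fin n → ℝ)} (hΩ : IsOpen Ω) {f : (Fin n → ℝ) → ℝ}
    (hf : ContDiffOn ℝ (⊤ : ℕ∞) f Ω) (hpos : ∀ x ∈ Ω, (Hess n f x).PosDef)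
    (hcomp : CalabiComplete n Ω f) (hJ : ∀ x ∈ Ω, JJ f x = 0) {p : Fin n → ℝ} (hp : p ∈ Ω)
    (y : Fin n → ℝ) : y ∈ Ω := by
  set u := y - p with hu
  set S := {r : ℝ | r ∈ Set.Icc (0:ℝ) 1 ∧ ∀ s ∈ Set.Icc (0:ℝ) r, p + s • u ∈ Ω} with hS
  have h0 : (0:ℝ) ∈ S := by
    refine ⟨⟨le_rfl, zero_le_one⟩, fun s hs => ?_⟩
    obtain rfl : s = 0 := le_antisymm hs.2 hs.1
    simpa using hp
  have hbdd : BddAbove S := ⟨1, fun r hr => hr.1.2⟩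
  set R := sSup S with hR
  have hR0 : 0 ≤ R := le_csSup hbdd h0
  have hR1 : R ≤ 1 := csSup_le ⟨0, h0⟩ fun r hr => hr.1.2
  have hconst : ∀ r ∈ S, nq f (p + r • u) u = nq f p u := by
    intro r hr
    have hd : ∀ s ∈ Set.Icc (0:ℝ) r, HasDerivAt (fun s : ℝ => dd u (dd u f) (p + s • u)) 0 s := by
      intro s hs
      have h1 := hr.2 s hs
      have h2 := dd_line p u s (sm_diff hΩ (dd_smooth hΩ (dd_smooth hΩ hf u) u) h1)
      rwa [dd3_zero hΩ hf hpos hJ h1] at h2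
    have h := constant_of_has_deriv_right_zero (a := 0) (b := r)
      (fun s hs => (hd s hs).continuousAt.continuousWithinAt)
      (fun s hs => (hd s ⟨hs.1, hs.2.le⟩).hasDerivWithinAt) r ⟨hr.1.1, le_rfl⟩
    simp only [zero_smul, add_zero] at h
    rw [dd2_quad hΩ hf (hr.2 r ⟨hr.1.1, le_rfl⟩), dd2_quad hΩ hf hp] at h
    exact h
  have hbelow : ∀ s, 0 ≤ s → s < R → s ∈ S := by
    intro s hs0 hsR
    obtain ⟨r, hr, hsr⟩ := exists_lt_of_lt_csSup ⟨0, h0⟩ hsR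
    exact ⟨⟨hs0, hsr.le.trans hr.1.2⟩, fun s' hs' => hr.2 s' ⟨hs'.1, hs'.2.trans hsr.le⟩⟩
  have hcont : Continuous fun s : ℝ => p + s • u := by fun_prop
  have hRmem : p + R • u ∈ Ω := by
    rcases hR0.eq_or_lt with h | h
    · rw [← h]; simpa using hp
    refine leave hcomp p (R • u) (R ^ 2 * nq f p u) ?_ ?_
    · intro s hs
      rw [smul_smul]
      have := hbelow (s * R) (mul_nonneg hs.1 hR0) (by nlinarith [hs.2])
      exact this.2 _ ⟨this.1.1, le_rfl⟩
    · intro s hs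
      rw [smul_smul, nq_smul, hconst _ (hbelow (s * R) (mul_nonneg hs.1 hR0) (by nlinarith [hs.2]))]
  have hRS : R ∈ S := by
    refine ⟨⟨hR0, hR1⟩, fun s hs => ?_⟩
    rcases hs.2.eq_or_lt with h | h
    · rw [h]; exact hRmem
    · exact (hbelow s hs.1 h).2 s ⟨hs.1, le_rfl⟩
  have hReq : R = 1 := by
    by_contra hne
    have hlt : R < 1 := lt_of_le_of_ne hR1 hne
    have hev := hcont.continuousAt.eventually_mem (hΩ.mem_nhds hRmem)
    obtain ⟨δ, hδ, hb⟩ := Metric.eventually_nhds_iff.1 hev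
    have hmem : min 1 (R + δ / 2) ∈ S := by
      refine ⟨⟨by positivity, min_le_left _ _⟩, fun s hs => ?_⟩
      rcases le_or_gt s R with h | h
      · exact hRS.2 s ⟨hs.1, h⟩
      · refine hb ?_
        rw [Real.dist_eq, abs_lt]
        have := hs.2.trans (min_le_right _ _)
        constructor <;> linarith
    have := le_csSup hbdd hmem
    have h2 : R < min 1 (R + δ / 2) := lt_min hlt (by linarith)
    linarith
  rw [hReq] at hRmem
  simpa [hu] using hRmem

lemma quad_of_univ {f : (Fin n → ℝ) → ℝ}
    (hf : ContDiffOn ℝ (⊤ : ℕ∞) f Set.univ) (hpos : ∀ x ∈ (Set.univ : Set (Fin n → ℝ)), (Hess n f x).PosDef)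
    (hJ : ∀ x ∈ (Set.univ : Set (Fin n → ℝ)), JJ f x = 0) : IsQuadraticOn n Set.univ f := by
  have hO : IsOpen (Set.univ : Set (Fin n → ℝ)) := isOpen_univ
  have hm : ∀ x : Fin n → ℝ, x ∈ (Set.univ : Set (Fin n → ℝ)) := fun x => Set.mem_univ x
  set A := Hess n f 0 with hA
  have hH : ∀ v x, dd v (dd v f) x = v ⬝ᵥ (A *ᵥ v) := by
    intro v x
    have hd : ∀ s : ℝ, HasDerivAt (fun s : ℝ => dd v (dd v f) (0 + s • x)) 0 s := by
      intro s
      have h2 := dd_line 0 x s (sm_diff hO (dd_smooth hO (dd_smooth hO hf v) v) (hm _))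
      rwa [dd3_zero hO hf hpos hJ (hm _)] at h2
    have h := is_const_of_deriv_eq_zero (fun s => (hd s).differentiableAt) (fun s => (hd s).deriv) 1 0
    simp only [zero_smul, add_zero, one_smul, zero_add] at h
    rw [h, dd2_quad hO hf (hm _)]
  have hsymm : A.IsSymm := by
    have := (hpos 0 (hm 0)).isHermitian
    exact this
  refine ⟨A, hsymm, hpos 0 (hm 0), fun i => dd (Pi.single i 1) f 0, f 0, fun x _ => ?_⟩
  -- along the ray s ↦ s x
  have hg1 : ∀ s : ℝ, HasDerivAt (fun s : ℝ => f (0 + s • x)) (dd x f (0 + s • x)) s := fun s =>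
    dd_line 0 x s (sm_diff hO hf (hm _))
  have hg2 : ∀ s : ℝ, HasDerivAt (fun s : ℝ => dd x f (0 + s • x)) (x ⬝ᵥ (A *ᵥ x)) s := fun s => by
    have := dd_line 0 x s (sm_diff hO (dd_smooth hO hf x) (hm _))
    rwa [hH] at this
  set a := x ⬝ᵥ (A *ᵥ x) with ha
  have h1 : ∀ s : ℝ, dd x f (0 + s • x) = dd x f 0 + s * a := by
    intro s
    have hd : ∀ s : ℝ, HasDerivAt (fun s : ℝ => dd x f (0 + s • x) - s * a) 0 s := fun s => by
      have := (hg2 s).fun_sub ((hasDerivAt_id s).mul_const a)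
      refine this.congr_deriv ?_
      simp
    have h := is_const_of_deriv_eq_zero (fun s => (hd s).differentiableAt) (fun s => (hd s).deriv) s 0
    simp only [zero_smul, add_zero, zero_mul, sub_zero] at h
    linarith
  have hd : ∀ s : ℝ, HasDerivAt (fun s : ℝ => f (0 + s • x) - (s * dd x f 0 + (1/2) * s ^ 2 * a)) 0 s := fun s => by
    have h2 : HasDerivAt (fun s : ℝ => s * dd x f 0 + (1/2) * s ^ 2 * a) (dd x f 0 + s * a) s := by
      have h3 := ((hasDerivAt_id s).mul_const (dd x f 0)).add
        ((((hasDerivAt_id s).pow 2).const_mul (1/2:ℝ)).mul_const a)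
      refine h3.congr_deriv ?_
      simp
    have := (hg1 s).fun_sub h2
    rw [h1] at this
    refine this.congr_deriv ?_
    simp
  have h := is_const_of_deriv_eq_zero (fun s => (hd s).differentiableAt) (fun s => (hd s).deriv) 1 0
  simp only [zero_smul, add_zero, one_smul, zero_add] at h
  have hb : dd x f 0 = (fun i => dd (Pi.single i 1) f 0) ⬝ᵥ x := by
    rw [dd_lin]; simp only [dotProduct]
    exact Finset.sum_congr rfl fun i _ => mul_comm _ _
  rw [← hb, dotProduct_comm (A *ᵥ x) x, ← ha]
  norm_num at h
  linarith

end fin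

theorem det_hessian_constant_complete_implies_quadratic (n : ℕ) (hn : 1 ≤ n)
    (Ω : Set (Fin n → ℝ)) (hΩ : IsOpen Ω) (f : (Fin n → ℝ) → ℝ)
    (hf : ContDiffOn ℝ (⊤ : ℕ∞) f Ω) (hpos : ∀ x ∈ Ω, (Hess n f x).PosDef)
    (hdet : ∃ c : ℝ, ∀ x ∈ Ω, (Hess n f x).det = c) (hcomplete : CalabiComplete n Ω f) :
    IsQuadraticOn n Ω f := by
  rcases Ω.eq_empty_or_nonempty with rfl | ⟨p, hp⟩
  · exact ⟨1, Matrix.isSymm_one, Matrix.PosDef.one, 0, 0, fun x hx => absurd hx (Set.notMem_empty x)⟩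
  obtain ⟨c, hc⟩ := hdet
  have hJ : ∀ x ∈ Ω, JJ f x = 0 := fun x hx => JJ_zero hΩ hf hpos hc hcomplete hx
  obtain rfl : Ω = Set.univ := Set.eq_univ_of_forall (univ_of_JJ hΩ hf hpos hcomplete hJ hp)
  exact quad_of_univ hf hpos hJ
end

section
/- (Proposition 1) Let n ≥ 2, let Ω ⊆ ℝⁿ be an open set, and let f : Ω → ℝ be a smooth function whose Hessian matrix H(x) = (∂²f/∂xᵢ∂xⱼ(x)) is positive definite at every x ∈ Ω. Assume f is affine Kähler Ricci flat, i.e. ∂²(log det H)/∂xᵢ∂xⱼ ≡ 0 on Ω for all i, j. Set ρ = (det H)^{−1/(n+2)} and Φ = (Σᵢⱼ H^{ij} ∂ᵢρ ∂ⱼρ)/ρ². Then at every point p ∈ Ω with Φ(p) > 0: Δ_g Φ ≥ (n/(n−1)) · ‖∇Φ‖²_g / Φ + ((n²−3n−10)/(2(n−1))) · ⟨∇Φ, ∇log ρ⟩_g + ((n+2)²/(n−1)) · Φ², where for smooth u, v: ‖∇u‖²_g = Σᵢⱼ H^{ij} ∂ᵢu ∂ⱼu, ⟨∇u, ∇v⟩_g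 = Σᵢⱼ H^{ij} ∂ᵢu ∂ⱼv, and Δ_g u = (det H)^{−1/2} Σᵢ ∂ᵢ( (det H)^{1/2} Σⱼ H^{ij} ∂ⱼu ). Moreover at every point p with Φ(p) = 0 one has Δ_g Φ(p) ≥ 0. -/
open Matrix

section Calcu
variable {n : ℕ} {Ω : Set (Fin n → ℝ)}

/-- Smoothness on `Ω`. -/
def Smo (Ω : Set (Fin n → ℝ)) (u : (Fin n → ℝ) → ℝ) : Prop := ContDiffOn ℝ (⊤ : ℕ∞) u Ω

lemma Smo.pder (hΩ : IsOpen Ω) {u : (Fin n → ℝ) → ℝ} (hu : Smo Ω u) (i : Fin n) :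
    Smo Ω (_root_.pder n i u) := by
  unfold Smo _root_.pder
  exact (ContDiffOn.fderiv_of_isOpen hu hΩ (by simp)).clm_apply contDiffOn_const

lemma Smo.diff (hΩ : IsOpen Ω) {u : (Fin n → ℝ) → ℝ} (hu : Smo Ω u) {x} (hx : x ∈ Ω) :
    DifferentiableAt ℝ u x :=
  (hu.contDiffAt (hΩ.mem_nhds hx)).differentiableAt (by simp)

lemma Smo.mul {u v : (Fin n → ℝ) → ℝ} (hu : Smo Ω u) (hv : Smo Ω v) :
    Smo Ω (fun y => u y * v y) := ContDiffOn.mul hu hv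

lemma Smo.sum {ι : Type} {s : Finset ι} {u : ι → (Fin n → ℝ) → ℝ} (hu : ∀ i, Smo Ω (u i)) :
    Smo Ω (fun y => ∑ i ∈ s, u i y) := ContDiffOn.sum fun i _ => hu i

lemma Smo.congr {u v : (Fin n → ℝ) → ℝ} (hu : Smo Ω u) (h : ∀ y ∈ Ω, v y = u y) :
    Smo Ω v := ContDiffOn.congr hu h

lemma pder_congr (hΩ : IsOpen Ω) {u v : (Fin n → ℝ) → ℝ} (h : ∀ y ∈ Ω, u y = v y)
    {x} (hx : x ∈ Ω) (i : Fin n) : pder n i u x = pder n i v x := by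
  unfold pder
  rw [Filter.EventuallyEq.fderiv_eq (Filter.eventuallyEq_of_mem (hΩ.mem_nhds hx) h)]

lemma pder_mul (hΩ : IsOpen Ω) {u v : (Fin n → ℝ) → ℝ} (hu : Smo Ω u) (hv : Smo Ω v)
    {x} (hx : x ∈ Ω) (i : Fin n) :
    pder n i (fun y => u y * v y) x = pder n i u x * v x + u x * pder n i v x := by
  unfold pder
  rw [fderiv_fun_mul (hu.diff hΩ hx) (hv.diff hΩ hx)]
  simp; ring

lemma pder_sum (hΩ : IsOpen Ω) {ι : Type} {s : Finset ι} {u : ι → (Fin n → ℝ) → ℝ}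
    (hu : ∀ i, Smo Ω (u i)) {x} (hx : x ∈ Ω) (i : Fin n) :
    pder n i (fun y => ∑ j ∈ s, u j y) x = ∑ j ∈ s, pder n i (u j) x := by
  unfold pder
  rw [fderiv_fun_sum fun j _ => (hu j).diff hΩ hx]
  simp

lemma pder_const_mul (hΩ : IsOpen Ω) {u : (Fin n → ℝ) → ℝ} (c : ℝ) (hu : Smo Ω u)
    {x} (hx : x ∈ Ω) (i : Fin n) :
    pder n i (fun y => c * u y) x = c * pder n i u x := by
  unfold pder
  rw [fderiv_const_mul (hu.diff hΩ hx)]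
  simp

lemma pder_const (c : ℝ) (x) (i : Fin n) : pder n i (fun _ => c) x = 0 := by
  unfold pder; simp

lemma pder_symm (hΩ : IsOpen Ω) {u : (Fin n → ℝ) → ℝ} (hu : Smo Ω u)
    {x} (hx : x ∈ Ω) (i j : Fin n) : pder n i (pder n j u) x = pder n j (pder n i u) x := by
  have h2 : ContDiffAt ℝ 2 u x := (hu.contDiffAt (hΩ.mem_nhds hx)).of_le (by
    exact WithTop.coe_le_coe.2 (le_top : (2 : ℕ∞) ≤ ⊤))
  have hs := h2.isSymmSndFDerivAt (by simp)
  have hd : DifferentiableAt ℝ (fderiv ℝ u) x :=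
    (h2.fderiv_right (m := 1) (by norm_num)).differentiableAt (by simp)
  have e : ∀ a b : Fin n, pder n a (pder n b u) x
      = fderiv ℝ (fderiv ℝ u) x (Pi.single a 1) (Pi.single b 1) := by
    intro a b
    unfold pder
    rw [fderiv_clm_apply hd (differentiableAt_const _)]
    simp
  rw [e, e, hs.eq]

lemma pder_log (hΩ : IsOpen Ω) {D : (Fin n → ℝ) → ℝ} (hD : Smo Ω D) (hp : ∀ y ∈ Ω, 0 < D y)
    {x} (hx : x ∈ Ω) (i : Fin n) :
    pder n i (fun y => Real.log (D y)) x = (D x)⁻¹ * pder n i D x := by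
  unfold pder
  rw [fderiv.log (hD.diff hΩ hx) (hp x hx).ne']
  simp

lemma pder_rpow (hΩ : IsOpen Ω) {D : (Fin n → ℝ) → ℝ} (hD : Smo Ω D) (hp : ∀ y ∈ Ω, 0 < D y)
    (r : ℝ) {x} (hx : x ∈ Ω) (i : Fin n) :
    pder n i (fun y => D y ^ r) x = D x ^ r * (r * pder n i (fun y => Real.log (D y)) x) := by
  rw [pder_log hΩ hD hp hx]
  unfold pder
  rw [((hD.diff hΩ hx).hasFDerivAt.rpow_const (Or.inl (hp x hx).ne')).fderiv]
  have := (hp x hx).ne'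
  simp [Real.rpow_sub_one this]
  field_simp

lemma Smo.log {D : (Fin n → ℝ) → ℝ} (hD : Smo Ω D) (hp : ∀ y ∈ Ω, 0 < D y) :
    Smo Ω (fun y => Real.log (D y)) := ContDiffOn.log hD fun y hy => (hp y hy).ne'

lemma Smo.rpow {D : (Fin n → ℝ) → ℝ} (hD : Smo Ω D) (hp : ∀ y ∈ Ω, 0 < D y) (r : ℝ) :
    Smo Ω (fun y => D y ^ r) := ContDiffOn.rpow_const_of_ne hD fun y hy => (hp y hy).ne'

/-- Entrywise derivative. -/
noncomputable def dM (k : Fin n) (X : (Fin n → ℝ) → Matrix (Fin n) (Fin n) ℝ) (x : Fin n → ℝ) :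
    Matrix (Fin n) (Fin n) ℝ := Matrix.of fun i j => pder n k (fun y => X y i j) x

/-- Entrywise derivative. -/
noncomputable def dV (k : Fin n) (X : (Fin n → ℝ) → (Fin n → ℝ)) (x : Fin n → ℝ) :
    Fin n → ℝ := fun i => pder n k (fun y => X y i) x

/-- Entrywise smoothness. -/
def SmoM (Ω : Set (Fin n → ℝ)) (X : (Fin n → ℝ) → Matrix (Fin n) (Fin n) ℝ) : Prop :=
  ∀ i j, Smo Ω (fun y => X y i j)

/-- Entrywise smoothness. -/
def SmoV (Ω : Set (Fin n → ℝ)) (X : (Fin n → ℝ) → (Fin n → ℝ)) : Prop :=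
  ∀ i, Smo Ω (fun y => X y i)

lemma SmoM.mul {X Y : (Fin n → ℝ) → Matrix (Fin n) (Fin n) ℝ} (hX : SmoM Ω X) (hY : SmoM Ω Y) :
    SmoM Ω (fun y => X y * Y y) := by
  intro i j
  simp only [Matrix.mul_apply]
  exact Smo.sum fun k => (hX i k).mul (hY k j)

lemma SmoM.dM (hΩ : IsOpen Ω) {X : (Fin n → ℝ) → Matrix (Fin n) (Fin n) ℝ} (hX : SmoM Ω X)
    (k : Fin n) : SmoM Ω (_root_.dM k X) := fun i j => (hX i j).pder hΩ k

lemma SmoM.mulVec {X : (Fin n → ℝ) → Matrix (Fin n) (Fin n) ℝ} {v : (Fin n → ℝ) → (Fin n → ℝ)}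
    (hX : SmoM Ω X) (hv : SmoV Ω v) : SmoV Ω (fun y => X y *ᵥ v y) := by
  intro i
  simp only [Matrix.mulVec, dotProduct]
  exact Smo.sum fun k => (hX i k).mul (hv k)

lemma SmoV.dot {u v : (Fin n → ℝ) → (Fin n → ℝ)}
    (hu : SmoV Ω u) (hv : SmoV Ω v) : Smo Ω (fun y => u y ⬝ᵥ v y) :=
  Smo.sum fun k => (hu k).mul (hv k)

lemma dM_mul (hΩ : IsOpen Ω) {X Y : (Fin n → ℝ) → Matrix (Fin n) (Fin n) ℝ} (hX : SmoM Ω X)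
    (hY : SmoM Ω Y) {x} (hx : x ∈ Ω) (k : Fin n) :
    dM k (fun y => X y * Y y) x = dM k X x * Y x + X x * dM k Y x := by
  ext i j
  simp only [dM, Matrix.of_apply, Matrix.add_apply, Matrix.mul_apply]
  rw [pder_sum hΩ (fun l => (hX i l).mul (hY l j)) hx, ← Finset.sum_add_distrib]
  exact Finset.sum_congr rfl fun l _ => pder_mul hΩ (hX i l) (hY l j) hx k

lemma dV_mulVec (hΩ : IsOpen Ω) {X : (Fin n → ℝ) → Matrix (Fin n) (Fin n) ℝ}
    {v : (Fin n → ℝ) → (Fin n → ℝ)} (hX : SmoM Ω X)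
    (hv : SmoV Ω v) {x} (hx : x ∈ Ω) (k : Fin n) :
    dV k (fun y => X y *ᵥ v y) x = dM k X x *ᵥ v x + X x *ᵥ dV k v x := by
  ext i
  simp only [dM, dV, Matrix.of_apply, Pi.add_apply, Matrix.mulVec, dotProduct]
  rw [pder_sum hΩ (fun l => (hX i l).mul (hv l)) hx, ← Finset.sum_add_distrib]
  exact Finset.sum_congr rfl fun l _ => pder_mul hΩ (hX i l) (hv l) hx k

lemma pder_dot (hΩ : IsOpen Ω) {u v : (Fin n → ℝ) → (Fin n → ℝ)} (hu : SmoV Ω u)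
    (hv : SmoV Ω v) {x} (hx : x ∈ Ω) (k : Fin n) :
    pder n k (fun y => u y ⬝ᵥ v y) x = dV k u x ⬝ᵥ v x + u x ⬝ᵥ dV k v x := by
  simp only [dV, dotProduct]
  rw [pder_sum hΩ (fun l => (hu l).mul (hv l)) hx, ← Finset.sum_add_distrib]
  exact Finset.sum_congr rfl fun l _ => pder_mul hΩ (hu l) (hv l) hx k

lemma pder_trace (hΩ : IsOpen Ω) {X : (Fin n → ℝ) → Matrix (Fin n) (Fin n) ℝ}
    (hX : SmoM Ω X) {x} (hx : x ∈ Ω) (k : Fin n) :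
    pder n k (fun y => (X y).trace) x = (dM k X x).trace :=
  pder_sum hΩ (fun l => hX l l) hx k

lemma SmoM.det {X : (Fin n → ℝ) → Matrix (Fin n) (Fin n) ℝ} (hX : SmoM Ω X) :
    Smo Ω (fun y => (X y).det) := by
  simp only [Matrix.det_apply']
  refine Smo.sum fun s => Smo.mul contDiffOn_const ?_
  exact contDiffOn_prod fun i _ => hX _ _

lemma SmoM.inv {X : (Fin n → ℝ) → Matrix (Fin n) (Fin n) ℝ} (hX : SmoM Ω X)
    (hp : ∀ y ∈ Ω, 0 < (X y).det) :
    SmoM Ω (fun y => (X y)⁻¹) := by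
  intro i j
  simp only [Matrix.inv_def, Ring.inverse_eq_inv', Matrix.smul_apply, smul_eq_mul,
    Matrix.adjugate_apply]
  refine Smo.mul (ContDiffOn.inv hX.det fun y hy => (hp y hy).ne') (SmoM.det fun a b => ?_)
  by_cases h : a = j
  · subst h
    simp only [Matrix.updateRow_self]
    exact contDiffOn_const
  · simp only [Matrix.updateRow_ne h]
    exact hX a b

lemma dM_inv (hΩ : IsOpen Ω) {X : (Fin n → ℝ) → Matrix (Fin n) (Fin n) ℝ} (hX : SmoM Ω X)
    (hp : ∀ y ∈ Ω, 0 < (X y).det) {x} (hx : x ∈ Ω) (k : Fin n) :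
    dM k (fun y => (X y)⁻¹) x = - ((X x)⁻¹ * dM k X x * (X x)⁻¹) := by
  have h := dM_mul hΩ (hX.inv hp) hX hx k
  have h0 : dM k (fun y => (X y)⁻¹ * X y) x = 0 := by
    ext i j
    simp only [dM, Matrix.of_apply, Matrix.zero_apply]
    rw [pder_congr hΩ (v := fun _ => (1 : Matrix (Fin n) (Fin n) ℝ) i j) _ hx, pder_const]
    intro y hy
    rw [Matrix.nonsing_inv_mul _ (hp y hy).ne'.isUnit]
  rw [h0] at h
  have h1 := congrArg (· * (X x)⁻¹) h
  simp only [Matrix.zero_mul, Matrix.add_mul, Matrix.mul_assoc,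
    Matrix.mul_nonsing_inv _ (hp x hx).ne'.isUnit, Matrix.mul_one] at h1
  rw [Matrix.mul_assoc]
  exact eq_neg_of_add_eq_zero_left h1.symm

lemma pder_det (hΩ : IsOpen Ω) {X : (Fin n → ℝ) → Matrix (Fin n) (Fin n) ℝ} (hX : SmoM Ω X)
    (hp : ∀ y ∈ Ω, 0 < (X y).det) {x} (hx : x ∈ Ω) (k : Fin n) :
    pder n k (fun y => (X y).det) x = (X x).det * ((X x)⁻¹ * dM k X x).trace := by
  let F : ContinuousMultilinearMap ℝ (fun _ : Fin n => (Fin n → ℝ)) ℝ :=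
    ⟨(Matrix.detRowAlternating (R := ℝ) (n := Fin n)).toMultilinearMap, by
      exact Continuous.matrix_det (A := fun M : Matrix (Fin n) (Fin n) ℝ => M) continuous_id⟩
  have hF : ∀ M : Fin n → Fin n → ℝ, F M = Matrix.det (M : Matrix (Fin n) (Fin n) ℝ) :=
    fun M => rfl
  have h1 : HasFDerivAt (fun y => (fun i j => X y i j : Fin n → Fin n → ℝ))
      (ContinuousLinearMap.pi fun i => ContinuousLinearMap.pi fun j =>
        fderiv ℝ (fun y => X y i j) x) x :=
    hasFDerivAt_pi.2 fun i => hasFDerivAt_pi.2 fun j => ((hX i j).diff hΩ hx).hasFDerivAt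
  have h2 := (F.hasFDerivAt (fun i j => X x i j)).comp x h1
  have h3 : pder n k (fun y => (X y).det) x
      = ∑ i, Matrix.det (Matrix.updateRow (X x) i (dM k X x i)) := by
    unfold pder
    have : (fun y => (X y).det) = F ∘ (fun y => (fun i j => X y i j : Fin n → Fin n → ℝ)) := rfl
    rw [this, h2.fderiv, ContinuousLinearMap.comp_apply, ContinuousMultilinearMap.linearDeriv_apply]
    rfl
  rw [h3]
  have h4 : ∀ i, Matrix.det (Matrix.updateRow (X x) i (dM k X x i))
      = (X x).det * (dM k X x * (X x)⁻¹) i i := by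
    intro i
    rw [← Matrix.cramer_transpose_apply, Matrix.cramer_eq_adjugate_mulVec,
      ← Matrix.adjugate_transpose, Matrix.inv_def, Ring.inverse_eq_inv']
    have := (hp x hx).ne'
    simp only [Matrix.mulVec, dotProduct, Matrix.transpose_apply, Matrix.mul_apply,
      Matrix.smul_apply, smul_eq_mul, Finset.mul_sum]
    refine Finset.sum_congr rfl fun j _ => ?_
    field_simp
  simp only [h4]
  rw [← Finset.mul_sum, Matrix.trace_mul_comm]
  rfl

end Calcu

open scoped MatrixOrder ComplexOrder Matrix.Norms.L2Operator in
lemma aux_trace_nonneg {n : ℕ} (G S : Matrix (Fin n) (Fin n) ℝ) (hG : G.PosSemidef)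
    (hS : Sᵀ = S) : 0 ≤ (G * S * G * S).trace := by
  obtain ⟨C, rfl⟩ := CStarAlgebra.nonneg_iff_eq_star_mul_self.mp hG.nonneg
  rw [Matrix.star_eq_conjTranspose] at *
  have h := (Matrix.posSemidef_self_mul_conjTranspose (C * S * Cᴴ)).trace_nonneg
  have e : (C * S * Cᴴ) * (C * S * Cᴴ)ᴴ = C * (S * Cᴴ * C * S * Cᴴ) := by
    have hS' : Sᴴ = S := by rw [← hS]; ext; simp [hS]
    simp only [conjTranspose_mul, conjTranspose_conjTranspose, hS', Matrix.mul_assoc]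
  rw [e, Matrix.trace_mul_comm] at h
  rw [show Cᴴ * C * S * (Cᴴ * C) * S = Cᴴ * (C * S * Cᴴ * C * S) by
    simp only [Matrix.mul_assoc], Matrix.trace_mul_comm]
  rw [Matrix.trace_mul_comm] at h
  simpa only [Matrix.mul_assoc] using h

lemma aux_trace_expand {n : ℕ} (G H A : Matrix (Fin n) (Fin n) ℝ) (hGH : G * H = 1)
    (hGs : Gᵀ = G) (hA : Aᵀ = A) (b v w : Fin n → ℝ) (hv : v = G *ᵥ b) (hw : w = A *ᵥ v)
    (al ka ta : ℝ) (S : Matrix (Fin n) (Fin n) ℝ)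
    (hS : S = A - al • (vecMulVec w b + vecMulVec b w) + ka • vecMulVec b b - ta • H) :
    (G * S * G * S).trace = (G * A * G * A).trace
      + 2 * al ^ 2 * ((v ⬝ᵥ w) ^ 2 + (b ⬝ᵥ v) * (w ⬝ᵥ G *ᵥ w))
      + ka ^ 2 * (b ⬝ᵥ v) ^ 2 + ta ^ 2 * n
      - 4 * al * (w ⬝ᵥ G *ᵥ w) + 2 * ka * (v ⬝ᵥ w) - 2 * ta * (G * A).trace
      - 4 * al * ka * (b ⬝ᵥ v) * (v ⬝ᵥ w) + 4 * al * ta * (v ⬝ᵥ w)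
      - 2 * ka * ta * (b ⬝ᵥ v) := by
  set u := G *ᵥ w with hu
  have hGS : G * S = G * A - al • (vecMulVec u b + vecMulVec v w) + ka • vecMulVec v b
      - ta • (1 : Matrix (Fin n) (Fin n) ℝ) := by
    rw [hS]
    simp only [Matrix.mul_sub, Matrix.mul_add, Matrix.mul_smul, Matrix.mul_vecMulVec, hGH,
      ← hv, ← hu]
  have sy : ∀ x y : Fin n → ℝ, x ⬝ᵥ G *ᵥ y = (G *ᵥ x) ⬝ᵥ y := by
    intro x y
    rw [Matrix.dotProduct_mulVec, ← Matrix.mulVec_transpose, hGs]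
  have syA : ∀ x y : Fin n → ℝ, x ⬝ᵥ A *ᵥ y = (A *ᵥ x) ⬝ᵥ y := by
    intro x y
    rw [Matrix.dotProduct_mulVec, ← Matrix.mulVec_transpose, hA]
  have e1 : b ⬝ᵥ u = v ⬝ᵥ w := by rw [hu, sy, ← hv]
  have e2 : b ⬝ᵥ (G * A) *ᵥ u = w ⬝ᵥ u := by
    rw [← Matrix.mulVec_mulVec, sy, ← hv, syA, ← hw]
  have e3 : w ⬝ᵥ (G * A) *ᵥ v = w ⬝ᵥ u := by
    rw [← Matrix.mulVec_mulVec, ← hw]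
  have e4 : b ⬝ᵥ (G * A) *ᵥ v = v ⬝ᵥ w := by
    rw [← Matrix.mulVec_mulVec, ← hw, ← hu, e1]
  have e5 : w ⬝ᵥ v = v ⬝ᵥ w := dotProduct_comm _ _
  have tv : ∀ x y : Fin n → ℝ, (vecMulVec x y).trace = y ⬝ᵥ x := by
    intro x y; rw [Matrix.trace_vecMulVec, dotProduct_comm]
  have tm : ∀ (M : Matrix (Fin n) (Fin n) ℝ) (x y : Fin n → ℝ),
      (M * vecMulVec x y).trace = y ⬝ᵥ M *ᵥ x := by
    intro M x y; rw [Matrix.mul_vecMulVec, tv]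
  have tm' : ∀ (M : Matrix (Fin n) (Fin n) ℝ) (x y : Fin n → ℝ),
      (vecMulVec x y * M).trace = y ⬝ᵥ M *ᵥ x := by
    intro M x y; rw [Matrix.trace_mul_comm, tm]
  have vv : ∀ x y z t : Fin n → ℝ, (vecMulVec x y * vecMulVec z t).trace
      = (y ⬝ᵥ z) * (t ⬝ᵥ x) := by
    intro x y z t
    rw [tm', Matrix.vecMulVec_mulVec]
    simp [dotProduct_smul, mul_comm]
  have ta1 : (G * A * (G * A)).trace = (G * A * G * A).trace := by
    simp only [Matrix.mul_assoc]
  rw [show G * S * G * S = (G * S) * (G * S) by simp only [Matrix.mul_assoc], hGS]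
  simp only [Matrix.mul_sub, Matrix.mul_add, Matrix.sub_mul, Matrix.add_mul, Matrix.mul_smul,
    Matrix.smul_mul, Matrix.trace_sub, Matrix.trace_add, Matrix.trace_smul, smul_eq_mul,
    Matrix.mul_one, Matrix.one_mul, smul_add, smul_sub, vv, tv, tm, tm', ta1, Matrix.trace_one,
    Fintype.card_fin, e1, e2, e3, e4, e5]
  ring

lemma aux_main_ineq {n : ℕ} (hn : 2 ≤ n) (G H A : Matrix (Fin n) (Fin n) ℝ) (hGH : G * H = 1)
    (hG : G.PosSemidef)
    (hGs : Gᵀ = G) (hHs : Hᵀ = H) (hA : Aᵀ = A) (b v w : Fin n → ℝ) (hv : v = G *ᵥ b)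
    (hw : w = A *ᵥ v) (P : ℝ) (hP : P = b ⬝ᵥ v) (hP0 : 0 < P)
    (hT : (G * A).trace = -((n : ℝ) + 2) * P) :
    (G * A * G * A).trace ≥ ((n : ℝ) / ((n : ℝ) - 1)) * (w ⬝ᵥ G *ᵥ w) / P
      + 2 * (n + 2) / ((n : ℝ) - 1) * (v ⬝ᵥ w)
      + (((n : ℝ) + 2) ^ 2 / ((n : ℝ) - 1)) * P ^ 2 := by
  have hn1 : (0 : ℝ) < (n : ℝ) - 1 := by
    have : (2 : ℝ) ≤ n := by exact_mod_cast hn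
    linarith
  have hn2 : (0 : ℝ) ≤ (n : ℝ) - 2 := by
    have : (2 : ℝ) ≤ n := by exact_mod_cast hn
    linarith
  -- Cauchy-Schwarz
  have cs : (v ⬝ᵥ w) ^ 2 ≤ P * (w ⬝ᵥ G *ᵥ w) := by
    have h := hG.dotProduct_mulVec_nonneg (P • w - (v ⬝ᵥ w) • b)
    have e1 : b ⬝ᵥ G *ᵥ w = v ⬝ᵥ w := by
      rw [Matrix.dotProduct_mulVec, ← Matrix.mulVec_transpose, hGs, ← hv]
    have e5 : w ⬝ᵥ v = v ⬝ᵥ w := dotProduct_comm _ _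
    simp only [star_trivial, Matrix.mulVec_sub, Matrix.mulVec_smul, dotProduct_sub,
      sub_dotProduct, smul_dotProduct, dotProduct_smul, smul_eq_mul, ← hv, e1, e5, ← hP] at h
    have : 0 ≤ P * (P * (w ⬝ᵥ G *ᵥ w) - (v ⬝ᵥ w) ^ 2) := by linarith
    have := nonneg_of_mul_nonneg_right this hP0
    linarith
  set c := v ⬝ᵥ w with hc
  set W := w ⬝ᵥ G *ᵥ w with hW
  set ta := (-((n : ℝ) + 2) * P - c / P) / ((n : ℝ) - 1) with hta
  have h0 := aux_trace_nonneg G (A - (1 / P) • (vecMulVec w b + vecMulVec b w)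
    + (c / P ^ 2 + ta / P) • vecMulVec b b - ta • H) hG (by
      simp [Matrix.transpose_vecMulVec, hA, hHs, add_comm])
  rw [aux_trace_expand G H A hGH hGs hA b v w hv hw _ _ _ _ rfl, ← hP, ← hc, ← hW, hT] at h0
  have key : (G * A * G * A).trace ≥ 2 * W / P - c ^ 2 / P ^ 2 +
      (-((n : ℝ) + 2) * P - c / P) ^ 2 / ((n : ℝ) - 1) := by
    have e : (-((n : ℝ) + 2) * P - c / P) ^ 2 / ((n : ℝ) - 1) = ta ^ 2 * ((n : ℝ) - 1) := by
      rw [hta]; field_simp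
    have e' : -((n : ℝ) + 2) * P = ta * ((n : ℝ) - 1) + c / P := by
      rw [hta]; field_simp; ring
    rw [e]
    rw [e'] at h0
    refine le_of_sub_nonneg (h0.trans (le_of_eq ?_))
    field_simp
    ring
  refine le_trans ?_ key
  have hd : 2 * W / P - c ^ 2 / P ^ 2 +
      (-((n : ℝ) + 2) * P - c / P) ^ 2 / ((n : ℝ) - 1) -
     (((n : ℝ) / ((n : ℝ) - 1)) * W / P
      + 2 * (n + 2) / ((n : ℝ) - 1) * c
      + (((n : ℝ) + 2) ^ 2 / ((n : ℝ) - 1)) * P ^ 2)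
     = ((n : ℝ) - 2) / (((n : ℝ) - 1) * P ^ 2) * (P * W - c ^ 2) := by
    field_simp
    ring
  have : 0 ≤ ((n : ℝ) - 2) / (((n : ℝ) - 1) * P ^ 2) * (P * W - c ^ 2) := by
    have : 0 ≤ P * W - c ^ 2 := by linarith
    positivity
  linarith

lemma aux_contract {n : ℕ} (G : Matrix (Fin n) (Fin n) ℝ) (hGs : ∀ i j, G i j = G j i)
    (t : Fin n → Matrix (Fin n) (Fin n) ℝ) (q : Fin n → Fin n → Matrix (Fin n) (Fin n) ℝ)
    (ht1 : ∀ k i j, t k i j = t k j i) (ht2 : ∀ k i j, t k i j = t i k j)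
    (hq : ∀ k l i j, q k l i j = q i j k l)
    (htr : ∀ k l, (G * q k l).trace = (G * t l * G * t k).trace) (v : Fin n → ℝ) :
    ∑ k, ∑ l, G k l * (-(v ⬝ᵥ q k l *ᵥ v) + 2 * (v ⬝ᵥ (t k * G * t l) *ᵥ v))
      = (G * (∑ p, v p • t p) * G * (∑ p, v p • t p)).trace := by
  set A := ∑ p, v p • t p with hA
  have h1 : ∑ k, ∑ l, G k l * (v ⬝ᵥ q k l *ᵥ v) = (G * A * G * A).trace := by
    have : (G * A * G * A).trace = ∑ i, ∑ j, v i * v j * (G * q i j).trace := by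
      simp only [htr, hA, Finset.mul_sum, Finset.sum_mul, Matrix.trace_sum, Matrix.mul_smul,
        Matrix.smul_mul, Matrix.trace_smul, smul_eq_mul]
      simp only [mul_assoc]
    rw [this]
    simp only [Matrix.trace, Matrix.diag, Matrix.mul_apply, dotProduct, Matrix.mulVec,
      Finset.mul_sum]
    have : ∀ i j : Fin n, ∑ x, ∑ y, v i * v j * (G x y * q i j y x)
        = ∑ x, ∑ y, G x y * (v i * (q x y i j * v j)) := by
      intro i j
      rw [Finset.sum_comm]
      refine Finset.sum_congr rfl fun x _ => Finset.sum_congr rfl fun y _ => ?_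
      rw [hq x y, hGs y x]; ring
    simp only [this]
    rw [Finset.sum_congr rfl fun i _ => Finset.sum_comm]
    rw [Finset.sum_comm]
    rw [Finset.sum_congr rfl fun i _ => Finset.sum_congr rfl fun j _ => Finset.sum_comm]
    rw [Finset.sum_congr rfl fun i _ => Finset.sum_comm]
  have hr : ∀ k i, (t k *ᵥ v) i = A k i := by
    intro k i
    simp only [hA, Matrix.sum_apply, Matrix.smul_apply, smul_eq_mul, Matrix.mulVec, dotProduct]
    refine Finset.sum_congr rfl fun p _ => ?_
    rw [ht1 k i p, ht2 k p i]; ring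
  have hAs : ∀ i j, A i j = A j i := by
    intro i j
    simp only [hA, Matrix.sum_apply, Matrix.smul_apply]
    exact Finset.sum_congr rfl fun p _ => by rw [ht1]
  have h2 : ∑ k, ∑ l, G k l * (v ⬝ᵥ (t k * G * t l) *ᵥ v) = (G * A * G * A).trace := by
    have : ∀ k l, v ⬝ᵥ (t k * G * t l) *ᵥ v = (A * G * A) k l := by
      intro k l
      rw [← Matrix.mulVec_mulVec, ← Matrix.mulVec_mulVec, Matrix.dotProduct_mulVec,
        ← Matrix.mulVec_transpose, show (t k)ᵀ = t k from by ext i j; exact ht1 k j i,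
        Matrix.mul_assoc, Matrix.mul_apply]
      rw [show t k *ᵥ v = A k from funext (hr k), show t l *ᵥ v = A l from funext (hr l)]
      simp only [dotProduct, Matrix.mulVec, Matrix.mul_apply, hAs l]
    simp only [this]
    rw [show G * A * G * A = G * (A * G * A) by simp only [Matrix.mul_assoc]]
    simp only [Matrix.trace, Matrix.diag, Matrix.mul_apply (M := G)]
    rw [Finset.sum_comm]
    refine Finset.sum_congr rfl fun x _ => Finset.sum_congr rfl fun y _ => ?_
    rw [hGs]
  simp only [mul_add, Finset.sum_add_distrib, mul_neg, Finset.sum_neg_distrib, h1,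
    mul_left_comm _ (2 : ℝ), ← Finset.mul_sum, h2]
  ring


section Geo
variable {n : ℕ} {Ω : Set (Fin n → ℝ)} {f : (Fin n → ℝ) → ℝ}

lemma geo_hess_smo (hΩ : IsOpen Ω) (hf : Smo Ω f) : SmoM Ω (Hess n f) :=
  fun i j => (hf.pder hΩ j).pder hΩ i

lemma geo_t1 (hΩ : IsOpen Ω) (hf : Smo Ω f) {x} (hx : x ∈ Ω) (k i j : Fin n) :
    dM k (Hess n f) x i j = dM k (Hess n f) x j i :=
  pder_congr hΩ (fun _ hy => pder_symm hΩ hf hy i j) hx k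

lemma geo_t2 (hΩ : IsOpen Ω) (hf : Smo Ω f) {x} (hx : x ∈ Ω) (k i j : Fin n) :
    dM k (Hess n f) x i j = dM i (Hess n f) x k j :=
  pder_symm hΩ (hf.pder hΩ j) hx k i

/-- Second derivatives of the Hessian. -/
noncomputable def QQ (f : (Fin n → ℝ) → ℝ) (x : Fin n → ℝ) (k l : Fin n) :
    Matrix (Fin n) (Fin n) ℝ := dM l (dM k (Hess n f)) x

lemma geo_q (hΩ : IsOpen Ω) (hf : Smo Ω f) {x} (hx : x ∈ Ω) (k l i j : Fin n) :
    QQ f x k l i j = QQ f x i j k l := by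
  have s12 : ∀ k l i j : Fin n, QQ f x k l i j = QQ f x l k i j := fun k l i j =>
    pder_symm hΩ ((hf.pder hΩ j).pder hΩ i) hx l k
  have s23 : ∀ k l i j : Fin n, QQ f x k l i j = QQ f x i l k j := fun k l i j =>
    pder_congr hΩ (fun y hy => geo_t2 hΩ hf hy k i j) hx l
  have s34 : ∀ k l i j : Fin n, QQ f x k l i j = QQ f x k l j i := fun k l i j =>
    pder_congr hΩ (fun y hy => geo_t1 hΩ hf hy k i j) hx l
  rw [s23 k l i j, s12 i l k j, s34 l i k j, s23 l i j k, s12 j i l k, s34 i j l k]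

lemma geo_loga (hΩ : IsOpen Ω) (hf : Smo Ω f) (hp : ∀ y ∈ Ω, 0 < (Hess n f y).det)
    {x} (hx : x ∈ Ω) (k : Fin n) :
    pder n k (fun y => Real.log (Hess n f y).det) x
      = ((Hess n f x)⁻¹ * dM k (Hess n f) x).trace := by
  rw [pder_log hΩ (geo_hess_smo hΩ hf).det hp hx, pder_det hΩ (geo_hess_smo hΩ hf) hp hx]
  have := (hp x hx).ne'
  field_simp

lemma geo_tr (hΩ : IsOpen Ω) (hf : Smo Ω f) (hp : ∀ y ∈ Ω, 0 < (Hess n f y).det)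
    (hric : ∀ x ∈ Ω, ∀ i j : Fin n,
      pder n i (pder n j (fun y => Real.log (Hess n f y).det)) x = 0)
    {x} (hx : x ∈ Ω) (k l : Fin n) :
    ((Hess n f x)⁻¹ * QQ f x k l).trace
      = ((Hess n f x)⁻¹ * dM l (Hess n f) x * (Hess n f x)⁻¹ * dM k (Hess n f) x).trace := by
  have hH := geo_hess_smo hΩ hf
  have h := hric x hx l k
  rw [pder_congr hΩ (fun y hy => geo_loga hΩ hf hp hy k) hx,
    pder_trace hΩ ((hH.inv hp).mul (hH.dM hΩ k)) hx,
    dM_mul hΩ (hH.inv hp) (hH.dM hΩ k) hx, dM_inv hΩ hH hp hx, Matrix.trace_add,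
    Matrix.neg_mul, Matrix.trace_neg] at h
  unfold QQ
  linarith

lemma geo_lap (hΩ : IsOpen Ω) (hf : Smo Ω f) (hp : ∀ y ∈ Ω, 0 < (Hess n f y).det)
    (hGs : ∀ y ∈ Ω, ∀ i j, (Hess n f y)⁻¹ i j = (Hess n f y)⁻¹ j i)
    {u : (Fin n → ℝ) → ℝ} (hu : Smo Ω u) {x} (hx : x ∈ Ω) :
    lapBel n f u x = ∑ i, ∑ j, (Hess n f x)⁻¹ i j * pder n i (pder n j u) x
      - (1 / 2) * ∑ i, ∑ j, (Hess n f x)⁻¹ i j *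
        pder n i (fun y => Real.log (Hess n f y).det) x * pder n j u x := by
  have hH := geo_hess_smo hΩ hf
  have hG := hH.inv hp
  set a : Fin n → ℝ := fun i => pder n i (fun y => Real.log (Hess n f y).det) x with ha
  have h1 : ∀ i, pder n i (fun y => (Hess n f y).det ^ ((1 : ℝ) / 2) *
      ∑ j, (Hess n f y)⁻¹ i j * pder n j u y) x
      = (Hess n f x).det ^ ((1 : ℝ) / 2) * (∑ j, ((1 / 2) * ((Hess n f x)⁻¹ i j * a i * pder n j u x)
        - ((Hess n f x)⁻¹ * dM i (Hess n f) x * (Hess n f x)⁻¹) i j * pder n j u x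
        + (Hess n f x)⁻¹ i j * pder n i (pder n j u) x)) := by
    intro i
    rw [pder_mul hΩ (hH.det.rpow hp _) (Smo.sum fun j => (hG i j).mul (hu.pder hΩ j)) hx,
      pder_sum hΩ (fun j => (hG i j).mul (hu.pder hΩ j)) hx, pder_rpow hΩ hH.det hp _ hx,
      mul_assoc, ← mul_add]
    congr 1
    rw [Finset.mul_sum, ← Finset.sum_add_distrib]
    refine Finset.sum_congr rfl fun j _ => ?_
    rw [pder_mul hΩ (hG i j) (hu.pder hΩ j) hx]
    have := congrFun (congrFun (dM_inv hΩ hH hp hx i) i) j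
    simp only [dM, Matrix.of_apply, Matrix.neg_apply] at this
    rw [this]
    simp only [ha, dM]
    ring
  have h2 : ∀ j, ∑ i, ((Hess n f x)⁻¹ * dM i (Hess n f) x * (Hess n f x)⁻¹) i j
      = ∑ i, (Hess n f x)⁻¹ i j * a i := by
    intro j
    simp only [Matrix.mul_apply, Finset.sum_mul]
    rw [Finset.sum_comm]
    refine Finset.sum_congr rfl fun q _ => ?_
    rw [ha]
    simp only
    rw [geo_loga hΩ hf hp hx]
    simp only [Matrix.trace, Matrix.diag, Matrix.mul_apply, Finset.mul_sum]
    refine Finset.sum_congr rfl fun i _ => Finset.sum_congr rfl fun p _ => ?_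
    rw [geo_t1 hΩ hf hx i p q, geo_t2 hΩ hf hx i q p, geo_t1 hΩ hf hx q i p]
    ring
  unfold lapBel
  simp only [h1]
  rw [← Finset.mul_sum, ← mul_assoc, ← Real.rpow_add (hp x hx)]
  norm_num only [Real.rpow_zero, one_mul]
  simp only [Finset.sum_add_distrib, Finset.sum_sub_distrib]
  have h3 : ∑ i, ∑ j, ((Hess n f x)⁻¹ * dM i (Hess n f) x * (Hess n f x)⁻¹) i j * pder n j u x
      = ∑ i, ∑ j, (Hess n f x)⁻¹ i j * a i * pder n j u x := by
    rw [Finset.sum_comm]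
    simp only [← Finset.sum_mul, h2]
    simp only [Finset.sum_mul]
    rw [Finset.sum_comm]
  rw [h3]
  simp only [← Finset.mul_sum]
  ring

/-- Gradient of `log ρ`. -/
noncomputable def bb (f : (Fin n → ℝ) → ℝ) (x : Fin n → ℝ) : Fin n → ℝ :=
  fun j => pder n j (fun y => Real.log (rho n f y)) x

lemma geo_b (hΩ : IsOpen Ω) (hf : Smo Ω f) (hp : ∀ y ∈ Ω, 0 < (Hess n f y).det)
    {x} (hx : x ∈ Ω) (j : Fin n) :
    bb f x j = (-(1 : ℝ) / ((n : ℝ) + 2)) * pder n j (fun y => Real.log (Hess n f y).det) x := by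
  unfold bb rho
  rw [pder_congr hΩ (fun y hy => Real.log_rpow (hp y hy) _) hx,
    pder_const_mul hΩ _ ((geo_hess_smo hΩ hf).det.log hp) hx]

lemma geo_b_smo (hΩ : IsOpen Ω) (hf : Smo Ω f) (hp : ∀ y ∈ Ω, 0 < (Hess n f y).det) :
    SmoV Ω (bb f) := fun j =>
  Smo.congr (Smo.mul contDiffOn_const (((geo_hess_smo hΩ hf).det.log hp).pder hΩ j))
    fun _ hy => geo_b hΩ hf hp hy j

lemma geo_db (hΩ : IsOpen Ω) (hf : Smo Ω f) (hp : ∀ y ∈ Ω, 0 < (Hess n f y).det)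
    (hric : ∀ x ∈ Ω, ∀ i j : Fin n,
      pder n i (pder n j (fun y => Real.log (Hess n f y).det)) x = 0)
    {x} (hx : x ∈ Ω) (k : Fin n) : dV k (bb f) x = 0 := by
  ext j
  simp only [dV, Pi.zero_apply]
  rw [pder_congr hΩ (fun y hy => geo_b hΩ hf hp hy j) hx,
    pder_const_mul hΩ _ (((geo_hess_smo hΩ hf).det.log hp).pder hΩ j) hx, hric x hx, mul_zero]

lemma geo_gi (u v : (Fin n → ℝ) → ℝ) (x) : gradInner n f u v x
    = (fun i => pder n i u x) ⬝ᵥ ((Hess n f x)⁻¹ *ᵥ (fun i => pder n i v x)) := by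
  simp only [gradInner, dotProduct, Matrix.mulVec, Finset.mul_sum]
  exact Finset.sum_congr rfl fun i _ => Finset.sum_congr rfl fun j _ => by ring

lemma geo_phi (hΩ : IsOpen Ω) (hf : Smo Ω f) (hp : ∀ y ∈ Ω, 0 < (Hess n f y).det)
    {x} (hx : x ∈ Ω) : Phi n f x = bb f x ⬝ᵥ ((Hess n f x)⁻¹ *ᵥ bb f x) := by
  have h0 : 0 < rho n f x := Real.rpow_pos_of_pos (hp x hx) _
  have h1 : (fun i => pder n i (rho n f) x) = rho n f x • bb f x := by
    ext i
    rw [Pi.smul_apply, geo_b hΩ hf hp hx i]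
    exact pder_rpow hΩ (geo_hess_smo hΩ hf).det hp _ hx i
  unfold Phi
  rw [geo_gi, h1, Matrix.mulVec_smul, smul_dotProduct, dotProduct_smul]
  simp only [smul_eq_mul]
  field_simp

lemma geo_main (hn : 2 ≤ n) (hΩ : IsOpen Ω) (hf : Smo Ω f)
    (hpos : ∀ x ∈ Ω, (Hess n f x).PosDef)
    (hric : ∀ x ∈ Ω, ∀ i j : Fin n,
      pder n i (pder n j (fun y => Real.log (Hess n f y).det)) x = 0) {p} (hx : p ∈ Ω) :
      (0 < Phi n f p →
        lapBel n f (Phi n f) p ≥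
          ((n : ℝ) / ((n : ℝ) - 1)) * gradInner n f (Phi n f) (Phi n f) p / Phi n f p +
          (((n : ℝ) ^ 2 - 3 * (n : ℝ) - 10) / (2 * ((n : ℝ) - 1))) *
            gradInner n f (Phi n f) (fun y => Real.log (rho n f y)) p +
          (((n : ℝ) + 2) ^ 2 / ((n : ℝ) - 1)) * (Phi n f p) ^ 2) ∧
      (Phi n f p = 0 → lapBel n f (Phi n f) p ≥ 0) := by
  have hp : ∀ y ∈ Ω, 0 < (Hess n f y).det := fun y hy => (hpos y hy).det_pos
  have hH := geo_hess_smo hΩ hf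
  have hGsm := hH.inv hp
  have hbs := geo_b_smo hΩ hf hp
  have hHT : ∀ y ∈ Ω, (Hess n f y)ᵀ = Hess n f y := fun y hy => by
    ext i j; exact pder_symm hΩ hf hy j i
  have hGT : ∀ y ∈ Ω, ((Hess n f y)⁻¹)ᵀ = (Hess n f y)⁻¹ := fun y hy => by
    rw [Matrix.transpose_nonsing_inv, hHT y hy]
  have hGs : ∀ y ∈ Ω, ∀ i j, (Hess n f y)⁻¹ i j = (Hess n f y)⁻¹ j i := fun y hy i j => by
    conv_lhs => rw [← hGT y hy, Matrix.transpose_apply]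
  have hGH : (Hess n f p)⁻¹ * Hess n f p = 1 := Matrix.nonsing_inv_mul _ (hp p hx).ne'.isUnit
  -- the vector field v
  let v : (Fin n → ℝ) → (Fin n → ℝ) := fun y => (Hess n f y)⁻¹ *ᵥ bb f y
  have hvs : SmoV Ω v := hGsm.mulVec hbs
  have hdv : ∀ y ∈ Ω, ∀ k, dV k v y = -(((Hess n f y)⁻¹ * dM k (Hess n f) y) *ᵥ v y) := by
    intro y hy k
    rw [dV_mulVec hΩ hGsm hbs hy, geo_db hΩ hf hp hric hy, dM_inv hΩ hH hp hy,
      Matrix.mulVec_zero, add_zero, Matrix.neg_mulVec, ← Matrix.mulVec_mulVec]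
  have hPhis : Smo Ω (Phi n f) := Smo.congr (hbs.dot hvs) fun y hy => geo_phi hΩ hf hp hy
  have sy : ∀ (M : Matrix (Fin n) (Fin n) ℝ), Mᵀ = M → ∀ a c : Fin n → ℝ,
      a ⬝ᵥ M *ᵥ c = (M *ᵥ a) ⬝ᵥ c := by
    intro M hM a c
    rw [Matrix.dotProduct_mulVec, ← Matrix.mulVec_transpose, hM]
  have hTT : ∀ y ∈ Ω, ∀ k, (dM k (Hess n f) y)ᵀ = dM k (Hess n f) y := fun y hy k => by
    ext i j; exact geo_t1 hΩ hf hy k j i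
  have hP1 : ∀ y ∈ Ω, ∀ k, pder n k (Phi n f) y = -(v y ⬝ᵥ dM k (Hess n f) y *ᵥ v y) := by
    intro y hy k
    rw [pder_congr hΩ (fun z hz => geo_phi hΩ hf hp hz) hy, pder_dot hΩ hbs hvs hy,
      geo_db hΩ hf hp hric hy, zero_dotProduct, zero_add, hdv y hy, dotProduct_neg,
      ← Matrix.mulVec_mulVec, sy _ (hGT y hy)]
  have hP2 : ∀ k l, pder n l (pder n k (Phi n f)) p = -(v p ⬝ᵥ QQ f p k l *ᵥ v p)
      + 2 * (v p ⬝ᵥ (dM k (Hess n f) p * (Hess n f p)⁻¹ * dM l (Hess n f) p) *ᵥ v p) := by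
    intro k l
    have hTv : SmoV Ω (fun y => dM k (Hess n f) y *ᵥ v y) := (hH.dM hΩ k).mulVec hvs
    rw [pder_congr hΩ (v := fun y => (-1) * (v y ⬝ᵥ dM k (Hess n f) y *ᵥ v y))
      (fun y hy => by rw [hP1 y hy k]; ring) hx, pder_const_mul hΩ _ (hvs.dot hTv) hx,
      pder_dot hΩ hvs hTv hx, dV_mulVec hΩ (hH.dM hΩ k) hvs hx, hdv p hx]
    simp only [neg_dotProduct, dotProduct_add, Matrix.mulVec_neg, dotProduct_neg,
      ← Matrix.mulVec_mulVec]
    rw [dotProduct_comm ((Hess n f p)⁻¹ *ᵥ dM l (Hess n f) p *ᵥ v p),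
      ← sy _ (hTT p hx k)]
    unfold QQ
    ring
  set G := (Hess n f p)⁻¹ with hG
  have hGs' : ∀ i j, G i j = G j i := hGs p hx
  set b := bb f p with hb
  set t := fun k => dM k (Hess n f) p with ht
  set w0 := v p with hw0
  set A := ∑ q, w0 q • t q with hA
  have hcon := aux_contract G (hGs p hx) t (QQ f p) (geo_t1 hΩ hf hx) (geo_t2 hΩ hf hx)
    (geo_q hΩ hf hx) (geo_tr hΩ hf hp hric hx) w0
  have hAT : Aᵀ = A := by
    rw [hA, Matrix.transpose_sum]
    exact Finset.sum_congr rfl fun q _ => by rw [Matrix.transpose_smul, hTT p hx]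
  have ha : ∀ k, pder n k (fun y => Real.log (Hess n f y).det) p = -((n : ℝ) + 2) * b k := by
    intro k
    rw [hb, geo_b hΩ hf hp hx]
    have : (n : ℝ) + 2 ≠ 0 := by positivity
    field_simp
  have hgrad : (fun k => pder n k (Phi n f) p) = -(A *ᵥ w0) := by
    ext k
    rw [hP1 p hx k, Pi.neg_apply]
    congr 1
    rw [hA]
    simp only [dotProduct, Matrix.mulVec, Matrix.sum_apply, Matrix.smul_apply, smul_eq_mul,
      Finset.sum_mul, Finset.mul_sum]
    rw [Finset.sum_comm]
    refine Finset.sum_congr rfl fun i _ => Finset.sum_congr rfl fun j _ => ?_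
    rw [geo_t2 hΩ hf hx k j i, mul_assoc]
  have hgb : gradInner n f (Phi n f) (fun y => Real.log (rho n f y)) p
      = -(w0 ⬝ᵥ A *ᵥ w0) := by
    rw [geo_gi, hgrad, neg_dotProduct, dotProduct_comm]
    rfl
  have hgg : gradInner n f (Phi n f) (Phi n f) p = (A *ᵥ w0) ⬝ᵥ G *ᵥ (A *ᵥ w0) := by
    rw [geo_gi, hgrad, Matrix.mulVec_neg, neg_dotProduct_neg]
  have hlap : lapBel n f (Phi n f) p = (G * A * G * A).trace
      + ((n : ℝ) + 2) / 2 * gradInner n f (Phi n f) (fun y => Real.log (rho n f y)) p := by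
    rw [geo_lap hΩ hf hp hGs hPhis hx, ← hcon]
    have e1 : ∑ i, ∑ j, G i j * pder n i (pder n j (Phi n f)) p
        = ∑ k, ∑ l, G k l * (-(w0 ⬝ᵥ QQ f p k l *ᵥ w0) + 2 * (w0 ⬝ᵥ (t k * G * t l) *ᵥ w0)) := by
      rw [Finset.sum_comm]
      refine Finset.sum_congr rfl fun k _ => Finset.sum_congr rfl fun l _ => ?_
      rw [hP2 k l, hGs' l k]
    rw [e1]
    have e2 : ∑ i, ∑ j, G i j * pder n i (fun y => Real.log (Hess n f y).det) p *
        pder n j (Phi n f) p = -((n : ℝ) + 2) *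
          gradInner n f (Phi n f) (fun y => Real.log (rho n f y)) p := by
      unfold gradInner
      rw [Finset.sum_comm, Finset.mul_sum]
      refine Finset.sum_congr rfl fun k _ => ?_
      rw [Finset.mul_sum]
      refine Finset.sum_congr rfl fun l _ => ?_
      rw [ha l, hGs p hx]
      simp only [hb, bb]
      ring
    rw [e2]
    ring
  have hGps : G.PosDef := (hpos p hx).inv
  have hPhi : Phi n f p = b ⬝ᵥ w0 := geo_phi hΩ hf hp hx
  constructor
  · intro hP0
    have hT : (G * A).trace = -((n : ℝ) + 2) * Phi n f p := by
      rw [hPhi, hA]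
      simp only [Matrix.mul_sum, Matrix.mul_smul, Matrix.trace_sum, Matrix.trace_smul, smul_eq_mul,
        dotProduct, Finset.mul_sum]
      refine Finset.sum_congr rfl fun q _ => ?_
      have := geo_loga hΩ hf hp hx q
      rw [ha] at this
      rw [ht, hG, ← this]
      ring
    have key := aux_main_ineq hn G (Hess n f p) A hGH hGps.posSemidef (hGT p hx) (hHT p hx) hAT b
      w0 (A *ᵥ w0) rfl rfl (Phi n f p) hPhi hP0 hT
    rw [hlap, hgg, hgb]
    have hn1 : (0 : ℝ) < (n : ℝ) - 1 := by
      have : (2 : ℝ) ≤ n := by exact_mod_cast hn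
      linarith
    have e : (((n : ℝ) ^ 2 - 3 * (n : ℝ) - 10) / (2 * ((n : ℝ) - 1))) * -(w0 ⬝ᵥ A *ᵥ w0)
      = 2 * (n + 2) / ((n : ℝ) - 1) * (w0 ⬝ᵥ A *ᵥ w0)
        + ((n : ℝ) + 2) / 2 * -(w0 ⬝ᵥ A *ᵥ w0) := by
      field_simp
      ring
    rw [e]
    linarith
  · intro hP0
    have hb0 : w0 = 0 := by
      have := (hGps.posSemidef.dotProduct_mulVec_zero_iff b).1 (by
        rw [star_trivial]; rw [hPhi] at hP0; exact hP0)
      exact this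
    rw [hlap, hgb, hb0]
    have := aux_trace_nonneg G A hGps.posSemidef hAT
    simpa using this

end Geo

/-- **Proposition 1 (paper).** For an affine Kähler Ricci flat potential `f` on `Ω ⊆ ℝⁿ`
(`n ≥ 2`), at every point where `Φ > 0`,
`Δ_g Φ ≥ (n/(n−1))‖∇Φ‖²_g/Φ + ((n²−3n−10)/(2(n−1)))⟨∇Φ, ∇log ρ⟩_g + ((n+2)²/(n−1))Φ²`,
and at every point where `Φ = 0`, `Δ_g Φ ≥ 0`. -/
theorem laplacian_Phi_estimate_ricci_flat
    (n : ℕ) (hn : 2 ≤ n) (Ω : Set (Fin n → ℝ)) (hΩ : IsOpen Ω)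
    (f : (Fin n → ℝ) → ℝ) (hf : ContDiffOn ℝ (⊤ : ℕ∞) f Ω)
    (hpos : ∀ x ∈ Ω, (Hess n f x).PosDef)
    (hric : ∀ x ∈ Ω, ∀ i j : Fin n,
      pder n i (pder n j (fun y => Real.log (Hess n f y).det)) x = 0) :
    ∀ p ∈ Ω,
      (0 < Phi n f p →
        lapBel n f (Phi n f) p ≥
          ((n : ℝ) / ((n : ℝ) - 1)) * gradInner n f (Phi n f) (Phi n f) p / Phi n f p +
          (((n : ℝ) ^ 2 - 3 * (n : ℝ) - 10) / (2 * ((n : ℝ) - 1))) *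
            gradInner n f (Phi n f) (fun y => Real.log (rho n f y)) p +
          (((n : ℝ) + 2) ^ 2 / ((n : ℝ) - 1)) * (Phi n f p) ^ 2) ∧
      (Phi n f p = 0 → lapBel n f (Phi n f) p ≥ 0) := by
  exact fun p hp => geo_main hn hΩ hf hpos hric hp
end
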